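/- arXiv:1402.4299 — 7 statements merged into one kernel-verified Lean document; each statement's English description precedes it below -/
import Mathlib

section
/- Let k be a field and R a commutative k-algebra. If R is a k-subalgebra of a finitely generated k-algebra that is an integral domain, then the finite generation ideal f_R of R is nonzero, i.e., there exists a nonzero f ∈ R such that the localization R_f is a finitely generated k-algebra. -/
universe u v

/-- Let `B` be the localization of `R` away from `f`, mapping injectively to a field `L`. If finitely
many elements of `L` become integral over `R` after multiplication by `f` and generate a
`k`-subalgebra containing the image of `R`, then `B` is a finitely generated `k`-algebra. -/
theorem IsLocalization.Away.finiteType_of_isIntegral_smul {k R B L : Type*} [Field k] [CommRing R]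
    [CommRing B] [Field L] [Algebra R B] [Algebra R L] [Algebra k B] [Algebra k L]
    [Algebra B L] [IsScalarTower R B L] [IsScalarTower k B L]
    (f : R) [IsLocalization.Away f B] (hinj : Function.Injective (algebraMap B L)) (s : Finset L)
    (hs_int : ∀ x ∈ s, IsIntegral R (f • x))
    (hs : ∀ r : R, algebraMap R L r ∈ Algebra.adjoin k (s : Set L)) :
    Algebra.FiniteType k B := by
  let C := Algebra.adjoin B (s : Set L)
  have hmul : algebraMap R L f * algebraMap B L (IsLocalization.Away.invSelf f) = 1 := by
    rw [IsScalarTower.algebraMap_apply R B L, ← map_mul, IsLocalization.Away.mul_invSelf, map_one]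
  have hfL : algebraMap R L f ≠ 0 := left_ne_zero_of_mul_eq_one hmul
  have hinv : algebraMap B L (IsLocalization.Away.invSelf f) = (algebraMap R L f)⁻¹ :=
    eq_inv_of_mul_eq_one_right hmul
  have hC : C.restrictScalars k = Algebra.adjoin k (insert (algebraMap R L f)⁻¹ (s : Set L)) := by
    refine le_antisymm (fun x (hx : x ∈ Algebra.adjoin B (s : Set L)) => ?_)
      (Algebra.adjoin_le ?_)
    · refine Algebra.adjoin_induction
        (p := fun x _ => x ∈ Algebra.adjoin k (insert (algebraMap R L f)⁻¹ (s : Set L)))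
        (fun x hx => Algebra.subset_adjoin (Set.mem_insert_of_mem _ hx)) (fun b => ?_)
        (fun _ _ _ _ hx hy => add_mem hx hy) (fun _ _ _ _ hx hy => mul_mem hx hy) hx
      obtain ⟨n, r, hr⟩ := IsLocalization.Away.surj f b
      have hb : algebraMap B L b = algebraMap R L r * (algebraMap R L f)⁻¹ ^ n := by
        rw [inv_pow, eq_mul_inv_iff_mul_eq₀ (pow_ne_zero _ hfL),
          IsScalarTower.algebraMap_apply R B L, IsScalarTower.algebraMap_apply R B L, ← hr,
          map_mul, map_pow]
      rw [hb]
      exact mul_mem (Algebra.adjoin_mono (Set.subset_insert _ _) (hs r))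
        (pow_mem (Algebra.subset_adjoin (Set.mem_insert _ _)) n)
    · have hinvC : (algebraMap R L f)⁻¹ ∈ C := hinv ▸ C.algebraMap_mem _
      have hsC : (s : Set L) ⊆ C := Algebra.subset_adjoin
      exact Set.insert_subset hinvC hsC
  have hsB (x : L) (hx : x ∈ (s : Set L)) : IsIntegral B x := by
    have h := ((hs_int x hx).tower_top (A := B)).smul (IsLocalization.Away.invSelf f : B)
    rwa [Algebra.smul_def, Algebra.smul_def, hinv, inv_mul_cancel_left₀ hfL] at h
  have hfin : (⊤ : Submodule B C).FG :=
    (Submodule.fg_top _).mpr (fg_adjoin_of_finite s.finite_toSet hsB)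
  have hft : (⊤ : Subalgebra k C).FG := by
    refine (C.restrictScalars k).fg_top.mpr ?_
    rw [hC]
    exact Subalgebra.fg_def.mpr ⟨_, s.finite_toSet.insert _, rfl⟩
  exact ⟨fg_of_fg_of_fg k B C hft hfin (.of_comp (f := C.val) hinj)⟩

/-- If the image of `R` in an algebraic field extension `L` is contained in a finitely generated
`k`-subalgebra, then `R` becomes finitely generated after inverting a single nonzero element. -/
theorem exists_finiteType_away_of_isAlgebraic {k R L : Type*} [Field k] [CommRing R] [IsDomain R]
    [Field L] [Algebra k R] [Algebra R L] [Algebra k L] [IsScalarTower k R L]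
    [Algebra.IsAlgebraic R L] (hinj : Function.Injective (algebraMap R L)) (s : Finset L)
    (hs : ∀ r : R, algebraMap R L r ∈ Algebra.adjoin k (s : Set L)) :
    ∃ f : R, f ≠ 0 ∧ Algebra.FiniteType k (Localization.Away f) := by
  obtain ⟨f, hf, hs_int⟩ := Algebra.IsAlgebraic.exists_integral_multiples R s
  refine ⟨f, hf, ?_⟩
  have hfL : algebraMap R L f ≠ 0 := (map_ne_zero_iff _ hinj).mpr hf
  let φ : Localization.Away f →+* L := IsLocalization.Away.lift f hfL.isUnit
  have hφ (r : R) : φ (algebraMap R _ r) = algebraMap R L r := IsLocalization.Away.lift_eq f _ r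
  let : Algebra (Localization.Away f) L := φ.toAlgebra
  have : IsScalarTower R (Localization.Away f) L := .of_algebraMap_eq fun r => (hφ r).symm
  have : IsScalarTower k (Localization.Away f) L := .of_algebraMap_eq fun r => by
    rw [IsScalarTower.algebraMap_apply k R L,
      IsScalarTower.algebraMap_apply k R (Localization.Away f),
      ← IsScalarTower.algebraMap_apply R (Localization.Away f) L]
  have hφinj : Function.Injective φ :=
    (IsLocalization.lift_injective_iff _).mpr fun x y =>
      ⟨fun h => by rw [IsLocalization.injective (Localization.Away f)
        (powers_le_nonZeroDivisors_of_noZeroDivisors hf) h], fun h => by rw [hinj h]⟩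
  exact IsLocalization.Away.finiteType_of_isIntegral_smul (L := L) f hφinj s hs_int hs

/-- A nontrivial finitely generated algebra over a field maps to a finite field extension. -/
theorem exists_algHom_finite_field (K : Type u) {T : Type v} [Field K] [CommRing T] [Nontrivial T]
    [Algebra K T] [Algebra.FiniteType K T] :
    ∃ (L : Type v) (_ : Field L) (_ : Algebra K L) (_ : T →ₐ[K] L), Module.Finite K L := by
  obtain ⟨M, hM⟩ := Ideal.exists_maximal T
  let := Ideal.Quotient.field M
  exact ⟨T ⧸ M, inferInstance, inferInstance, Ideal.Quotient.mkₐ K M,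
    finite_of_finite_type_of_isJacobsonRing K (T ⧸ M)⟩

/-- A finitely generated algebra `A` containing a domain `R` maps over `R` to a field which is
algebraic over `R` and contains `R`. -/
theorem exists_algHom_isAlgebraic_field (R : Type u) (A : Type v) [CommRing R] [IsDomain R]
    [CommRing A] [Algebra R A] [Algebra.FiniteType R A] (hinj : Function.Injective (algebraMap R A)) :
    ∃ (L : Type (max u v)) (_ : Field L) (_ : Algebra R L) (_ : A →ₐ[R] L),
      Algebra.IsAlgebraic R L ∧ Function.Injective (algebraMap R L) := by
  let K := FractionRing R
  have : Nontrivial (TensorProduct R K A) :=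
    ((Module.Flat.lTensor_preserves_injective_linearMap (M := K) (Algebra.linearMap R A)
      hinj).comp (TensorProduct.rid R K).symm.injective).nontrivial
  obtain ⟨L, _, _, g, _⟩ := exists_algHom_finite_field K (T := TensorProduct R K A)
  let : Algebra R L := Algebra.compHom L (algebraMap R K)
  have : IsScalarTower R K L := .of_algebraMap_eq fun _ => rfl
  refine ⟨L, inferInstance, inferInstance,
    (g.restrictScalars R).comp Algebra.TensorProduct.includeRight,
    (IsFractionRing.comap_isAlgebraic_iff (K := K)).mpr inferInstance, ?_⟩
  exact (algebraMap K L).injective.comp (IsFractionRing.injective R K)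

/-- If `R` is a `k`-subalgebra of a finitely generated `k`-algebra `A` that is an integral
domain, then the finite generation ideal of `R` is nonzero: there is a nonzero `f ∈ R` such
that the localization `R_f` is a finitely generated `k`-algebra. -/
theorem stmt_1 (k A : Type*) [Field k] [CommRing A] [IsDomain A] [Algebra k A]
    [Algebra.FiniteType k A] (R : Subalgebra k A) :
    ∃ f : R, f ≠ 0 ∧ Algebra.FiniteType k (Localization.Away f) := by
  classical
  have : Algebra.FiniteType R A := .of_restrictScalars_finiteType k R A
  obtain ⟨L, _, _, g, _, hRL⟩ := exists_algHom_isAlgebraic_field R A Subtype.val_injective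
  let : Algebra k L := Algebra.compHom L (algebraMap k R)
  have : IsScalarTower k R L := .of_algebraMap_eq fun _ => rfl
  obtain ⟨s, hs⟩ := Algebra.FiniteType.out (R := k) (A := A)
  refine exists_finiteType_away_of_isAlgebraic hRL (s.image g) fun r => ?_
  have h : g.restrictScalars k r ∈ (Algebra.adjoin k (s : Set A)).map (g.restrictScalars k) :=
    ⟨r, hs ▸ Algebra.mem_top, rfl⟩
  rw [AlgHom.map_adjoin] at h
  rw [Finset.coe_image, ← g.commutes r]
  exact h
end

section
/- Let k be an algebraically closed field, A a finitely generated k-algebra that is an integral domain and is integrally closed in its fraction field, G a group acting on A by k-algebra automorphisms, and B = A^G the subalgebra of G-invariant elements. Let R ⊆ B be a finitely generated separating subalgebra, i.e., for all k-algebra homomorphisms u, v : A → k, if u and v agree on R then they agree on B. Then the Krull dimension of B equals the Krull dimension of R, and both equal the transcendence degree over k of the fraction field of B. -/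
/-- The subalgebra of invariants `A^G` for a group `G` acting on a `k`-algebra `A` by
`k`-algebra automorphisms. -/
def fixedSubalgebra (G k A : Type*) [CommRing k] [CommRing A] [Algebra k A]
    [Monoid G] [MulSemiringAction G A] [SMulCommClass G k A] : Subalgebra k A where
  carrier := {a | ∀ g : G, g • a = a}
  mul_mem' := fun {a b} (ha : ∀ g : G, g • a = a) (hb : ∀ g : G, g • b = b) g => by
    rw [smul_mul', ha g, hb g]
  add_mem' := fun {a b} (ha : ∀ g : G, g • a = a) (hb : ∀ g : G, g • b = b) g => by
    rw [smul_add, ha g, hb g]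
  algebraMap_mem' := fun c g => by
    rw [Algebra.algebraMap_eq_smul_one, smul_comm, smul_one]

open Ideal in
/-- Going-up holds over a nonempty principal open subset for an algebraic ring extension of
finite type over a domain. -/
theorem exists_goingUp_of_isAlgebraic (P A : Type*) [CommRing P] [IsDomain P] [CommRing A]
    [Algebra P A] [Algebra.FiniteType P A] [Algebra.IsAlgebraic P A] :
    ∃ f : P, f ≠ 0 ∧ ∀ (p : Ideal P) [p.IsPrime], f ∉ p → ∀ I : Ideal A,
      I.comap (algebraMap P A) ≤ p →
        ∃ Q ≥ I, Q.IsPrime ∧ Q.comap (algebraMap P A) = p := by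
  obtain ⟨s, hs⟩ := (‹Algebra.FiniteType P A›).out
  obtain ⟨f, hf, hfs⟩ := Algebra.IsAlgebraic.exists_integral_multiples P s
  have key (a : A) : ∃ N : ℕ, f ^ N • a ∈ integralClosure P A := by
    have ha : a ∈ Algebra.adjoin P (s : Set A) := hs ▸ Algebra.mem_top
    induction ha using Algebra.adjoin_induction with
    | mem x hx => exact ⟨1, by rw [pow_one]; exact hfs x hx⟩
    | algebraMap r => exact ⟨0, by simp⟩
    | add x y _ _ hx hy =>
      obtain ⟨N, hN⟩ := hx
      obtain ⟨M, hM⟩ := hy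
      refine ⟨N + M, ?_⟩
      have h := add_mem (Subalgebra.smul_mem _ hN (f ^ M)) (Subalgebra.smul_mem _ hM (f ^ N))
      rwa [smul_smul, smul_smul, ← pow_add, ← pow_add, add_comm M N, ← smul_add] at h
    | mul x y _ _ hx hy =>
      obtain ⟨N, hN⟩ := hx
      obtain ⟨M, hM⟩ := hy
      exact ⟨N + M, by simpa only [pow_add, smul_mul_smul_comm] using mul_mem hN hM⟩
  refine ⟨f, hf, fun p _ hfp I hI ↦ ?_⟩
  obtain ⟨Q', hIQ', hQ', hQp⟩ := exists_ideal_over_prime_of_isIntegral p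
    (I.comap (algebraMap (integralClosure P A) A)) (by
      rwa [comap_comap, ← IsScalarTower.algebraMap_eq])
  have hmul (j : A) (hj : j ∈ Q'.map (algebraMap (integralClosure P A) A)) :
      ∃ N : ℕ, ∃ c ∈ Q', f ^ N • j = (c : A) := by
    induction hj using Submodule.span_induction with
    | mem x hx =>
      obtain ⟨c, hc, rfl⟩ := hx
      exact ⟨0, c, hc, by simp⟩
    | zero => exact ⟨0, 0, zero_mem _, by simp⟩
    | add x y _ _ hx hy =>
      obtain ⟨N, c, hc, hN⟩ := hx
      obtain ⟨M, d, hd, hM⟩ := hy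
      refine ⟨N + M, f ^ M • c + f ^ N • d,
        add_mem (Submodule.smul_of_tower_mem _ _ hc) (Submodule.smul_of_tower_mem _ _ hd), ?_⟩
      simp [← hN, ← hM, smul_smul, pow_add, mul_comm]
    | smul a x _ hx =>
      obtain ⟨N, c, hc, hN⟩ := hx
      obtain ⟨M, hM⟩ := key a
      refine ⟨M + N, ⟨_, hM⟩ * c, mul_mem_left _ _ hc, ?_⟩
      rw [smul_eq_mul, pow_add, ← smul_mul_smul_comm, hN]
      rfl
  have hcomap : (I ⊔ Q'.map (algebraMap (integralClosure P A) A)).comap (algebraMap P A) ≤ p := by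
    intro x hx
    obtain ⟨i, hi, j, hj, hij⟩ := Submodule.mem_sup.mp (mem_comap.mp hx)
    obtain ⟨N, c, hc, hN⟩ := hmul j hj
    have hmem : algebraMap P (integralClosure P A) (f ^ N * x) - c ∈ Q' := by
      apply hIQ'
      rw [mem_comap]
      have : algebraMap (integralClosure P A) A
          (algebraMap P (integralClosure P A) (f ^ N * x) - c) = f ^ N • i := by
        rw [map_sub, ← IsScalarTower.algebraMap_apply, map_mul, ← hij, ← Algebra.smul_def,
          smul_add, hN]
        exact add_sub_cancel_right _ _
      rw [this]
      exact Submodule.smul_of_tower_mem _ _ hi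
    have : f ^ N * x ∈ p := by
      rw [← hQp, mem_comap]
      simpa using add_mem hmem hc
    exact (IsPrime.mem_or_mem ‹_› this).resolve_left fun h ↦ hfp (IsPrime.mem_of_pow_mem ‹_› _ h)
  obtain ⟨Q, hJQ, hQ, hQle⟩ := exists_ideal_comap_le_prime p _ hcomap
  refine ⟨Q, le_sup_left.trans hJQ, hQ, hQle.antisymm ?_⟩
  nth_rw 1 [← hQp]
  rw [IsScalarTower.algebraMap_eq P (integralClosure P A) A, ← comap_comap]
  exact comap_mono (le_comap_of_map_le (le_sup_right.trans hJQ))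


/-- A prime lying over the maximal ideal of a point `a` yields a `k`-point of `A` over `a`. -/
theorem exists_algHom_of_comap_eq_ker {k A σ : Type*} [Field k] [IsAlgClosed k] [CommRing A]
    [Algebra k A] [Algebra.FiniteType k A] (y : σ → A) (a : σ → k) (Q : Ideal A) [hQ : Q.IsPrime]
    (hQa : Q.comap (MvPolynomial.aeval (R := k) y) = RingHom.ker (MvPolynomial.aeval (R := k) a)) :
    ∃ u : A →ₐ[k] k, ∀ s, u (y s) = a s := by
  obtain ⟨M, hM, hQM⟩ := Q.exists_le_maximal hQ.ne_top
  let := Ideal.Quotient.field M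
  have : Module.Finite k (A ⧸ M) := finite_of_finite_type_of_isJacobsonRing k (A ⧸ M)
  let e := AlgEquiv.ofBijective (Algebra.ofId k (A ⧸ M))
    (IsAlgClosed.algebraMap_bijective_of_isIntegral)
  refine ⟨e.symm.toAlgHom.comp (Ideal.Quotient.mkₐ k M), fun s ↦ ?_⟩
  have h1 : (MvPolynomial.X s - MvPolynomial.C (a s) : MvPolynomial σ k) ∈
      Q.comap (MvPolynomial.aeval (R := k) y) := by
    rw [hQa, RingHom.mem_ker]
    simp
  have h2 : y s - algebraMap k A (a s) ∈ M := hQM (by simpa using h1)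
  have h3 : Ideal.Quotient.mkₐ k M (y s) = e (a s) := by
    rw [← Ideal.Quotient.mk_eq_mk_iff_sub_mem] at h2
    exact h2
  exact e.symm_apply_eq.mpr h3

theorem AlgebraicIndependent.exists_isTranscendenceBasis_comp {ι R A : Type*} [CommRing R]
    [CommRing A] [Algebra R A] [NoZeroDivisors A] [Nontrivial R] {x : ι → A}
    (hx : AlgebraicIndependent R x) :
    ∃ (t : Set A) (e : ι → t), Function.Injective e ∧ (∀ i, (e i : A) = x i) ∧
      IsTranscendenceBasis R ((↑) : t → A) := by
  obtain ⟨t, hst, ht⟩ := exists_isTranscendenceBasis_superset hx.to_subtype_range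
  exact ⟨t, fun i ↦ ⟨x i, hst ⟨i, rfl⟩⟩, fun i j h ↦ hx.injective (congrArg Subtype.val h),
    fun _ ↦ rfl, ht⟩

/-- Generic going-up for the polynomial ring on a transcendence basis of an affine domain. -/
theorem IsTranscendenceBasis.exists_goingUp {k A σ : Type*} [Field k] [CommRing A]
    [IsDomain A] [Algebra k A] [Algebra.FiniteType k A] {y : σ → A}
    (hy : IsTranscendenceBasis k y) :
    ∃ f : MvPolynomial σ k, f ≠ 0 ∧ ∀ (p : Ideal (MvPolynomial σ k)) [p.IsPrime], f ∉ p →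
      ∀ I : Ideal A, I.comap (MvPolynomial.aeval (R := k) y) ≤ p →
        ∃ Q ≥ I, Q.IsPrime ∧ Q.comap (MvPolynomial.aeval (R := k) y) = p := by
  let : Algebra (MvPolynomial σ k) A := (MvPolynomial.aeval (R := k) y).toAlgebra
  have : IsScalarTower k (MvPolynomial σ k) A := .of_algHom (MvPolynomial.aeval (R := k) y)
  have : Algebra.FiniteType (MvPolynomial σ k) A := .of_restrictScalars_finiteType k _ _
  have : Algebra.IsAlgebraic (MvPolynomial σ k) A := by
    refine hy.isAlgebraic_iff.mpr fun i ↦ ?_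
    have : y i = algebraMap (MvPolynomial σ k) A (MvPolynomial.X i) :=
      (MvPolynomial.aeval_X y i).symm
    exact this ▸ isAlgebraic_algebraMap _
  exact exists_goingUp_of_isAlgebraic (MvPolynomial σ k) A

open MvPolynomial in
/-- A subalgebra of an affine domain, finitely generated or not, has Krull dimension at least the
size of any algebraically independent family in it. -/
theorem AlgebraicIndependent.natCast_le_ringKrullDim {k A : Type*} [Field k] [Infinite k]
    [CommRing A] [IsDomain A] [Algebra k A] [Algebra.FiniteType k A] (B : Subalgebra k A) {n : ℕ}
    {x : Fin n → B} (hx : AlgebraicIndependent k x) : (n : WithBot ℕ∞) ≤ ringKrullDim B := by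
  classical
  obtain ⟨t, e, he, hex, ht⟩ :=
    (hx.map' (f := B.val) Subtype.val_injective).exists_isTranscendenceBasis_comp
  obtain ⟨f, hf, hup⟩ := ht.exists_goingUp
  obtain ⟨a, ha⟩ : ∃ a : t → k, eval a f ≠ 0 := by
    by_contra! h
    exact hf (MvPolynomial.funext (by simpa using h))
  let φ (i : ℕ) : MvPolynomial t k →ₐ[k] MvPolynomial t k :=
    aeval fun s ↦ if ∃ j : Fin n, j < i ∧ e j = s then C (a s) else X s
  have hφ {i j : ℕ} (hij : i ≤ j) : (φ j).comp (φ i) = φ j := by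
    ext s : 1
    by_cases h : ∃ l : Fin n, l < i ∧ e l = s
    · have h' : ∃ l : Fin n, l < j ∧ e l = s := h.imp fun l hl ↦ ⟨hl.1.trans_le hij, hl.2⟩
      simp only [φ, AlgHom.comp_apply, aeval_X, if_pos h, if_pos h', algHom_C, algebraMap_eq]
    · simp only [φ, AlgHom.comp_apply, aeval_X, if_neg h]
  let p (i : ℕ) : Ideal (MvPolynomial t k) := RingHom.ker (φ i)
  have hp (i : ℕ) : (p i).IsPrime := RingHom.ker_isPrime _
  have hmono : Monotone p := fun i j hij q hq ↦ by
    rw [RingHom.mem_ker] at hq ⊢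
    rw [← hφ hij, AlgHom.comp_apply, hq, map_zero]
  have hfp (i : ℕ) : f ∉ p i := fun h ↦ ha <| by
    have : (aeval a).comp (φ i) = aeval (R := k) a := by
      ext s
      by_cases h : ∃ l : Fin n, l < i ∧ e l = s
      · simp only [φ, AlgHom.comp_apply, aeval_X, if_pos h, algHom_C, Algebra.algebraMap_self,
          RingHom.id_apply]
      · simp only [φ, AlgHom.comp_apply, aeval_X, if_neg h]
    rw [RingHom.mem_ker] at h
    rw [← aeval_eq_eval, ← this, AlgHom.comp_apply, h, map_zero]
  have step (i : ℕ) (I : Ideal A) (hI : I.comap (aeval (R := k) ((↑) : t → A)) ≤ p i) :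
      ∃ Q : PrimeSpectrum A, I ≤ Q.asIdeal ∧
        Q.asIdeal.comap (aeval (R := k) ((↑) : t → A)) = p i :=
    have ⟨Q, h1, h2, h3⟩ := hup (p i) (hfp i) I hI
    ⟨⟨Q, h2⟩, h1, h3⟩
  obtain ⟨Q₀, -, hQ₀⟩ := step 0 ⊥ (by
    intro q hq
    have : q = 0 := ht.1 (by simpa using hq)
    simp [this])
  have step' (i : ℕ) (Q : {Q : PrimeSpectrum A //
      Q.asIdeal.comap (aeval (R := k) ((↑) : t → A)) = p i}) :
      ∃ Q' : {Q : PrimeSpectrum A //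
      Q.asIdeal.comap (aeval (R := k) ((↑) : t → A)) = p (i + 1)}, Q.1 ≤ Q'.1 :=
    have ⟨Q', h1, h2⟩ := step (i + 1) Q.1.asIdeal (Q.2.le.trans (hmono i.le_succ))
    ⟨⟨Q', h2⟩, h1⟩
  choose next hnext using step'
  let L (i : ℕ) : {Q : PrimeSpectrum A //
      Q.asIdeal.comap (aeval (R := k) ((↑) : t → A)) = p i} :=
    Nat.rec ⟨Q₀, hQ₀⟩ next i
  let S : LTSeries (PrimeSpectrum B) :=
    { length := n
      toFun i := PrimeSpectrum.comap B.val.toRingHom (L i).1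
      step i := by
        have hmem (j : ℕ) : x i - algebraMap k B (a (e i)) ∈
            (PrimeSpectrum.comap B.val.toRingHom (L j).1).asIdeal ↔
            X (e i) - C (a (e i)) ∈ p j := by
          rw [← SetLike.ext_iff.mp (L j).2]
          simp [hex]
        refine lt_of_le_not_ge
          (Ideal.comap_mono (hnext i (L i))) fun hle ↦ ?_
        have h1 := (hmem (i + 1)).mpr (by
          rw [RingHom.mem_ker]
          have h : ∃ l : Fin n, (l : ℕ) < (i + 1 : ℕ) ∧ e l = e i := ⟨i, by simp, rfl⟩
          simp only [φ, map_sub, aeval_X, if_pos h, algHom_C, algebraMap_eq, sub_self])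
        have h2 := (hmem i).mp (hle h1)
        rw [RingHom.mem_ker] at h2
        have h : ¬ ∃ l : Fin n, (l : ℕ) < (i : ℕ) ∧ e l = e i := by
          rintro ⟨l, hl, hli⟩
          rw [he hli] at hl
          exact hl.false
        simp only [φ, map_sub, aeval_X, if_neg h, algHom_C, algebraMap_eq] at h2
        have h3 := congrArg (eval fun _ ↦ a (e i) + 1) h2
        simp at h3 }
  exact Order.LTSeries.length_le_krullDim S

/-- The Krull dimension of a domain over a field is at most its transcendence degree. -/
theorem exists_algebraicIndependent_of_le_ringKrullDim {k B : Type*} [Field k] [CommRing B]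
    [IsDomain B] [Algebra k B] {n : ℕ} (h : (n : WithBot ℕ∞) ≤ ringKrullDim B) :
    ∃ x : Fin n → B, AlgebraicIndependent k x := by
  obtain ⟨L, hL⟩ := Order.le_krullDim_iff.mp h
  subst hL
  have hz (i : Fin L.length) : ∃ z, z ∈ (L i.succ).asIdeal ∧ z ∉ (L i.castSucc).asIdeal :=
    SetLike.exists_of_lt (L.step i)
  choose z hz1 hz2 using hz
  let R := Algebra.adjoin k (Set.range z)
  have hR : Algebra.FiniteType k R :=
    R.fg_iff_finiteType.mp (Subalgebra.fg_def.mpr ⟨_, Set.finite_range z, rfl⟩)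
  obtain ⟨s, g, hg, hgint⟩ := exists_integral_inj_algHom_of_fg k R
  algebraize [g.toRingHom]
  let S : LTSeries (PrimeSpectrum (MvPolynomial (Fin s) k)) :=
    { length := L.length
      toFun i := PrimeSpectrum.comap (g : _ →+* R) (PrimeSpectrum.comap R.val.toRingHom (L i))
      step i := by
        refine Ideal.IsIntegral.comap_lt_comap (lt_of_le_not_ge (Ideal.comap_mono (L.step i).le)
          fun hle ↦ hz2 i ?_)
        exact @hle ⟨z i, Algebra.subset_adjoin ⟨i, rfl⟩⟩ (hz1 i) }
  have hle : (L.length : WithBot ℕ∞) ≤ s := by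
    calc _ ≤ ringKrullDim (MvPolynomial (Fin s) k) := Order.LTSeries.length_le_krullDim S
      _ = s := by simp [MvPolynomial.ringKrullDim_of_isNoetherianRing]
  have hle' : L.length ≤ s := by exact_mod_cast hle
  refine ⟨fun i ↦ g (MvPolynomial.X (Fin.castLE hle' i)), ?_⟩
  have := ((MvPolynomial.algebraicIndependent_X (Fin s) k).map' (f := R.val.comp g)
    (Subtype.val_injective.comp hg)).comp _ (Fin.castLE_injective hle')
  exact this

open MvPolynomial in
/-- A finitely generated subalgebra that separates the `k`-points of `A` up to `b` has `b`
algebraic over it. -/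
theorem Subalgebra.isAlgebraic_of_separating {k A : Type*} [Field k] [IsAlgClosed k] [CommRing A]
    [IsDomain A] [Algebra k A] [Algebra.FiniteType k A] (R : Subalgebra k A) (hfg : R.FG) (b : A)
    (hsep : ∀ u v : A →ₐ[k] k, (∀ r ∈ R, u r = v r) → u b = v b) : IsAlgebraic R b := by
  classical
  by_contra hb
  have hR : Algebra.FiniteType k R := R.fg_iff_finiteType.mp hfg
  obtain ⟨m, g, hg, hgint⟩ := exists_integral_inj_algHom_of_fg k R
  have hz : AlgebraicIndependent k fun i ↦ (g (X i) : A) :=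
    (algebraicIndependent_X (Fin m) k).map' (f := R.val.comp g) (Subtype.val_injective.comp hg)
  have hle : Algebra.adjoin k (Set.range fun i ↦ (g (X i) : A)) ≤ R :=
    Algebra.adjoin_le (by rintro _ ⟨i, rfl⟩; exact (g (X i)).2)
  obtain ⟨t, e, he, hex, ht⟩ := ((hz.option_iff_transcendental b).mpr
    (Transcendental.of_tower_top_of_subalgebra_le hle hb)).exists_isTranscendenceBasis_comp
  obtain ⟨f, hf, hup⟩ := ht.exists_goingUp
  have hlift (a : t → k) (ha : eval a f ≠ 0) : ∃ u : A →ₐ[k] k, ∀ s : t, u (s : A) = a s := by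
    have hprime : (RingHom.ker (aeval (R := k) a)).IsPrime := RingHom.ker_isPrime _
    obtain ⟨Q, -, hQ, hQa⟩ := hup (RingHom.ker (aeval (R := k) a))
      (by rwa [RingHom.mem_ker, aeval_eq_eval]) ⊥ (by
        intro q hq
        have : q = 0 := ht.1 (by simpa using hq)
        simp [this])
    exact exists_algHom_of_comap_eq_ker _ a Q hQa
  obtain ⟨a, ha⟩ : ∃ a : t → k, eval a f ≠ 0 := by
    by_contra! h
    exact hf (MvPolynomial.funext (by simpa using h))
  let q : Polynomial k :=
    aeval (Function.update (fun s ↦ Polynomial.C (a s)) (e none) Polynomial.X) f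
  have hq (c : k) : q.eval c = eval (Function.update a (e none) c) f := by
    have : ((Polynomial.aeval c).comp (aeval
        (Function.update (fun s ↦ Polynomial.C (a s)) (e none) Polynomial.X))) =
        aeval (R := k) (Function.update a (e none) c) := by
      ext s
      by_cases h : s = e none
      · subst h; simp
      · simp [h]
    rw [← aeval_eq_eval, ← this]
    rfl
  have hq0 : q ≠ 0 := by
    intro h
    have := hq (a (e none))
    rw [h, Function.update_eq_self, Polynomial.eval_zero] at this
    exact ha this.symm
  have hinf : {c : k | q.eval c ≠ 0}.Infinite := by
    have : {c : k | q.eval c = 0}.Finite := by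
      simpa [Polynomial.IsRoot] using Polynomial.finite_setOfPred_isRoot hq0
    exact this.infinite_compl
  have : Nonempty (A →ₐ[k] k) := ⟨(hlift a ha).choose⟩
  choose! u hu using fun c (hc : q.eval c ≠ 0) ↦
    hlift (Function.update a (e none) c) (by rwa [← hq])
  obtain ⟨S, hS⟩ := hfg
  have hroot (r : S) : ∃ F : Polynomial k, F ≠ 0 ∧ ∀ c, q.eval c ≠ 0 → F.eval (u c r) = 0 := by
    have hrR : (r : A) ∈ R := hS ▸ Algebra.subset_adjoin r.2
    obtain ⟨F, hF, hF0⟩ := hgint ⟨r, hrR⟩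
    refine ⟨F.map (aeval (R := k) fun i ↦ a (e (some i))).toRingHom,
      (hF.map _).ne_zero, fun c hc ↦ ?_⟩
    have hcomp : (((u c).comp R.val).comp g : MvPolynomial (Fin m) k →ₐ[k] k) =
        aeval fun i ↦ a (e (some i)) := by
      ext i
      have h := hu c hc (e (some i))
      rw [hex, Function.update_of_ne (he.ne (by simp))] at h
      simpa using h
    have := congrArg ((u c).comp R.val) hF0
    rw [map_zero] at this
    rw [← this, ← hcomp, Polynomial.eval_map]
    symm
    exact (Polynomial.hom_eval₂ F g.toRingHom ((u c).comp R.val).toRingHom ⟨r, hrR⟩)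
  choose F hF0 hF using hroot
  have hfin : (Set.univ.pi fun r : S ↦ {c : k | (F r).eval c = 0}).Finite :=
    Set.Finite.pi fun r ↦ by
      simpa [Polynomial.IsRoot] using Polynomial.finite_setOfPred_isRoot (hF0 r)
  obtain ⟨c, hc, d, hd, hcd, heq⟩ := hinf.exists_ne_map_eq_of_mapsTo
    (f := fun c (r : S) ↦ u c r) (t := Set.univ.pi fun r : S ↦ {c : k | (F r).eval c = 0})
    (fun c hc r _ ↦ hF r c hc) hfin
  have hubd (c : k) (hc : q.eval c ≠ 0) : u c b = c := by
    have h := hu c hc (e none)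
    rw [hex] at h
    simpa using h
  refine hcd ?_
  rw [← hubd c hc, ← hubd d hd]
  refine hsep _ _ fun r hr ↦ ?_
  have hle : Algebra.adjoin k (S : Set A) ≤ AlgHom.equalizer (u c) (u d) :=
    Algebra.adjoin_le fun r hr ↦ congrFun heq ⟨r, hr⟩
  exact hle (hS ▸ hr)

/-- The Krull dimension of a subalgebra of an affine domain is its transcendence degree. -/
theorem Subalgebra.ringKrullDim_eq_trdeg {k A : Type*} [Field k] [Infinite k] [CommRing A]
    [IsDomain A] [Algebra k A] [Algebra.FiniteType k A] (B : Subalgebra k A) :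
    ringKrullDim B = ((Cardinal.toENat (Algebra.trdeg k B) : ℕ∞) : WithBot ℕ∞) := by
  have hfin : Algebra.trdeg k B < Cardinal.aleph0 :=
    (trdeg_le_of_injective B.val Subtype.val_injective).trans_lt
      trdeg_lt_aleph0_of_finiteType
  obtain ⟨n, hn⟩ := Cardinal.lt_aleph0.mp hfin
  rw [hn, Cardinal.toENat_nat]
  refine le_antisymm ?_ ?_
  · refine iSup_le fun L ↦ ?_
    obtain ⟨x, hx⟩ := exists_algebraicIndependent_of_le_ringKrullDim (k := k)
      (Order.LTSeries.length_le_krullDim L)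
    have h := hx.lift_cardinalMk_le_trdeg
    rw [hn] at h
    exact_mod_cast (by simpa using h : L.length ≤ n)
  · obtain ⟨s, hs⟩ := exists_isTranscendenceBasis k B
    have hcard : Cardinal.mk s = n := hs.cardinalMk_eq_trdeg.trans hn
    have e : s ≃ Fin n := (Cardinal.mk_eq_nat_iff.mp hcard).some
    exact (hs.1.comp _ e.symm.injective).natCast_le_ringKrullDim


/-- If `A` is a normal affine domain over an algebraically closed field `k`, `B = A^G`,
and `R ⊆ B` is a finitely generated separating subalgebra, then the Krull dimensions of
`B` and `R` agree and both equal the transcendence degree over `k` of the fraction field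
of `B` (expressed via the cardinality of any transcendence basis). -/
theorem stmt_6 (k A G : Type*) [Field k] [IsAlgClosed k] [CommRing A] [IsDomain A]
    [IsIntegrallyClosed A] [Algebra k A] [Algebra.FiniteType k A]
    [Group G] [MulSemiringAction G A] [SMulCommClass G k A]
    (R : Subalgebra k A) (hle : R ≤ fixedSubalgebra G k A) (hfg : R.FG)
    (hsep : ∀ u v : A →ₐ[k] k, (∀ r ∈ R, u r = v r) →
      ∀ b ∈ fixedSubalgebra G k A, u b = v b) :
    ringKrullDim ↥(fixedSubalgebra G k A) = ringKrullDim ↥R ∧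
    ∀ t : Set (FractionRing ↥(fixedSubalgebra G k A)),
      IsTranscendenceBasis k ((↑) : t → FractionRing ↥(fixedSubalgebra G k A)) →
      ringKrullDim ↥(fixedSubalgebra G k A) =
        ((Cardinal.toENat (Cardinal.mk ↥t) : ℕ∞) : WithBot ℕ∞) := by
  have : Infinite k := IsAlgClosed.instInfinite
  constructor
  · rw [Subalgebra.ringKrullDim_eq_trdeg, Subalgebra.ringKrullDim_eq_trdeg]
    algebraize [(Subalgebra.inclusion hle).toRingHom]
    have : FaithfulSMul R (fixedSubalgebra G k A) :=
      (faithfulSMul_iff_algebraMap_injective _ _).mpr (Subalgebra.inclusion_injective hle)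
    have : IsScalarTower k R (fixedSubalgebra G k A) := .of_algHom (Subalgebra.inclusion hle)
    have : IsScalarTower R (fixedSubalgebra G k A) A := .of_algebraMap_eq fun _ ↦ rfl
    have : Algebra.IsAlgebraic R (fixedSubalgebra G k A) := ⟨fun b ↦
      (isAlgebraic_algebraMap_iff (A := A) Subtype.val_injective).mp
        (R.isAlgebraic_of_separating hfg b fun u v h ↦ hsep u v h b b.2)⟩
    have : FaithfulSMul k R :=
      (faithfulSMul_iff_algebraMap_injective k R).mpr (algebraMap k R).injective
    rw [← trdeg_add_eq k R (A := fixedSubalgebra G k A), trdeg_eq_zero (R := R), add_zero]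
  · intro t ht
    have : Algebra.IsAlgebraic (fixedSubalgebra G k A) (FractionRing (fixedSubalgebra G k A)) :=
      IsLocalization.isAlgebraic _ (nonZeroDivisors (fixedSubalgebra G k A))
    have : FaithfulSMul k (fixedSubalgebra G k A) :=
      (faithfulSMul_iff_algebraMap_injective k _).mpr (algebraMap k _).injective
    rw [Subalgebra.ringKrullDim_eq_trdeg, ht.cardinalMk_eq_trdeg,
      ← trdeg_add_eq k (fixedSubalgebra G k A) (A := FractionRing (fixedSubalgebra G k A)),
      trdeg_eq_zero (R := fixedSubalgebra G k A), add_zero]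
end

section
/- Let k be an algebraically closed field, A a finitely generated k-algebra that is an integral domain, and R ⊆ A a k-subalgebra. Let m = (Krull dimension of A) − (transcendence degree over k of the fraction field of R). Then there exists a nonzero f ∈ R such that: the localization R_f is a finitely generated k-algebra; there exist elements y₁, …, y_m ∈ A_f which are algebraically independent over the fraction field of R; A_f is a finitely generated module over its subalgebra S generated by R_f and y₁, …, y_m; and the induced map Spec A_f → Spec S is surjective. -/
section

open MvPolynomial nonZeroDivisors

theorem ringKrullDim_eq_of_isIntegral (R S : Type*) [CommRing R] [CommRing S] [Algebra R S]
    [Algebra.IsIntegral R S] [FaithfulSMul R S] : ringKrullDim S = ringKrullDim R := by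
  apply le_antisymm
  · exact Order.krullDim_le_of_strictMono (PrimeSpectrum.comap (algebraMap R S))
      fun p q h ↦ Ideal.IsIntegral.comap_lt_comap (I := p.asIdeal) (J := q.asIdeal) h
  · refine iSup_le fun l ↦ ?_
    obtain ⟨P, hP⟩ := Algebra.IsIntegral.comap_surjective R S l.head
    have : P.asIdeal.LiesOver l.head.asIdeal := ⟨by rw [← hP]; rfl⟩
    obtain ⟨L, hL, -⟩ := Ideal.exists_ltSeries_of_hasGoingUp l P.asIdeal
    rw [← hL]
    exact Order.LTSeries.length_le_krullDim L

theorem exists_ringKrullDim_eq_trdeg (k A : Type*) [Field k] [CommRing A] [IsDomain A]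
    [Algebra k A] [Algebra.FiniteType k A] :
    ∃ n : ℕ, ringKrullDim A = n ∧ Algebra.trdeg k A = n := by
  obtain ⟨n, g, hinj, hint⟩ := exists_integral_inj_algHom_of_fg k A
  refine ⟨n, ?_, ?_⟩
  · algebraize [g.toRingHom]
    have : FaithfulSMul (MvPolynomial (Fin n) k) A :=
      (faithfulSMul_iff_algebraMap_injective _ _).mpr hinj
    rw [ringKrullDim_eq_of_isIntegral (MvPolynomial (Fin n) k) A,
      MvPolynomial.ringKrullDim_of_isNoetherianRing, ringKrullDim_eq_zero_of_field]
    simp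
  · algebraize [g.toRingHom]
    have : FaithfulSMul (MvPolynomial (Fin n) k) A :=
      (faithfulSMul_iff_algebraMap_injective _ _).mpr hinj
    have : IsScalarTower k (MvPolynomial (Fin n) k) A := .of_algHom g
    have h := lift_trdeg_add_eq k (MvPolynomial (Fin n) k) A
    rw [MvPolynomial.trdeg_of_isDomain, trdeg_eq_zero] at h
    simpa using h.symm

theorem isIntegral_of_isLocalization_away {R A S L : Type*} [CommRing R] [CommRing A] [CommRing S]
    [CommRing L] [Algebra R A] [Algebra A L] [Algebra R S] [Algebra S L] [Algebra R L]
    [IsScalarTower R A L] [IsScalarTower R S L] (f : R)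
    [IsLocalization.Away (algebraMap R A f) L] (invf : S) (hinv : algebraMap R S f * invf = 1)
    (G : Set A) (hG : Algebra.adjoin R G = ⊤)
    (hint : ∀ a ∈ G, IsIntegral S (algebraMap A L (f • a))) : Algebra.IsIntegral S L := by
  have hf : algebraMap S L invf * algebraMap R L f = 1 := by
    rw [IsScalarTower.algebraMap_apply R S L, ← map_mul, mul_comm, hinv, map_one]
  have hA (a : A) : IsIntegral S (algebraMap A L a) := by
    have ha : a ∈ Algebra.adjoin R G := hG ▸ Algebra.mem_top
    induction ha using Algebra.adjoin_induction with
    | mem a ha =>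
      have := (isIntegral_algebraMap (A := L) (x := invf)).mul (hint a ha)
      rwa [Algebra.smul_def, map_mul, ← IsScalarTower.algebraMap_apply, ← mul_assoc, hf,
        one_mul] at this
    | algebraMap r =>
      rw [← IsScalarTower.algebraMap_apply, IsScalarTower.algebraMap_apply R S L]
      exact isIntegral_algebraMap
    | add x y _ _ hx hy => rw [map_add]; exact hx.add hy
    | mul x y _ _ hx hy => rw [map_mul]; exact hx.mul hy
  refine ⟨fun x ↦ ?_⟩
  obtain ⟨N, a, hx⟩ := IsLocalization.Away.surj (algebraMap R A f) x
  have h := ((isIntegral_algebraMap (A := L) (x := invf)).pow N).mul (hA a)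
  rwa [← hx, ← IsScalarTower.algebraMap_apply, mul_left_comm, ← mul_pow, hf, one_pow,
    mul_one] at h

theorem isIntegral_adjoin_of_isIntegralElem_aeval {R A ι : Type*} [CommRing R] [CommRing A]
    [Algebra R A] {y : ι → A} {a : A} (h : (aeval (R := R) y).toRingHom.IsIntegralElem a) :
    IsIntegral (Algebra.adjoin R (Set.range y)) a := by
  rw [Algebra.adjoin_range_eq_range_aeval]
  exact RingHom.isIntegralElem.of_comp (f := (aeval (R := R) y).rangeRestrict.toRingHom)
    (g := algebraMap _ A) h

theorem exists_aeval_injective_isIntegral_of_isFractionRing (R K A B : Type*) [CommRing R]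
    [IsDomain R] [Field K] [Algebra R K] [IsFractionRing R K] [CommRing A] [Algebra R A]
    [CommRing B] [Nontrivial B] [Algebra K B] [Algebra A B] [Algebra R B] [IsScalarTower R K B]
    [IsScalarTower R A B] [IsLocalization (Algebra.algebraMapSubmonoid A R⁰) B]
    [Algebra.FiniteType K B] :
    ∃ (n : ℕ) (y : Fin n → A),
      Function.Injective (aeval (R := K) (algebraMap A B ∘ y)) ∧
      (aeval (R := K) (algebraMap A B ∘ y)).toRingHom.IsIntegral := by
  obtain ⟨n, g, hinj, hint⟩ := exists_integral_inj_algHom_of_fg K B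
  obtain ⟨⟨_, c, hc, rfl⟩, hd⟩ := IsLocalization.exist_integer_multiples_of_finite
    (Algebra.algebraMapSubmonoid A R⁰) (fun i ↦ g (X i))
  choose y hy using hd
  have hc0 : algebraMap R K c ≠ 0 := by
    simpa using nonZeroDivisors.ne_zero hc
  let σ : MvPolynomial (Fin n) K →ₐ[K] MvPolynomial (Fin n) K :=
    aeval fun i ↦ C (algebraMap R K c) * X i
  let τ : MvPolynomial (Fin n) K →ₐ[K] MvPolynomial (Fin n) K :=
    aeval fun i ↦ C (algebraMap R K c)⁻¹ * X i
  have hτσ : τ.comp σ = AlgHom.id K _ := by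
    ext i
    simp [σ, τ, algHom_C, ← mul_assoc, ← C_mul, hc0, MvPolynomial.algebraMap_eq]
  have hστ : σ.comp τ = AlgHom.id K _ := by
    ext i
    simp [σ, τ, algHom_C, ← mul_assoc, ← C_mul, hc0, MvPolynomial.algebraMap_eq]
  have hθ : aeval (R := K) (algebraMap A B ∘ y) = g.comp σ := by
    ext i
    have h1 : g (C (algebraMap R K c)) = algebraMap A B (algebraMap R A c) := by
      rw [← MvPolynomial.algebraMap_eq, AlgHom.commutes, ← IsScalarTower.algebraMap_apply,
        ← IsScalarTower.algebraMap_apply]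
    simp [σ, hy, h1, Algebra.smul_def]
  refine ⟨n, y, ?_, ?_⟩
  · rw [hθ]
    exact hinj.comp (Function.LeftInverse.injective (g := τ) (DFunLike.congr_fun hτσ))
  · rw [hθ]
    exact (RingHom.isIntegral_of_surjective σ.toRingHom
      (Function.RightInverse.surjective (DFunLike.congr_fun hστ))).trans _ _ hint

theorem exists_smul_isIntegralElem_aeval (R K A B : Type*) [CommRing R]
    [IsDomain R] [Field K] [Algebra R K] [IsFractionRing R K] [CommRing A] [Algebra R A]
    [CommRing B] [Algebra K B] [Algebra A B] [Algebra R B] [IsScalarTower R K B]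
    [IsScalarTower R A B] (hAB : Function.Injective (algebraMap A B)) {n : ℕ} (y : Fin n → A)
    (hy : (aeval (R := K) (algebraMap A B ∘ y)).toRingHom.IsIntegral) (a : A) :
    ∃ r : R, r ≠ 0 ∧ (aeval (R := R) y).toRingHom.IsIntegralElem (r • a) := by
  algebraize [(aeval (R := K) (algebraMap A B ∘ y)).toRingHom, (aeval (R := R) y).toRingHom]
  let _ : Algebra (MvPolynomial (Fin n) R) B := (aeval (R := R) (algebraMap A B ∘ y)).toAlgebra
  let _ : Algebra (MvPolynomial (Fin n) R) (MvPolynomial (Fin n) K) := algebraMvPolynomial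
  have : IsScalarTower (MvPolynomial (Fin n) R) A B := .of_algebraMap_eq fun p ↦
    aeval_algebraMap_apply B y p
  have : IsScalarTower (MvPolynomial (Fin n) R) (MvPolynomial (Fin n) K) B :=
    .of_algebraMap_eq fun p ↦ (aeval_map_algebraMap K (algebraMap A B ∘ y) p).symm
  obtain ⟨⟨_, r, hr, rfl⟩, h⟩ := IsIntegral.exists_multiple_integral_of_isLocalization
    (R := MvPolynomial (Fin n) R) (Rₘ := MvPolynomial (Fin n) K) (R⁰.map C) (algebraMap A B a)
    (hy _)
  refine ⟨r, nonZeroDivisors.ne_zero hr, ?_⟩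
  change IsIntegral (MvPolynomial (Fin n) R) (r • a)
  rw [← isIntegral_algebraMap_iff hAB]
  convert h using 1
  rw [Submonoid.smul_def, Algebra.smul_def, map_mul, Algebra.smul_def,
    ← IsScalarTower.algebraMap_apply]
  congr 1
  exact (aeval_C _ _).symm

theorem isTranscendenceBasis_of_smul_isIntegral {R A ι : Type*} [CommRing R] [IsDomain R]
    [CommRing A] [IsDomain A] [Algebra R A] {y : ι → A} (hy : AlgebraicIndependent R y)
    (h : ∀ a : A, ∃ r : R, r ≠ 0 ∧ IsIntegral (Algebra.adjoin R (Set.range y)) (r • a)) :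
    IsTranscendenceBasis R y := by
  rw [hy.isTranscendenceBasis_iff_isAlgebraic]
  refine ⟨fun a ↦ ?_⟩
  obtain ⟨r, hr, ha⟩ := h a
  rw [Algebra.smul_def] at ha
  have hr' : algebraMap R A r ≠ 0 := by
    rwa [Ne, map_eq_zero_iff _ hy.algebraMap_injective]
  refine IsAlgebraic.of_mul (mem_nonZeroDivisors_of_ne_zero hr') ?_ ha.isAlgebraic
  exact isAlgebraic_algebraMap (algebraMap R (Algebra.adjoin R (Set.range y)) r)

/-- Noether normalization over a domain: a finitely generated domain `A` over `R` has a
transcendence basis `y` over `R` such that, up to inverting a nonzero `f : R`, `A` is integral over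
`R[y]`, and the generic point of the section `y = 0` lifts to `A`. -/
theorem exists_isTranscendenceBasis_smul_isIntegral (R A : Type*) [CommRing R] [IsDomain R]
    [CommRing A] [IsDomain A] [Algebra R A] [FaithfulSMul R A] [Algebra.FiniteType R A] :
    ∃ (f : R) (n : ℕ) (y : Fin n → A) (G : Set A) (Q : Ideal A),
      f ≠ 0 ∧ IsTranscendenceBasis R y ∧ Algebra.adjoin R G = ⊤ ∧
      (∀ a ∈ G, (aeval (R := R) y).toRingHom.IsIntegralElem (f • a)) ∧
      Q.IsPrime ∧ Q.comap (algebraMap R A) = ⊥ ∧ ∀ i, y i ∈ Q := by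
  let K := FractionRing R
  let B := TensorProduct R K A
  let _ : Algebra A B := Algebra.TensorProduct.rightAlgebra
  have hM : Algebra.algebraMapSubmonoid A R⁰ ≤ A⁰ := by
    rintro _ ⟨r, hr, rfl⟩
    refine mem_nonZeroDivisors_of_ne_zero ?_
    rw [Ne, map_eq_zero_iff _ (FaithfulSMul.algebraMap_injective R A)]
    exact nonZeroDivisors.ne_zero hr
  have hAB : Function.Injective (algebraMap A B) :=
    IsLocalization.injective (M := Algebra.algebraMapSubmonoid A R⁰) B hM
  have : Nontrivial B := hAB.nontrivial
  obtain ⟨n, y, hinj, hint⟩ := exists_aeval_injective_isIntegral_of_isFractionRing R K A B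
  have hsmul := exists_smul_isIntegralElem_aeval R K A B hAB y hint
  have hRK : Function.Injective (algebraMap R K) := IsFractionRing.injective R K
  have hind : AlgebraicIndependent R y := by
    have h : AlgebraicIndependent K (algebraMap A B ∘ y) := hinj
    exact (h.restrictScalars hRK).of_comp (IsScalarTower.toAlgHom R A B)
  choose r hr hra using hsmul
  obtain ⟨G, hG⟩ := Algebra.FiniteType.out (R := R) (A := A)
  have hcomap := RingHom.IsIntegral.comap_surjective hint hinj
  obtain ⟨Q, hQ⟩ := hcomap ⟨RingHom.ker (constantCoeff : MvPolynomial (Fin n) K →+* K),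
    RingHom.ker_isPrime _⟩
  have hmem (p : MvPolynomial (Fin n) K) :
      aeval (algebraMap A B ∘ y) p ∈ Q.asIdeal ↔ constantCoeff p = 0 := by
    have := congrArg (p ∈ PrimeSpectrum.asIdeal ·) hQ
    simpa [RingHom.mem_ker] using this
  refine ⟨∏ a ∈ G, r a, n, y, G, Q.asIdeal.comap (algebraMap A B),
    Finset.prod_ne_zero_iff.mpr fun a _ ↦ hr a,
    isTranscendenceBasis_of_smul_isIntegral hind fun a ↦
      ⟨r a, hr a, isIntegral_adjoin_of_isIntegralElem_aeval (hra a)⟩, hG, fun a ha ↦ ?_,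
    inferInstance, ?_, fun i ↦ ?_⟩
  · classical
    rw [← Finset.prod_erase_mul G r ha, mul_smul, Algebra.smul_def]
    refine RingHom.IsIntegralElem.mul _ ?_ (hra a)
    convert RingHom.isIntegralElem_map (aeval (R := R) y).toRingHom (x := C (∏ a ∈ G.erase a, r a))
    simp
  · rw [eq_bot_iff]
    intro s hs
    have h := (hmem (C (algebraMap R K s))).mp (by
      simpa [Ideal.mem_comap, ← IsScalarTower.algebraMap_apply] using hs)
    rw [constantCoeff_C] at h
    exact (map_eq_zero_iff _ hRK).mp h
  · have h := (hmem (X i)).mpr (by simp)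
    simpa using h

theorem isIntegral_map_of_isIntegralElem {P A S L : Type*} [CommRing P] [CommRing A]
    [CommRing S] [CommRing L] [Algebra S L] {η : P →+* A} {a : A} (ha : η.IsIntegralElem a)
    (φ : A →+* L) (h : P →+* S) (hcomm : (algebraMap S L).comp h = φ.comp η) :
    IsIntegral S (φ a) := by
  obtain ⟨p, hp, h0⟩ := ha
  exact ⟨p.map h, hp.map h, by
    rw [Polynomial.eval₂_map, hcomm, ← Polynomial.hom_eval₂, h0, map_zero]⟩

theorem finiteType_localizationAway_of_isIntegralElem_aeval {k R A : Type*} [Field k] [CommRing R]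
    [IsDomain R] [CommRing A] [Algebra k R] [Algebra k A] [Algebra R A] [IsScalarTower k R A]
    [Algebra.FiniteType k A] {f : R} (hf : f ≠ 0) {n : ℕ} {y : Fin n → A} {G : Set A}
    (hG : Algebra.adjoin R G = ⊤)
    (hint : ∀ a ∈ G, (aeval (R := R) y).toRingHom.IsIntegralElem (f • a))
    (Q : Ideal A) [Q.IsPrime] (hQ : Q.comap (algebraMap R A) = ⊥) (hy : ∀ i, y i ∈ Q) :
    Algebra.FiniteType k (Localization.Away f) := by
  let E := Localization.Away (algebraMap R (A ⧸ Q) f)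
  have hRQ : Function.Injective (algebraMap R (A ⧸ Q)) := by
    rw [RingHom.injective_iff_ker_eq_bot, ← hQ, IsScalarTower.algebraMap_eq R A (A ⧸ Q),
      ← RingHom.comap_ker, Ideal.Quotient.algebraMap_eq, Ideal.mk_ker]
  have hle : Submonoid.powers f ≤
      (Submonoid.powers (algebraMap R (A ⧸ Q) f)).comap (algebraMap R (A ⧸ Q)) := by
    rw [← Submonoid.map_le_iff_le_comap, Submonoid.map_powers]
  let ψ : Localization.Away f →+* E := Localization.awayMap (algebraMap R (A ⧸ Q)) f
  let _ : Algebra (Localization.Away f) E := ψ.toAlgebra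
  have : IsScalarTower R (Localization.Away f) E := .of_algebraMap_eq fun r ↦ by
    rw [IsScalarTower.algebraMap_apply R (A ⧸ Q) E]
    exact (IsLocalization.map_eq (M := Submonoid.powers f) (S := Localization.Away f) (Q := E)
      (T := Submonoid.powers (algebraMap R (A ⧸ Q) f)) (g := algebraMap R (A ⧸ Q)) hle r).symm
  have : IsScalarTower k (Localization.Away f) E := .of_algebraMap_eq fun r ↦ by
    rw [IsScalarTower.algebraMap_apply k R (Localization.Away f),
      ← IsScalarTower.algebraMap_apply R (Localization.Away f) E,
      IsScalarTower.algebraMap_apply R (A ⧸ Q) E, ← IsScalarTower.algebraMap_apply k R (A ⧸ Q),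
      ← IsScalarTower.algebraMap_apply k (A ⧸ Q) E]
  have hinj : Function.Injective (algebraMap (Localization.Away f) E) := by
    refine IsLocalization.map_injective_of_injective' (f := algebraMap R (A ⧸ Q))
      (Rₘ := Localization.Away f) (Submonoid.powers f) (A ⧸ Q) E hle ?_ hRQ
    rintro ⟨N, hN⟩
    exact hf (hRQ (by simpa using eq_zero_of_pow_eq_zero hN))
  have hfE : Algebra.FiniteType k E :=
    inferInstanceAs (Algebra.FiniteType k (Localization.Away (algebraMap R (A ⧸ Q) f)))
  have : Algebra.IsIntegral (Localization.Away f) E := by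
    refine isIntegral_of_isLocalization_away (A := A ⧸ Q) f (IsLocalization.Away.invSelf f)
      (IsLocalization.Away.mul_invSelf f) (Ideal.Quotient.mkₐ R Q '' G) ?_ ?_
    · rw [← AlgHom.map_adjoin, hG, Algebra.map_top, AlgHom.range_eq_top]
      exact Ideal.Quotient.mkₐ_surjective R Q
    · rintro _ ⟨a, ha, rfl⟩
      rw [← map_smul]
      refine isIntegral_map_of_isIntegralElem (hint a ha)
        ((algebraMap (A ⧸ Q) E).comp (Ideal.Quotient.mk Q))
        ((algebraMap R (Localization.Away f)).comp constantCoeff) ?_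
      refine MvPolynomial.ringHom_ext (fun r ↦ ?_) fun i ↦ ?_
      · simp [← IsScalarTower.algebraMap_apply, ← Ideal.Quotient.algebraMap_eq]
      · simp [Ideal.Quotient.eq_zero_iff_mem.mpr (hy i)]
  have : Algebra.FiniteType (Localization.Away f) E := .of_restrictScalars_finiteType k _ _
  have : Module.Finite (Localization.Away f) E := Algebra.IsIntegral.finite
  exact ⟨fg_of_fg_of_fg k (Localization.Away f) E hfE.out Module.Finite.fg_top hinj⟩

theorem isIntegral_adjoin_localizationAway {R A : Type*} [CommRing R] [CommRing A] [Algebra R A]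
    {f : R} {n : ℕ} {y : Fin n → A} {G : Set A} (hG : Algebra.adjoin R G = ⊤)
    (hint : ∀ a ∈ G, (aeval (R := R) y).toRingHom.IsIntegralElem (f • a))
    {L : Type*} [CommRing L] [Algebra A L] [Algebra R L] [IsScalarTower R A L]
    [IsLocalization.Away (algebraMap R A f) L] (invf : L)
    (hinv : algebraMap A L (algebraMap R A f) * invf = 1) :
    Algebra.IsIntegral (Algebra.adjoin R (Set.range (algebraMap A L ∘ y) ∪ {invf})) L := by
  set S := Algebra.adjoin R (Set.range (algebraMap A L ∘ y) ∪ {invf})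
  have hyS (i) : algebraMap A L (y i) ∈ S := Algebra.subset_adjoin (.inl ⟨i, rfl⟩)
  refine isIntegral_of_isLocalization_away (A := A) f
    (⟨invf, Algebra.subset_adjoin (.inr rfl)⟩ : S) ?_ G hG fun a ha ↦ ?_
  · ext
    simpa [← IsScalarTower.algebraMap_apply] using hinv
  · refine isIntegral_map_of_isIntegralElem (hint a ha) (algebraMap A L)
      (aeval (R := R) fun i ↦ (⟨algebraMap A L (y i), hyS i⟩ : S)).toRingHom ?_
    refine MvPolynomial.ringHom_ext (fun r ↦ ?_) fun i ↦ ?_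
    · simp [← IsScalarTower.algebraMap_apply]
    · simp

theorem eq_of_ringKrullDim_eq_of_isTranscendenceBasis {k R A : Type*} [Field k] [CommRing R]
    [IsDomain R] [CommRing A] [IsDomain A] [Algebra k R] [Algebra k A] [Algebra R A]
    [IsScalarTower k R A] [FaithfulSMul R A] [Algebra.FiniteType k A] {t : Set (FractionRing R)}
    (ht : IsTranscendenceBasis k ((↑) : t → FractionRing R)) {n m : ℕ} {y : Fin n → A}
    (hy : IsTranscendenceBasis R y)
    (hm : ringKrullDim A = ((Cardinal.toENat (Cardinal.mk t) + m : ℕ∞) : WithBot ℕ∞)) :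
    n = m := by
  obtain ⟨N, hN, hN'⟩ := exists_ringKrullDim_eq_trdeg k A
  have : Algebra.IsAlgebraic R (FractionRing R) :=
    (IsFractionRing.comap_isAlgebraic_iff (K := FractionRing R)).mpr inferInstance
  have h1 : Cardinal.mk t = Algebra.trdeg k R := by
    rw [ht.cardinalMk_eq_trdeg, ← trdeg_add_eq k R (A := FractionRing R),
      trdeg_eq_zero (R := R) (A := FractionRing R), add_zero]
  have h2 : (n : Cardinal) = Algebra.trdeg R A := by
    simpa using hy.lift_cardinalMk_eq_trdeg
  have h3 := congrArg Cardinal.toENat (lift_trdeg_add_eq k R A)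
  rw [← h1, ← h2, hN'] at h3
  simp only [map_add, Cardinal.toENat_lift, map_natCast] at h3
  rw [hN] at hm
  have h4 : (N : ℕ∞) = Cardinal.toENat (Cardinal.mk t) + m := by exact_mod_cast hm
  have h5 : Cardinal.toENat (Cardinal.mk t) ≠ ⊤ := by
    intro h
    simp [h] at h4
  rw [h4] at h3
  lift Cardinal.toENat (Cardinal.mk t) to ℕ using h5 with c
  norm_cast at h3
  lia

end

/-- The local structure of a morphism given by a subalgebra `R ⊆ A` of a finitely
generated domain `A` over `k`: with `m = dim A - trdeg_k Q(R)` (where the transcendence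
degree of `Q(R)` over `k` is expressed as the cardinality of a transcendence basis `t`),
there is a nonzero `f ∈ R` such that `R_f` is finitely generated, and there are elements
`y₁, …, y_m ∈ A_f`, algebraically independent over `R` (equivalently over `Q(R)`), such
that `A_f` is a finite module over the subalgebra `S` generated by `R_f` (i.e. by `R` and
`1/f`) and the `yᵢ`, and `Spec A_f → Spec S` is surjective. -/
theorem stmt_7 (k A : Type*) [Field k] [IsAlgClosed k] [CommRing A] [IsDomain A]
    [Algebra k A] [Algebra.FiniteType k A] (R : Subalgebra k A) (m : ℕ)
    (t : Set (FractionRing ↥R))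
    (ht : IsTranscendenceBasis k ((↑) : t → FractionRing ↥R))
    (hm : ringKrullDim A = ((Cardinal.toENat (Cardinal.mk ↥t) + m : ℕ∞) : WithBot ℕ∞)) :
    ∃ f : ↥R, f ≠ 0 ∧ Algebra.FiniteType k (Localization.Away f) ∧
      ∃ y : Fin m → Localization.Away (f : A),
        AlgebraicIndependent ↥R y ∧
        ∃ invf : Localization.Away (f : A),
          algebraMap A (Localization.Away (f : A)) (f : A) * invf = 1 ∧
          Module.Finite ↥(Algebra.adjoin ↥R (Set.range y ∪ {invf}))
            (Localization.Away (f : A)) ∧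
          Function.Surjective (PrimeSpectrum.comap
            (algebraMap ↥(Algebra.adjoin ↥R (Set.range y ∪ {invf}))
              (Localization.Away (f : A)))) := by
  have : Algebra.FiniteType R A := .of_restrictScalars_finiteType k R A
  obtain ⟨f, n, y, G, Q, hf, hy, hG, hint, hQ, hQR, hyQ⟩ :=
    exists_isTranscendenceBasis_smul_isIntegral R A
  obtain rfl := eq_of_ringKrullDim_eq_of_isTranscendenceBasis ht hy hm
  let L := Localization.Away (f : A)
  have hAL : Function.Injective (algebraMap A L) :=
    IsLocalization.injective L (M := Submonoid.powers (f : A))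
      (powers_le_nonZeroDivisors_of_noZeroDivisors fun h ↦ hf (Subtype.ext h))
  have hinv : algebraMap A L (f : A) * IsLocalization.Away.invSelf (f : A) = 1 :=
    IsLocalization.Away.mul_invSelf (f : A)
  have : IsLocalization.Away (algebraMap R A f) L :=
    inferInstanceAs (IsLocalization.Away (f : A) (Localization.Away (f : A)))
  have hS := isIntegral_adjoin_localizationAway hG hint (L := L) _ hinv
  refine ⟨f, hf, finiteType_localizationAway_of_isIntegralElem_aeval hf hG hint Q hQR hyQ,
    algebraMap A L ∘ y, hy.1.map' (f := IsScalarTower.toAlgHom R A L) hAL, _, hinv, ?_,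
    Algebra.IsIntegral.comap_surjective _ _⟩
  have : Algebra.FiniteType A L :=
    inferInstanceAs (Algebra.FiniteType A (Localization.Away (f : A)))
  have : Algebra.FiniteType R L := .trans ‹Algebra.FiniteType R A› this
  have : Algebra.FiniteType
      (Algebra.adjoin R
        (Set.range (algebraMap A L ∘ y) ∪ {IsLocalization.Away.invSelf (f : A)})) L :=
    .of_restrictScalars_finiteType R _ _
  exact Algebra.IsIntegral.finite
end

section
/- Let A be a finitely generated algebra over a field k which is an integral domain, let p be a prime ideal of A of height d, and let g ∈ A be a nonzero element. Then there exists a chain of prime ideals (0) = p₀ ⊂ p₁ ⊂ ⋯ ⊂ p_d = p such that p_j has height j for every j = 0, …, d, and g ∉ p_j for every j < d. (Geometrically: given an irreducible closed subset C of codimension d in an irreducible affine variety Y and a nonempty principal open set U ⊆ Y, there is a chain Y = C₀ ⊃ C₁ ⊃ ⋯ ⊃ C_d = C of irreducible closed subsets with codim C_j = j and C_j ∩ U ≠ ∅ for all j < d.) -/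
/-- Relative form of Krull's principal ideal theorem: nothing lies strictly between a prime `c` and
a minimal prime over `c` together with one more element. -/
theorem Ideal.eq_of_lt_of_mem_minimalPrimes_span_insert {A : Type*} [CommRing A]
    [IsNoetherianRing A] {c q r : Ideal A} [c.IsPrime] [q.IsPrime] {x : A}
    (hr : r ∈ (Ideal.span (insert x (c : Set A))).minimalPrimes) (hcq : c ≤ q) (hqr : q < r) :
    q = c := by
  have hq := Ideal.mem_minimalPrimes_span_of_mem_minimalPrimes_span_insert hqr x c hr c hcq
    fun a ha ↦ Ideal.le_radical (Ideal.subset_span (Set.mem_insert_of_mem x ha))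
  rwa [Ideal.span_eq, Ideal.minimalPrimes_eq_subsingleton_self, Set.mem_singleton_iff] at hq

/-- In a Noetherian ring, if some prime lies strictly between the primes `c` and `Q`, then such a
prime can be chosen to avoid any given element outside `c`. -/
theorem PrimeSpectrum.exists_between_notMem {A : Type*} [CommRing A] [IsNoetherianRing A]
    {c q Q : PrimeSpectrum A} (hcq : c < q) (hqQ : q < Q) {g : A} (hg : g ∉ c.asIdeal) :
    ∃ r : PrimeSpectrum A, c < r ∧ r < Q ∧ g ∉ r.asIdeal := by
  set I := Ideal.span (insert g (c.asIdeal : Set A))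
  have hfin : (insert c.asIdeal I.minimalPrimes).Finite :=
    (Ideal.finite_minimalPrimes_of_isNoetherianRing A I).insert _
  have havoid : ¬ (Q.asIdeal : Set A) ⊆ ⋃ m ∈ insert c.asIdeal I.minimalPrimes, (m : Set A) := by
    intro h
    obtain ⟨m, rfl | hm, hQm⟩ := (Ideal.subset_union_prime_finite hfin (f := id) ⊥ ⊥ <| by
      rintro m (rfl | hm) - -
      exacts [c.isPrime, hm.isPrime]).mp h
    · exact (hcq.trans hqQ).not_ge hQm
    · exact hcq.ne' (PrimeSpectrum.ext (Ideal.eq_of_lt_of_mem_minimalPrimes_span_insert hm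
        hcq.le (lt_of_lt_of_le hqQ hQm)))
  obtain ⟨x, hxQ, hx⟩ := Set.not_subset.mp havoid
  simp only [Set.mem_iUnion, SetLike.mem_coe, not_exists] at hx
  obtain ⟨r, hr, hrQ⟩ := Ideal.exists_minimalPrimes_le
    (Ideal.span_le.mpr (Set.insert_subset hxQ (hcq.trans hqQ).le))
  have hxr : x ∈ r := hr.le (Ideal.subset_span (Set.mem_insert _ _))
  have hcr : c.asIdeal ≤ r := fun a ha ↦ hr.le (Ideal.subset_span (Set.mem_insert_of_mem x ha))
  have hrp : r.IsPrime := hr.isPrime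
  refine ⟨⟨r, hrp⟩, lt_of_le_not_ge hcr fun h ↦ hx _ (Set.mem_insert _ _) (h hxr),
    lt_of_le_not_ge hrQ fun h ↦ ?_, fun hgr ↦ ?_⟩
  · exact hcq.ne' (PrimeSpectrum.ext (Ideal.eq_of_lt_of_mem_minimalPrimes_span_insert hr
      hcq.le (lt_of_lt_of_le hqQ h)))
  · obtain ⟨m, hm, hmr⟩ := Ideal.exists_minimalPrimes_le (I := I)
      (Ideal.span_le.mpr (Set.insert_subset hgr hcr))
    have hmp : m.IsPrime := hm.isPrime
    have hcm : c.asIdeal ≤ m := fun a ha ↦ hm.le (Ideal.subset_span (Set.mem_insert_of_mem g ha))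
    have hmc := Ideal.eq_of_lt_of_mem_minimalPrimes_span_insert hr hcm
      (lt_of_le_not_ge hmr fun h ↦ hx m (Set.mem_insert_of_mem _ hm) (h hxr))
    exact hg (hmc ▸ hm.le (Ideal.subset_span (Set.mem_insert _ _)))

/-- In a Noetherian domain, a prime of height `n + 1` contains a prime of height `n` avoiding a
given nonzero element. -/
theorem PrimeSpectrum.exists_lt_height_eq_notMem {A : Type*} [CommRing A] [IsDomain A]
    [IsNoetherianRing A] {g : A} (hg : g ≠ 0) {n : ℕ} {p : PrimeSpectrum A}
    (hp : Order.height p = n + 1) :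
    ∃ q < p, Order.height q = n ∧ g ∉ q.asIdeal := by
  induction n generalizing p with
  | zero =>
    obtain ⟨-, ⟨q, hqp, -⟩, -⟩ := Order.height_eq_coe_add_one_iff.mp hp
    refine ⟨⊥, bot_le.trans_lt hqp, by simp, by simpa using hg⟩
  | succ n ih =>
    obtain ⟨-, ⟨q, hqp, hq⟩, hlt⟩ := Order.height_eq_coe_add_one_iff.mp hp
    obtain ⟨c, hcq, hc, hgc⟩ := ih (p := q) (by simpa using hq)
    obtain ⟨r, hcr, hrp, hgr⟩ := PrimeSpectrum.exists_between_notMem hcq hqp hgc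
    refine ⟨r, hrp, le_antisymm (hlt r hrp) ?_, hgr⟩
    simpa [hc] using Order.height_add_one_le hcr

/-- In a Noetherian domain, a prime of height `d` is the top of a chain of primes of heights
`0, …, d` whose members below the top avoid a given nonzero element. -/
theorem PrimeSpectrum.exists_chain_height_eq_notMem {A : Type*} [CommRing A] [IsDomain A]
    [IsNoetherianRing A] {g : A} (hg : g ≠ 0) {d : ℕ} {p : PrimeSpectrum A}
    (hp : Order.height p = d) :
    ∃ c : Fin (d + 1) → PrimeSpectrum A, StrictMono c ∧ c (Fin.last d) = p ∧
      (∀ j : Fin (d + 1), Order.height (c j) = (j : ℕ)) ∧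
      ∀ j : Fin (d + 1), (j : ℕ) < d → g ∉ (c j).asIdeal := by
  induction d generalizing p with
  | zero =>
    refine ⟨fun _ ↦ p, Fin.strictMono_iff_lt_succ.mpr fun i ↦ i.elim0, rfl, fun j ↦ ?_, fun j hj ↦ by simp at hj⟩
    simpa using hp
  | succ d ih =>
    obtain ⟨q, hqp, hq, hgq⟩ := PrimeSpectrum.exists_lt_height_eq_notMem hg
      (by simpa using hp : Order.height p = d + 1)
    obtain ⟨c, hc, hcl, hch, hcg⟩ := ih hq
    refine ⟨Fin.snoc c p, ?_, by simp, fun j ↦ ?_, fun j hj ↦ ?_⟩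
    · refine Fin.strictMono_iff_lt_succ.mpr fun i ↦ ?_
      induction i using Fin.lastCases with
      | last => simpa [hcl] using hqp
      | cast i =>
        rw [Fin.succ_castSucc, Fin.snoc_castSucc, Fin.snoc_castSucc]
        exact hc Fin.castSucc_lt_succ
    · induction j using Fin.lastCases with
      | last => simpa using hp
      | cast j => simpa using hch j
    · induction j using Fin.lastCases with
      | last => simp at hj
      | cast j =>
        rw [Fin.snoc_castSucc]
        induction j using Fin.lastCases with
        | last => rwa [hcl]
        | cast j => exact hcg _ (by simp)

/-- In a finitely generated domain `A` over a field `k`, given a prime `p` of height `d`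
and a nonzero `g ∈ A`, there is a chain of primes `(0) = p₀ ⊂ p₁ ⊂ ⋯ ⊂ p_d = p` with
`p_j` of height `j` for all `j`, and `g ∉ p_j` for all `j < d`. -/
theorem stmt_10 (k A : Type*) [Field k] [CommRing A] [IsDomain A] [Algebra k A]
    [Algebra.FiniteType k A] (d : ℕ) (p : Ideal A) (hp : p.IsPrime)
    (hd : Order.height (⟨p, hp⟩ : PrimeSpectrum A) = d) (g : A) (hg : g ≠ 0) :
    ∃ (c : Fin (d + 1) → Ideal A) (hc : ∀ j, (c j).IsPrime),
      StrictMono c ∧ c 0 = ⊥ ∧ c (Fin.last d) = p ∧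
      (∀ j : Fin (d + 1), Order.height (⟨c j, hc j⟩ : PrimeSpectrum A) = (j : ℕ)) ∧
      (∀ j : Fin (d + 1), (j : ℕ) < d → g ∉ c j) := by
  have : IsNoetherianRing A := Algebra.FiniteType.isNoetherianRing k A
  obtain ⟨c, hc, hcl, hch, hcg⟩ := PrimeSpectrum.exists_chain_height_eq_notMem hg hd
  refine ⟨fun j ↦ (c j).asIdeal, fun j ↦ (c j).isPrime, fun i j h ↦ hc h, ?_, ?_, hch, hcg⟩
  · have h0 : c 0 = ⊥ := by simpa using hch 0
    simp [h0]
  · simp [hcl]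
end

section
/- Let k be an algebraically closed field of characteristic 0, A a finitely generated k-algebra that is an integral domain and integrally closed in its fraction field, G a group acting on A by k-algebra automorphisms, and B = A^G. Suppose R ⊆ B is a finitely generated separating subalgebra which is a unique factorization domain and whose fraction field equals the fraction field of B. Then B is a finitely generated k-algebra; more precisely, there exists f ∈ R such that B = R_f, the localization of R away from f, viewed inside the common fraction field. -/
universe u

/-- A Noetherian integrally closed domain is completely integrally closed: `w / t` is integral if
`c * (w / t) ^ n` lies in the ring for all `n`. -/
theorem dvd_of_forall_pow_dvd_mul_pow {A : Type*} [CommRing A] [IsDomain A] [IsNoetherianRing A]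
    [IsIntegrallyClosed A] {t w c : A} (ht : t ≠ 0) (hc : c ≠ 0)
    (h : ∀ n : ℕ, t ^ n ∣ c * w ^ n) : t ∣ w := by
  let K := FractionRing A
  have htK : algebraMap A K t ≠ 0 := by simpa using ht
  have hint : IsIntegral A (algebraMap A K w / algebraMap A K t) := by
    refine IsAlmostIntegral.isIntegral ⟨c, mem_nonZeroDivisors_of_ne_zero hc, fun n => ?_⟩
    obtain ⟨d, hd⟩ := h n
    refine ⟨d, ?_⟩
    rw [Algebra.smul_def, div_pow, ← mul_div_assoc, eq_div_iff (pow_ne_zero _ htK),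
      ← map_pow, ← map_pow, ← map_mul, ← map_mul, hd, mul_comm]
  obtain ⟨a, ha⟩ := IsIntegrallyClosed.isIntegral_iff.mp hint
  refine ⟨a, IsFractionRing.injective A K ?_⟩
  rw [map_mul, ha, mul_div_cancel₀ _ htK]

/-- If `B` contains every element of `A` which is a quotient of elements of `B`, some minimal prime
`P` over `p ∈ B` contracts to a prime of `B` which, after inverting some `w ∉ P`, is generated by a
single `t`. -/
theorem exists_minimalPrimes_uniformizer {A : Type*} [CommRing A] [IsDomain A] [IsNoetherianRing A]
    [IsIntegrallyClosed A] (B : Subring A)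
    (hB : ∀ a : A, ∀ b ∈ B, b ≠ 0 → a * b ∈ B → a ∈ B) {p : A} (hpB : p ∈ B) (hp0 : p ≠ 0)
    (hp : ¬ IsUnit p) :
    ∃ P ∈ (Ideal.span {p}).minimalPrimes, ∃ t ∈ B, ∃ w ∈ B, t ∈ P ∧ w ∉ P ∧ t ≠ 0 ∧
      ∀ c ∈ B, c ∈ P → ∃ c' ∈ B, w * c = t * c' := by
  let J : A → Ideal A := fun y => Submodule.comap (LinearMap.mulRight A y) (Ideal.span {p})
  have hJ : ∀ y a, a ∈ J y ↔ p ∣ a * y := fun y a => by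
    simp [J, Ideal.mem_span_singleton]
  obtain ⟨y, ⟨hyB, hyp⟩, hmax⟩ := exists_maximalFor_of_wellFoundedGT
    (fun y => y ∈ B ∧ ¬ p ∣ y) J ⟨1, B.one_mem, fun h => hp (isUnit_of_dvd_one h)⟩
  have hQ : ∀ b ∈ B, ∀ b' ∈ B, b * b' ∈ J y → b' ∉ J y → b ∈ J y := by
    intro b hb b' hb' hbb hb'y
    have hle : J (b' * y) ≤ J y := hmax ⟨B.mul_mem hb' hyB, by rwa [hJ] at hb'y⟩ fun a ha => by
      rw [hJ] at ha ⊢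
      rw [mul_left_comm]
      exact ha.mul_left _
    refine hle ((hJ _ _).2 ?_)
    rwa [hJ, mul_assoc] at hbb
  have hquot : ∀ c ∈ B, c ∈ J y → ∃ c' ∈ B, c * y = p * c' := by
    intro c hc hcy
    obtain ⟨c', hc'⟩ := (hJ _ _).1 hcy
    exact ⟨c', hB c' p hpB hp0 (by rw [mul_comm, ← hc']; exact B.mul_mem hc hyB), hc'⟩
  have hpJ : p ∈ J y := (hJ _ _).2 (dvd_mul_right _ _)
  obtain ⟨t, htB, htJ, w, hwB, htw, hwJ⟩ :
      ∃ t ∈ B, t ∈ J y ∧ ∃ w ∈ B, t * y = p * w ∧ w ∉ J y := by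
    by_contra! hcon
    refine hyp (dvd_of_forall_pow_dvd_mul_pow hp0 hp0 fun n => ?_)
    suffices ∃ c ∈ B, c ∈ J y ∧ p * y ^ n = p ^ n * c from this.imp fun c hc => hc.2.2
    induction n with
    | zero => exact ⟨p, hpB, hpJ, by simp⟩
    | succ n ih =>
      obtain ⟨c, hcB, hcJ, hc⟩ := ih
      obtain ⟨c', hcB', hc'⟩ := hquot c hcB hcJ
      exact ⟨c', hcB', hcon c hcB hcJ c' hcB' hc',
        by rw [pow_succ, ← mul_assoc, hc, mul_assoc, hc', pow_succ, mul_assoc]⟩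
  have ht0 : t ≠ 0 := by
    rintro rfl
    rw [zero_mul, eq_comm, mul_eq_zero, or_iff_right hp0] at htw
    exact hwJ (htw ▸ zero_mem _)
  have hstep : ∀ c ∈ B, c ∈ J y → ∃ c' ∈ B, w * c = t * c' := by
    intro c hcB hcJ
    obtain ⟨c', hcB', hc'⟩ := hquot c hcB hcJ
    exact ⟨c', hcB', mul_left_cancel₀ hp0 (by linear_combination (-c) * htw + t * hc')⟩
  let M : Submonoid A :=
    { carrier := {b | b ∈ B ∧ b ∉ J y}
      one_mem' := ⟨B.one_mem, by rwa [hJ, one_mul]⟩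
      mul_mem' := fun {a b} ha hb =>
        ⟨B.mul_mem ha.1 hb.1, fun h => ha.2 (hQ a ha.1 b hb.1 h hb.2)⟩ }
  obtain ⟨P', hP', hJP', hdisj⟩ := Ideal.exists_le_prime_disjoint (J y) M
    (Set.disjoint_left.2 fun a ha hM => hM.2 ha)
  obtain ⟨P, hP, hPP'⟩ := Ideal.exists_minimalPrimes_le
    (show Ideal.span {p} ≤ P' by simpa [Ideal.span_le] using hJP' hpJ)
  have := hP.1.1
  have hPJ : ∀ c ∈ B, c ∈ P' → c ∈ J y := fun c hcB hcP => by
    by_contra h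
    exact Set.disjoint_left.1 hdisj hcP ⟨hcB, h⟩
  refine ⟨P, hP, t, htB, w, hwB, ?_, fun h => hwJ (hPJ w hwB (hPP' h)), ht0,
    fun c hcB hcP => hstep c hcB (hPJ c hcB (hPP' hcP))⟩
  by_contra htP
  have hdvd : t ∣ w := by
    refine dvd_of_forall_pow_dvd_mul_pow ht0 hp0 fun n => ?_
    suffices ∃ c ∈ B, c ∈ P ∧ p * w ^ n = t ^ n * c from this.imp fun c hc => hc.2.2
    induction n with
    | zero => exact ⟨p, hpB, hP.1.2 (Ideal.mem_span_singleton_self p), by simp⟩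
    | succ n ih =>
      obtain ⟨c, hcB, hcP, hc⟩ := ih
      obtain ⟨c', hcB', hc'⟩ := hstep c hcB (hPJ c hcB (hPP' hcP))
      refine ⟨c', hcB', (this.mem_or_mem (hc' ▸ P.mul_mem_left w hcP)).resolve_left htP, ?_⟩
      rw [pow_succ, ← mul_assoc, hc, mul_assoc, mul_comm c, hc', pow_succ, mul_assoc]
  exact hwJ (hPJ w hwB (P'.mem_of_dvd hdvd (hJP' htJ)))

theorem exists_algHom_le_ker (k : Type*) {A : Type*} [Field k] [IsAlgClosed k] [CommRing A]
    [Algebra k A] [Algebra.FiniteType k A] {I : Ideal A} (hI : I ≠ ⊤) :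
    ∃ v : A →ₐ[k] k, ∀ a ∈ I, v a = 0 := by
  obtain ⟨m, hm, hIm⟩ := Ideal.exists_le_maximal I hI
  let := Ideal.Quotient.field m
  have := finite_of_finite_type_of_isJacobsonRing k (A ⧸ m)
  let e : (A ⧸ m) →ₐ[k] k := IsAlgClosed.lift
  refine ⟨e.comp (Ideal.Quotient.mkₐ k m), fun a ha => ?_⟩
  simp [Ideal.Quotient.eq_zero_iff_mem.2 (hIm ha)]

theorem exists_algHom_apply_ne_zero (k : Type*) {A : Type*} [Field k] [IsAlgClosed k] [CommRing A]
    [IsReduced A] [Algebra k A] [Algebra.FiniteType k A] {h : A} (hh : h ≠ 0) :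
    ∃ v : A →ₐ[k] k, v h ≠ 0 := by
  have : Nontrivial (Localization.Away h) := by
    refine not_subsingleton_iff_nontrivial.1 fun hs => hh ?_
    rw [IsLocalization.subsingleton_iff (M := Submonoid.powers h)] at hs
    obtain ⟨n, hn⟩ := hs
    exact IsReduced.eq_zero _ ⟨n, hn⟩
  have : Algebra.FiniteType A (Localization.Away h) :=
    IsLocalization.finiteType_of_monoid_fg (Submonoid.powers h) _
  have : Algebra.FiniteType k (Localization.Away h) := Algebra.FiniteType.trans ‹_› this
  obtain ⟨v, -⟩ := exists_algHom_le_ker k (A := Localization.Away h) (I := ⊥) bot_ne_top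
  refine ⟨v.comp (IsScalarTower.toAlgHom k A _), ?_⟩
  exact ((IsLocalization.Away.algebraMap_isUnit h).map v).ne_zero

/-- A dominant morphism of affine varieties hits every point of a nonempty basic open set. -/
theorem exists_ne_zero_forall_exists_lift {k C A : Type*} [Field k] [IsAlgClosed k] [CommRing C]
    [IsDomain C] [Algebra k C] [Algebra.FiniteType k C] [CommRing A] [IsDomain A] [Algebra k A]
    [Algebra.FiniteType k A] (φ : C →ₐ[k] A) (hφ : Function.Injective φ) :
    ∃ h : C, h ≠ 0 ∧ ∀ u : C →ₐ[k] k, u h ≠ 0 → ∃ v : A →ₐ[k] k, v.comp φ = u := by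
  have : IsNoetherianRing C := Algebra.FiniteType.isNoetherianRing k C
  have hfin : (φ : C →+* A).FiniteType := by
    apply RingHom.FiniteType.of_comp_finiteType (f := algebraMap k C)
    rw [φ.comp_algebraMap, RingHom.finiteType_algebraMap]
    infer_instance
  obtain ⟨S, hS⟩ := PrimeSpectrum.exists_constructibleSetData_iff.2
    (PrimeSpectrum.isConstructible_range_comap (RingHom.FinitePresentation.of_finiteType.1 hfin))
  have hbot : (⟨⊥, Ideal.isPrime_bot⟩ : PrimeSpectrum C) ∈ S.toSet := by
    rw [hS]
    refine ⟨⟨⊥, Ideal.isPrime_bot⟩, PrimeSpectrum.ext ?_⟩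
    exact Ideal.comap_bot_of_injective (φ : C →+* A) hφ
  simp only [PrimeSpectrum.ConstructibleSetData.toSet, Set.mem_iUnion] at hbot
  obtain ⟨D, hD, hbotD⟩ := hbot
  have hg : ∀ i, D.g i = 0 := by
    simpa [Set.range_subset_iff] using hbotD.1
  have hf : D.f ≠ 0 := by simpa using hbotD.2
  refine ⟨D.f, hf, fun u hu => ?_⟩
  have hmem : (⟨RingHom.ker u, RingHom.ker_isPrime u⟩ : PrimeSpectrum C) ∈ S.toSet := by
    refine Set.mem_biUnion hD ⟨?_, by simpa using hu⟩
    rintro _ ⟨i, rfl⟩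
    simp [hg]
  rw [hS] at hmem
  obtain ⟨P, hP⟩ := hmem
  obtain ⟨v, hv⟩ := exists_algHom_le_ker k P.isPrime.ne_top
  refine ⟨v, AlgHom.ext fun c => ?_⟩
  have hc : c - algebraMap k C (u c) ∈ RingHom.ker u := by simp
  have hc' : φ (c - algebraMap k C (u c)) ∈ P.asIdeal := by
    rw [← show _ = RingHom.ker u from congrArg PrimeSpectrum.asIdeal hP] at hc
    exact hc
  simpa [sub_eq_zero] using hv _ hc'
theorem isAlgebraic_of_forall_algHom_eq {k D : Type*} [Field k] [IsAlgClosed k] [CommRing D]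
    [IsDomain D] [Algebra k D] [Algebra.FiniteType k D] {R : Subalgebra k D} (hR : R.FG) {b : D}
    (h : ∀ u v : D →ₐ[k] k, (∀ r ∈ R, u r = v r) → u b = v b) : IsAlgebraic R b := by
  by_contra hb
  have hinj : Function.Injective (Polynomial.aeval (R := R) b) :=
    transcendental_iff_injective.1 hb
  have : Algebra.FiniteType k R := R.fg_iff_finiteType.1 hR
  have : Algebra.FiniteType k (Polynomial R) := Algebra.FiniteType.trans ‹_› inferInstance
  obtain ⟨f, hf, hlift⟩ := exists_ne_zero_forall_exists_lift
    ((Polynomial.aeval (R := R) b).restrictScalars k) hinj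
  obtain ⟨u, hu⟩ := exists_algHom_apply_ne_zero k (Polynomial.leadingCoeff_ne_zero.2 hf)
  have hfu : f.map (u : R →+* k) ≠ 0 := fun h0 => hu (by
    simpa using congrArg (Polynomial.coeff · f.natDegree) h0)
  have hext : ∀ x : k, ¬ (f.map (u : R →+* k)).IsRoot x →
      ∃ v : D →ₐ[k] k, v b = x ∧ ∀ r : R, v r = u r := by
    intro x hx
    obtain ⟨v, hv⟩ := hlift ((Polynomial.aeval x).comp (Polynomial.mapAlgHom u)) (by
      simpa [Polynomial.IsRoot, Polynomial.aeval_def] using hx)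
    refine ⟨v, ?_, fun r => ?_⟩
    · simpa using DFunLike.congr_fun hv Polynomial.X
    · simpa using DFunLike.congr_fun hv (Polynomial.C r)
  have hinf : {x | (f.map (u : R →+* k)).IsRoot x}ᶜ.Infinite :=
    (Polynomial.finite_setOfPred_isRoot hfu).infinite_compl
  obtain ⟨x, hx, y, hy, hxy⟩ := hinf.nontrivial
  obtain ⟨v, hvb, hv⟩ := hext x hx
  obtain ⟨v', hvb', hv'⟩ := hext y hy
  refine hxy ?_
  rw [← hvb, ← hvb']
  exact h v v' fun r hr => (hv ⟨r, hr⟩).trans (hv' ⟨r, hr⟩).symm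

theorem trdeg_add_one_le_of_surjective_of_not_injective {k : Type*} {C C' : Type u} [Field k]
    [CommRing C] [IsDomain C] [Algebra k C] [CommRing C'] [IsDomain C'] [Algebra k C']
    (φ : C →ₐ[k] C')
    (hφ : Function.Surjective φ) {a : C} (ha : a ≠ 0) (hφa : φ a = 0)
    (hfin : Algebra.trdeg k C < Cardinal.aleph0) :
    Algebra.trdeg k C' + 1 ≤ Algebra.trdeg k C := by
  by_contra! hlt
  obtain ⟨ι, x, hx⟩ := exists_isTranscendenceBasis' k C'
  choose y hy using fun i => hφ (x i)
  have hφy : φ ∘ y = x := funext hy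
  have hyind : AlgebraicIndependent k y := by
    refine AlgebraicIndependent.of_comp φ ?_
    rw [hφy]
    exact hx.1
  have hle : Algebra.trdeg k C ≤ Algebra.trdeg k C' := by
    by_contra! h
    exact hlt.not_ge (Cardinal.add_one_le_of_lt h)
  rw [← hx.cardinalMk_eq_trdeg] at hle
  have hyb := hyind.isTranscendenceBasis_of_trdeg_le hfin hle
  have := hyb.isAlgebraic
  have halg : IsAlgebraic (Algebra.adjoin k (Set.range y)) a := Algebra.IsAlgebraic.isAlgebraic a
  obtain ⟨q, hq0, hq⟩ :=
    halg.exists_nonzero_coeff_and_aeval_eq_zero (mem_nonZeroDivisors_of_ne_zero ha)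
  have hinj : ∀ c ∈ Algebra.adjoin k (Set.range y), φ c = 0 → c = 0 := by
    intro c hc hc0
    rw [Algebra.adjoin_range_eq_range_aeval] at hc
    obtain ⟨F, rfl⟩ := hc
    have : MvPolynomial.aeval x F = 0 := by
      rw [← hφy, ← hc0]
      exact (MvPolynomial.comp_aeval_apply y φ F).symm
    rw [(injective_iff_map_eq_zero _).1 hx.1 F this, map_zero]
  apply hq0
  refine Subtype.ext (hinj _ (q.coeff 0).2 ?_)
  obtain ⟨p, hp⟩ := Polynomial.X_dvd_sub_C (p := q)
  have h2 := congrArg (Polynomial.aeval a) hp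
  simp only [map_sub, hq, Polynomial.aeval_C, map_mul, Polynomial.aeval_X] at h2
  have h3 := congrArg φ h2
  simpa [hφa] using h3

theorem trdeg_le_trdeg_quotient_add_one {k A : Type*} [Field k] [CommRing A] [IsDomain A]
    [Algebra k A] [Algebra.FiniteType k A] {p : A} {P : Ideal A}
    (hP : P ∈ (Ideal.span {p}).minimalPrimes) :
    Algebra.trdeg k A ≤ Algebra.trdeg k (A ⧸ P) + 1 := by
  have : IsNoetherianRing A := Algebra.FiniteType.isNoetherianRing k A
  have hPp := hP.1.1
  obtain ⟨m, g, hg, hint⟩ := exists_integral_inj_algHom_of_fg k A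
  let S := MvPolynomial (Fin m) k
  algebraize [(g : S →+* A)]
  have : FaithfulSMul S A := (faithfulSMul_iff_algebraMap_injective S A).2 hg
  have : IsScalarTower k S A := IsScalarTower.of_algebraMap_eq fun c => (g.commutes c).symm
  have hA : Algebra.trdeg k A = m := by
    have h := lift_trdeg_add_eq k S A
    rw [trdeg_eq_zero (R := S) (A := A), MvPolynomial.trdeg_of_isDomain] at h
    simpa using h.symm
  have hmain : ∃ n : ℕ, m ≤ n + 1 ∧ ∃ x : Fin n → A ⧸ P, AlgebraicIndependent k x := by
    let ψ : S →ₐ[k] A ⧸ P := (Ideal.Quotient.mkₐ k P).comp g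
    have hψ : ∀ F : S, ψ F = 0 ↔ F ∈ P.under S := fun F => Ideal.Quotient.eq_zero_iff_mem
    have hψX : ∀ F : S, ψ F = MvPolynomial.aeval (fun i => ψ (MvPolynomial.X i)) F := fun F =>
      DFunLike.congr_fun (MvPolynomial.aeval_unique ψ) F
    by_cases hbot : P.under S = ⊥
    · refine ⟨m, by lia, fun i => ψ (MvPolynomial.X i),
        (injective_iff_map_eq_zero _).2 fun F hF => ?_⟩
      rw [← hψX, hψ, hbot] at hF
      exact hF
    have : (P.under S).IsPrime := inferInstance
    obtain ⟨f, hfP, hf⟩ := this.exists_mem_prime_of_ne_bot hbot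
    have hspan : Ideal.span {f} = P.under S := by
      have hle : Ideal.span {f} ≤ P.under S := by simpa [Ideal.span_le] using hfP
      by_contra hne
      have := (Ideal.span_singleton_prime hf.ne_zero).2 hf
      obtain ⟨P₁, hlt, hP₁, hlies⟩ :=
        Ideal.exists_ideal_lt_liesOver_of_lt P (lt_of_le_of_ne hle hne)
      have h1 : P.height ≤ 1 := Ideal.height_le_one_of_isPrincipal_of_mem_minimalPrimes _ _ hP
      have hP₁0 : ⊥ < P₁ := by
        refine bot_lt_iff_ne_bot.2 fun h0 => ?_
        have : algebraMap S A f ∈ P₁ := by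
          have := hlies.over ▸ Ideal.mem_span_singleton_self f
          exact this
        rw [h0, Ideal.mem_bot] at this
        exact hf.ne_zero (hg (by rw [map_zero]; exact this))
      have h2 := Ideal.height_add_one_le_of_lt_of_isPrime hP₁0
      have h3 := Ideal.height_add_one_le_of_lt_of_isPrime hlt
      have h4 : (⊥ : Ideal A).height + 1 + 1 ≤ 1 := by grw [h2, h3, h1]
      rw [Ideal.height_bot] at h4
      exact absurd h4 (by norm_num)
    obtain ⟨i, hi⟩ : ∃ i, f.degreeOf i ≠ 0 := by
      by_contra! h
      have hvars : f.vars = ∅ := Finset.eq_empty_of_forall_notMem fun i hi =>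
        MvPolynomial.mem_vars_iff_degreeOf_ne_zero.1 hi (h i)
      rw [MvPolynomial.vars_eq_empty_iff_eq_C] at hvars
      refine hf.not_isUnit ?_
      rw [hvars]
      refine (Ne.isUnit fun h0 => hf.ne_zero ?_).map MvPolynomial.C
      rw [hvars, h0, map_zero]
    obtain ⟨n, rfl⟩ : ∃ n, m = n + 1 := ⟨m - 1, by have := i.2; lia⟩
    refine ⟨n, le_rfl, fun j => ψ (MvPolynomial.X (i.succAbove j)),
      (injective_iff_map_eq_zero _).2 fun F hF => ?_⟩
    have hF' : MvPolynomial.rename i.succAbove F ∈ P.under S := by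
      rw [← hψ, hψX, MvPolynomial.aeval_rename]
      exact hF
    rw [← hspan, Ideal.mem_span_singleton] at hF'
    obtain ⟨q, hq⟩ := hF'
    by_contra hF0
    have hF1 : MvPolynomial.rename i.succAbove F ≠ 0 := by
      rwa [Ne, map_eq_zero_iff _ (MvPolynomial.rename_injective _ i.succAbove_right_injective)]
    have hq0 : q ≠ 0 := by
      rintro rfl
      simp [hF1] at hq
    have hdeg := MvPolynomial.degreeOf_mul_eq (n := i) hf.ne_zero hq0
    rw [← hq] at hdeg
    have : (MvPolynomial.rename i.succAbove F).degreeOf i = 0 := by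
      by_contra hne
      obtain ⟨j, -, hj⟩ := MvPolynomial.mem_vars_rename _ _
        (MvPolynomial.mem_vars_iff_degreeOf_ne_zero.2 hne)
      exact i.succAbove_ne j hj
    lia
  obtain ⟨n, hmn, x, hx⟩ := hmain
  have := hx.lift_cardinalMk_le_trdeg
  simp only [Cardinal.mk_fin, Cardinal.lift_natCast, Cardinal.lift_id'] at this
  rw [hA]
  calc (m : Cardinal) ≤ n + 1 := by exact_mod_cast hmn
    _ ≤ _ := by gcongr

theorem AlgebraicIndependent.of_inclusion {k A ι : Type*} [CommRing k] [CommRing A] [Algebra k A]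
    {R B : Subalgebra k A} (hRB : R ≤ B) {u : ι → A} (hu : AlgebraicIndependent B u) :
    AlgebraicIndependent R u := by
  refine (injective_iff_map_eq_zero _).2 fun F hF => ?_
  refine MvPolynomial.map_injective (Subalgebra.inclusion hRB : R →+* B)
    (Subalgebra.inclusion_injective hRB) ?_
  refine (injective_iff_map_eq_zero _).1 hu _ ?_ |>.trans (map_zero _).symm
  rw [← hF, MvPolynomial.aeval_def, MvPolynomial.eval₂_map]
  rfl

theorem AlgebraicIndependent.of_quotient {k A ι : Type*} [CommRing k] [CommRing A] [IsDomain A]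
    [IsNoetherianRing A] [IsIntegrallyClosed A] [Algebra k A] (B : Subalgebra k A) {P : Ideal A}
    [P.IsPrime] {t w : A} (ht : t ∈ B) (hw : w ∈ B) (htP : t ∈ P) (hwP : w ∉ P) (ht0 : t ≠ 0)
    (htw : ∀ c ∈ B, c ∈ P → ∃ c' ∈ B, w * c = t * c') {u : ι → A}
    (hu : AlgebraicIndependent (B.map (Ideal.Quotient.mkₐ k P))
      fun i => Ideal.Quotient.mk P (u i)) :
    AlgebraicIndependent B u := by
  refine (injective_iff_map_eq_zero _).2 fun F hF => ?_
  by_contra hF0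
  have hcoeff : ∀ G : MvPolynomial ι B, MvPolynomial.aeval u G = 0 →
      ∀ m, ((G.coeff m : B) : A) ∈ P := by
    intro G hG m
    let ρ : B →+* B.map (Ideal.Quotient.mkₐ k P) :=
      ((Ideal.Quotient.mkₐ k P : A →+* A ⧸ P).comp (B.val : B →+* A)).codRestrict _
        fun b => ⟨b, b.2, rfl⟩
    have h0 : MvPolynomial.map ρ G = 0 := by
      refine (injective_iff_map_eq_zero _).1 hu _ ?_
      rw [MvPolynomial.aeval_def, MvPolynomial.eval₂_map, ← map_zero (Ideal.Quotient.mk P), ← hG,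
        MvPolynomial.aeval_def, MvPolynomial.hom_eval₂]
      rfl
    have h1 : ρ (G.coeff m) = 0 := by
      rw [← MvPolynomial.coeff_map, h0, MvPolynomial.coeff_zero]
    exact Ideal.Quotient.eq_zero_iff_mem.1 (congrArg Subtype.val h1)
  have hiter : ∀ n : ℕ, ∃ G : MvPolynomial ι B, MvPolynomial.aeval u G = 0 ∧
      MvPolynomial.C (⟨w, hw⟩ ^ n) * F = MvPolynomial.C (⟨t, ht⟩ ^ n) * G := by
    intro n
    induction n with
    | zero => exact ⟨F, hF, by simp⟩
    | succ n ih =>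
      obtain ⟨G, hG, hGn⟩ := ih
      obtain ⟨G', hG'⟩ : MvPolynomial.C (⟨t, ht⟩ : B) ∣ MvPolynomial.C (⟨w, hw⟩ : B) * G := by
        rw [MvPolynomial.C_dvd_iff_dvd_coeff]
        intro m
        obtain ⟨c', hc', h⟩ := htw _ (G.coeff m).2 (hcoeff G hG m)
        exact ⟨⟨c', hc'⟩, by rw [MvPolynomial.coeff_C_mul]; exact Subtype.ext h⟩
      refine ⟨G', ?_, ?_⟩
      · have := congrArg (MvPolynomial.aeval u) hG'
        simp only [map_mul, hG, mul_zero, MvPolynomial.aeval_C] at this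
        exact (mul_eq_zero.1 this.symm).resolve_left ht0
      · rw [pow_succ, pow_succ, map_mul, map_mul, mul_assoc, mul_assoc, ← hG', mul_left_comm,
          mul_left_comm _ _ G, ← hGn]
  obtain ⟨m, hm⟩ := MvPolynomial.ne_zero_iff.1 hF0
  refine hwP (P.mem_of_dvd (dvd_of_forall_pow_dvd_mul_pow (c := (F.coeff m : B)) ht0
    (by simpa using hm) fun n => ?_) htP)
  obtain ⟨G, -, hG⟩ := hiter n
  have := congrArg Subtype.val (congrArg (MvPolynomial.coeff m) hG)
  simp only [MvPolynomial.coeff_C_mul] at this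
  exact ⟨(G.coeff m : B), by rw [mul_comm]; exact this⟩

theorem trdeg_quotient_le_trdeg {k A : Type*} [Field k] [CommRing A] [IsDomain A]
    [IsNoetherianRing A] [IsIntegrallyClosed A] [Algebra k A] {R B : Subalgebra k A} (hRB : R ≤ B)
    {P : Ideal A} [P.IsPrime] {t w : A} (ht : t ∈ B) (hw : w ∈ B) (htP : t ∈ P) (hwP : w ∉ P)
    (ht0 : t ≠ 0) (htw : ∀ c ∈ B, c ∈ P → ∃ c' ∈ B, w * c = t * c')
    (halg : ∀ b ∈ B, IsAlgebraic (R.map (Ideal.Quotient.mkₐ k P)) (Ideal.Quotient.mk P b)) :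
    Algebra.trdeg (R.map (Ideal.Quotient.mkₐ k P)) (A ⧸ P) ≤ Algebra.trdeg R A := by
  let R' := R.map (Ideal.Quotient.mkₐ k P)
  let B' := B.map (Ideal.Quotient.mkₐ k P)
  have hRB' : R' ≤ B' := Subalgebra.map_mono hRB
  let : Algebra R' B' := (Subalgebra.inclusion hRB').toAlgebra
  have : IsScalarTower R' B' (A ⧸ P) := IsScalarTower.of_algebraMap_eq fun _ => rfl
  have : Algebra.IsAlgebraic R' B' := by
    refine ⟨fun ⟨_, b, hb, hbx⟩ => ?_⟩
    rw [← isAlgebraic_algebraMap_iff (A := A ⧸ P) Subtype.val_injective]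
    exact hbx ▸ halg b hb
  obtain ⟨ι, x, hx⟩ := exists_isTranscendenceBasis' R' (A ⧸ P)
  choose u hu using fun i => Ideal.Quotient.mk_surjective (x i)
  obtain rfl : (fun i => Ideal.Quotient.mk P (u i)) = x := funext hu
  rw [← hx.cardinalMk_eq_trdeg]
  exact ((AlgebraicIndependent.of_quotient B ht hw htP hwP ht0 htw
    (hx.1.extendScalars B')).of_inclusion hRB).cardinalMk_le_trdeg

/-- If a fraction `r / s` of elements of a separating subalgebra `R` lies in `A`, then every prime
of `R` dividing `s` divides `r` or becomes a unit in `A`. -/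
theorem dvd_of_mul_eq_of_separating {k A : Type*} [Field k] [IsAlgClosed k] [CommRing A]
    [IsDomain A] [IsIntegrallyClosed A] [Algebra k A] [Algebra.FiniteType k A]
    {R B : Subalgebra k A} (hRB : R ≤ B) (hR : R.FG)
    (hsep : ∀ u v : A →ₐ[k] k, (∀ r ∈ R, u r = v r) → ∀ b ∈ B, u b = v b)
    (hB : ∀ a : A, ∀ b ∈ B, b ≠ 0 → a * b ∈ B → a ∈ B) {p : R} (hp : Prime p)
    (hpA : ¬ IsUnit (p : A)) {b : A} {r s : R} (hbs : b * s = r) (hps : p ∣ s) :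
    p ∣ r := by
  by_contra hpr
  have : IsNoetherianRing A := Algebra.FiniteType.isNoetherianRing k A
  have hp0 : (p : A) ≠ 0 := by simpa using hp.ne_zero
  obtain ⟨P, hP, t, ht, w, hw, htP, hwP, ht0, htw⟩ :=
    exists_minimalPrimes_uniformizer B.toSubring hB (hRB p.2) hp0 hpA
  have hPp := hP.1.1
  have hpP : (p : A) ∈ P := hP.1.2 (Ideal.mem_span_singleton_self _)
  have hrP : (r : A) ∈ P := by
    rw [← hbs]
    exact P.mul_mem_left b (P.mem_of_dvd (map_dvd R.val hps) hpP)
  let R' := R.map (Ideal.Quotient.mkₐ k P)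
  have : Algebra.FiniteType k R := R.fg_iff_finiteType.1 hR
  have halg : ∀ b ∈ B, IsAlgebraic R' (Ideal.Quotient.mk P b) := fun b hb =>
    isAlgebraic_of_forall_algHom_eq (hR.map _) fun u v huv =>
      hsep (u.comp (Ideal.Quotient.mkₐ k P)) (v.comp (Ideal.Quotient.mkₐ k P))
        (fun r hr => huv _ ⟨r, hr, rfl⟩) b hb
  have h₁ := trdeg_quotient_le_trdeg hRB ht hw htP hwP ht0 htw halg
  have h₂ := trdeg_le_trdeg_quotient_add_one (k := k) hP
  let ρ : R →ₐ[k] R' := ((Ideal.Quotient.mkₐ k P).comp R.val).codRestrict R'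
    fun c => ⟨c, c.2, rfl⟩
  have hρ : ∀ c : R, (c : A) ∈ P → ρ c = 0 := fun c hc =>
    Subtype.ext (Ideal.Quotient.eq_zero_iff_mem.2 hc)
  have hρs : Function.Surjective ρ := by
    rintro ⟨_, c, hc, rfl⟩
    exact ⟨⟨c, hc⟩, rfl⟩
  have : (Ideal.span {p}).IsPrime := (Ideal.span_singleton_prime hp.ne_zero).2 hp
  have hker : ∀ c ∈ Ideal.span {p}, ρ c = 0 := fun c hc =>
    hρ c (P.mem_of_dvd (map_dvd R.val (Ideal.mem_span_singleton.1 hc)) hpP)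
  have h₃ := trdeg_add_one_le_of_surjective_of_not_injective
    (Ideal.Quotient.mkₐ k (Ideal.span {p})) Ideal.Quotient.mk_surjective hp.ne_zero
    (Ideal.Quotient.eq_zero_iff_mem.2 (Ideal.mem_span_singleton_self p))
    trdeg_lt_aleph0_of_finiteType
  have h₄ := trdeg_add_one_le_of_surjective_of_not_injective
    (Ideal.Quotient.liftₐ (Ideal.span {p}) ρ hker)
    (Ideal.Quotient.lift_surjective_of_surjective _ hker hρs) (a := Ideal.Quotient.mk _ r)
    (by rwa [Ne, Ideal.Quotient.eq_zero_iff_mem, Ideal.mem_span_singleton]) (hρ r hrP)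
    trdeg_lt_aleph0_of_finiteType
  have h₅ := trdeg_add_eq k R (A := A)
  have : FaithfulSMul k R' :=
    (faithfulSMul_iff_algebraMap_injective k R').2 (algebraMap k R').injective
  have h₆ := trdeg_add_eq k R' (A := A ⧸ P)
  have hlt : Algebra.trdeg k A < Cardinal.aleph0 := trdeg_lt_aleph0_of_finiteType
  have hR' : Algebra.trdeg k R' + (1 + 1) ≤ Algebra.trdeg k R := by
    rw [← add_assoc]
    grw [h₄, h₃]
  have hle : Algebra.trdeg k R' + (1 + 1) + Algebra.trdeg R A ≤
      Algebra.trdeg k R' + Algebra.trdeg R A + 1 := by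
    grw [hR', h₅, h₂, ← h₆, h₁]
  have hlt' : Algebra.trdeg k R' < Cardinal.aleph0 :=
    (le_self_add.trans hR').trans_lt trdeg_lt_aleph0_of_finiteType
  rw [← h₅] at hlt
  obtain ⟨m, hm⟩ := Cardinal.lt_aleph0.1 hlt'
  obtain ⟨n, hn⟩ := Cardinal.lt_aleph0.1 (le_add_self.trans_lt hlt)
  rw [hm, hn] at hle
  have : m + (1 + 1) + n ≤ m + n + 1 := by exact_mod_cast hle
  lia

theorem exists_dvd_pow_of_forall_prime_dvd {R : Type*} [CommRing R] [IsDomain R]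
    [UniqueFactorizationMonoid R] {s f : R} (hs : s ≠ 0)
    (h : ∀ p : R, Prime p → p ∣ s → p ∣ f) : ∃ n : ℕ, s ∣ f ^ n := by
  induction s using UniqueFactorizationMonoid.induction_on_prime with
  | h₁ => exact absurd rfl hs
  | h₂ s hu => exact ⟨0, hu.dvd⟩
  | h₃ s p hs0 hp ih =>
    obtain ⟨n, hn⟩ := ih hs0 fun q hq hqs => h q hq (hqs.mul_left p)
    exact ⟨n + 1, by rw [pow_succ']; exact mul_dvd_mul (h p hp (dvd_mul_right p s)) hn⟩

theorem exists_isUnit_forall_prime_dvd {k A : Type*} [Field k] [IsAlgClosed k] [CommRing A]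
    [IsDomain A] [Algebra k A] [Algebra.FiniteType k A] {R : Subalgebra k A} (hR : R.FG)
    [UniqueFactorizationMonoid R] :
    ∃ f : R, IsUnit (f : A) ∧ ∀ p : R, Prime p → IsUnit (p : A) → p ∣ f := by
  classical
  have : Algebra.FiniteType k R := R.fg_iff_finiteType.1 hR
  obtain ⟨h, hh, hlift⟩ := exists_ne_zero_forall_exists_lift R.val Subtype.val_injective
  have hdvd : ∀ p : R, Prime p → IsUnit (p : A) → p ∣ h := by
    intro p hp hpA
    by_contra hph
    have : (Ideal.span {p}).IsPrime := (Ideal.span_singleton_prime hp.ne_zero).2 hp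
    obtain ⟨u, hu⟩ := exists_algHom_apply_ne_zero k (A := R ⧸ Ideal.span {p})
      (h := Ideal.Quotient.mk _ h)
      (by rwa [Ne, Ideal.Quotient.eq_zero_iff_mem, Ideal.mem_span_singleton])
    obtain ⟨v, hv⟩ := hlift (u.comp (Ideal.Quotient.mkₐ k _)) hu
    refine (hpA.map v).ne_zero ((DFunLike.congr_fun hv p).trans ?_)
    simp [Ideal.Quotient.eq_zero_iff_mem.2 (Ideal.mem_span_singleton_self p)]
  let S := (UniqueFactorizationMonoid.factors h).filter fun q : R => IsUnit (q : A)
  refine ⟨S.prod, ?_, fun p hp hpA => ?_⟩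
  · change IsUnit (R.val S.prod)
    rw [map_multiset_prod]
    refine Multiset.prod_induction IsUnit _ (fun _ _ => IsUnit.mul) isUnit_one ?_
    simp [S]
  · obtain ⟨q, hq, hpq⟩ := UniqueFactorizationMonoid.exists_mem_factors_of_dvd hh hp.irreducible
      (hdvd p hp hpA)
    refine hpq.dvd.trans (Multiset.dvd_prod (Multiset.mem_filter.2 ⟨hq, ?_⟩))
    exact (hpq.map R.val).isUnit hpA

theorem mem_fixedSubalgebra_of_mul_mem {G k A : Type*} [CommRing k] [CommRing A] [IsDomain A]
    [Algebra k A] [Monoid G] [MulSemiringAction G A] [SMulCommClass G k A] (a b : A)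
    (hb : b ∈ fixedSubalgebra G k A) (hb0 : b ≠ 0) (hab : a * b ∈ fixedSubalgebra G k A) :
    a ∈ fixedSubalgebra G k A := fun g =>
  mul_right_cancel₀ hb0 (by rw [← hab g, smul_mul', hb g])

/-- Over an algebraically closed field `k` of characteristic zero, if `B = A^G` for a
normal affine domain `A`, and `R ⊆ B` is a finitely generated separating subalgebra which
is a UFD and has the same fraction field as `B` (every `b ∈ B` is a ratio of elements of
`R`), then `B` is a finitely generated `k`-algebra; more precisely there is a nonzero
`f ∈ R` with `B = R_f` inside the common fraction field (i.e. every `b ∈ B` is of the form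
`r/fⁿ` with `r ∈ R`, and conversely every `r/fⁿ` lies in `B`). -/
theorem stmt_11 (k A G : Type*) [Field k] [IsAlgClosed k] [CharZero k]
    [CommRing A] [IsDomain A] [IsIntegrallyClosed A] [Algebra k A]
    [Algebra.FiniteType k A] [Group G] [MulSemiringAction G A] [SMulCommClass G k A]
    (R : Subalgebra k A) (hle : R ≤ fixedSubalgebra G k A) (hfg : R.FG)
    (hufd : UniqueFactorizationMonoid ↥R)
    (hsep : ∀ u v : A →ₐ[k] k, (∀ r ∈ R, u r = v r) →
      ∀ b ∈ fixedSubalgebra G k A, u b = v b)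
    (hfrac : ∀ b ∈ fixedSubalgebra G k A,
      ∃ r s : A, r ∈ R ∧ s ∈ R ∧ s ≠ 0 ∧ b * s = r) :
    Algebra.FiniteType k ↥(fixedSubalgebra G k A) ∧
    ∃ f : A, f ∈ R ∧ f ≠ 0 ∧
      (∀ b ∈ fixedSubalgebra G k A, ∃ r ∈ R, ∃ n : ℕ, b * f ^ n = r) ∧
      (∀ r ∈ R, ∀ n : ℕ, ∃ b ∈ fixedSubalgebra G k A, b * f ^ n = r) := by

  have := hufd
  obtain ⟨f, hfA, hf⟩ := exists_isUnit_forall_prime_dvd hfg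
  have hf0 : (f : A) ≠ 0 := hfA.ne_zero
  obtain ⟨i, hi⟩ := hfA.exists_left_inv
  have hiB : i ∈ fixedSubalgebra G k A :=
    mem_fixedSubalgebra_of_mul_mem i f (hle f.2) hf0 (hi ▸ one_mem _)
  have hpow : ∀ n : ℕ, i ^ n * (f : A) ^ n = 1 := fun n => by rw [← mul_pow, hi, one_pow]
  have hloc : ∀ b ∈ fixedSubalgebra G k A, ∃ r ∈ R, ∃ n : ℕ, b * (f : A) ^ n = r := by
    intro b hb
    obtain ⟨r₀, s₀, hr₀, hs₀, hs₀0, hbs₀⟩ := hfrac b hb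
    obtain ⟨s, r, c, hrel, hsc, hrc⟩ := UniqueFactorizationMonoid.exists_reduced_factors
      (⟨s₀, hs₀⟩ : R) (fun h => hs₀0 (congrArg Subtype.val h)) ⟨r₀, hr₀⟩
    have hcs : (c : A) * s = s₀ := congrArg Subtype.val hsc
    have hcr : (c : A) * r = r₀ := congrArg Subtype.val hrc
    have hc0 : (c : A) ≠ 0 := left_ne_zero_of_mul (hcs ▸ hs₀0)
    have hs0 : (s : A) ≠ 0 := right_ne_zero_of_mul (hcs ▸ hs₀0)
    have hbs : b * s = r := mul_left_cancel₀ hc0 (by rw [mul_left_comm, hcs, hbs₀, hcr])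
    obtain ⟨n, d, hd⟩ := exists_dvd_pow_of_forall_prime_dvd (s := s) (f := f) (by simpa using hs0)
      fun p hp hps => hf p hp <| by
        by_contra hpA
        exact hp.not_isUnit (hrel hps (dvd_of_mul_eq_of_separating hle hfg hsep
          mem_fixedSubalgebra_of_mul_mem hp hpA hbs hps))
    have hd' : (f : A) ^ n = s * d := congrArg Subtype.val hd
    exact ⟨r * d, mul_mem r.2 d.2, n, by rw [hd', ← mul_assoc, hbs]⟩
  refine ⟨?_, f, f.2, hf0, hloc, fun r hr n => ⟨r * i ^ n, mul_mem (hle hr) (pow_mem hiB n), ?_⟩⟩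
  · rw [← Subalgebra.fg_iff_finiteType]
    have heq : fixedSubalgebra G k A = R ⊔ Algebra.adjoin k {i} := by
      refine le_antisymm (fun b hb => ?_) (sup_le hle (Algebra.adjoin_le (by simpa using hiB)))
      obtain ⟨r, hr, n, hbr⟩ := hloc b hb
      have hb' : b = r * i ^ n := by rw [← hbr, mul_assoc, mul_comm (_ ^ n), hpow, mul_one]
      rw [hb']
      exact mul_mem ((le_sup_left : R ≤ _) hr)
        (pow_mem ((le_sup_right : _ ≤ R ⊔ _) (Algebra.self_mem_adjoin_singleton k i)) n)
    rw [heq]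
    exact hfg.sup ⟨{i}, by simp⟩
  · rw [mul_assoc, hpow, mul_one]
end

section
/- Let k be a field of characteristic 0, R = k[x₁, x₂, x₃, y₁, y₂, y₃, z], and D the k-derivation of R given by D = x₁³·∂/∂y₁ + x₂³·∂/∂y₂ + x₃³·∂/∂y₃ + (x₁x₂x₃)²·∂/∂z. Then for every permutation (i, j, k) of (1, 2, 3) and every integer n ≥ 2 there exists a polynomial P ∈ R with D(P) = 0 of the form P = x_i·z^n − n·x_j²x_k²·y_i·z^{n−1} + C(n,2)·(x_i²x_j⁴x_k·y_i y_k + x_i²x_j x_k⁴·y_i y_j − x_i⁵x_j x_k·y_j y_k)·z^{n−2} + Q, where Q ∈ R has degree at most n − 3 in the variable z and C(n,2) = n(n−1)/2. -/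
open MvPolynomial

/-- Roberts' derivation `D = x₁³ ∂/∂y₁ + x₂³ ∂/∂y₂ + x₃³ ∂/∂y₃ + (x₁x₂x₃)² ∂/∂z` on
`k[x₁,x₂,x₃,y₁,y₂,y₃,z]`, with variables indexed `0,…,6` as `x₁,x₂,x₃,y₁,y₂,y₃,z`. -/
noncomputable def robertsD (k : Type*) [CommRing k] :
    Derivation k (MvPolynomial (Fin 7) k) (MvPolynomial (Fin 7) k) :=
  MvPolynomial.mkDerivation k
    ![0, 0, 0, X 0 ^ 3, X 1 ^ 3, X 2 ^ 3, (X 0 * X 1 * X 2) ^ 2]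

/-- The index of the variable `xᵢ`. -/
def xv (i : Fin 3) : Fin 7 := ⟨(i : ℕ), by omega⟩

/-- The index of the variable `yᵢ`. -/
def yv (i : Fin 3) : Fin 7 := ⟨(i : ℕ) + 3, by omega⟩

noncomputable section SlTwo

/-- If `[E, F] = H` and `[H, E] = 2 E`, and `v` has `H`-weight `l`, then this is the standard formula
for `Eˢ⁺¹ F v`. -/
theorem pow_succ_apply_of_commutator {k V : Type*} [Field k] [AddCommGroup V] [Module k V]
    {E F H : Module.End k V} (hEF : ∀ v, E (F v) = F (E v) + H v)
    (hHE : ∀ v, H (E v) = E (H v) + (2 : k) • E v) {l : k} {v : V} (hv : H v = l • v) (s : ℕ) :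
    (E ^ (s + 1)) (F v) =
      F ((E ^ (s + 1)) v) + (((s : k) + 1) * (l + s)) • (E ^ s) v := by
  have hH : ∀ t : ℕ, H ((E ^ t) v) = (l + 2 * t) • (E ^ t) v := by
    intro t
    induction t with
    | zero => simp [hv]
    | succ t ih =>
      rw [pow_succ', Module.End.mul_apply, hHE, ih, map_smul]
      push_cast
      module
  induction s with
  | zero => simp [hEF, hv]
  | succ s ih =>
    rw [pow_succ', Module.End.mul_apply, ih, map_add, map_smul, hEF, hH,
      ← Module.End.mul_apply E (E ^ (s + 1)), ← pow_succ', ← Module.End.mul_apply E (E ^ s),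
      ← pow_succ']
    push_cast
    module

/-- Over a field of characteristic zero, a nilpotent lowering operator is onto the weight spaces
of positive weight. -/
theorem exists_eq_of_pos_weight {k V : Type*} [Field k] [CharZero k] [AddCommGroup V] [Module k V]
    {E F H : Module.End k V} (hEF : ∀ v, E (F v) = F (E v) + H v)
    (hHE : ∀ v, H (E v) = E (H v) + (2 : k) • E v) {N N' : Submodule k V}
    (hE : ∀ v ∈ N', E v ∈ N) (hF : ∀ v ∈ N, F v ∈ N') {l : ℕ} (hl : 0 < l)
    (hH : ∀ v ∈ N, H v = (l : k) • v) (s : ℕ) :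
    ∀ v ∈ N, (E ^ s) v = 0 → ∃ u ∈ N', E u = v := by
  induction s with
  | zero => exact fun v _ h ↦ ⟨0, N'.zero_mem, by simpa using h.symm⟩
  | succ s ih =>
    intro v hv h
    set c : k := ((s : k) + 1) * (l + s) with hc
    have hc0 : c ≠ 0 := by
      have : ((s + 1) * (l + s) : ℕ) ≠ 0 := by positivity
      rw [hc]
      exact_mod_cast this
    obtain ⟨u, hu, huv⟩ := ih (v - c⁻¹ • E (F v))
      (N.sub_mem hv (N.smul_mem _ (hE _ (hF _ hv)))) (by
        rw [map_sub, map_smul, ← Module.End.mul_apply (E ^ s) E, ← pow_succ,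
          pow_succ_apply_of_commutator hEF hHE (hH v hv), h, map_zero, zero_add, ← hc,
          inv_smul_smul₀ hc0, sub_self])
    exact ⟨u + c⁻¹ • F v, N'.add_mem hu (N'.smul_mem _ (hF _ hv)), by
      rw [map_add, map_smul, huv, sub_add_cancel]⟩

end SlTwo

noncomputable section Truncated

/-- The span of the monomials of degree `d` whose degree in each variable `yⱼ` is at most `mⱼ`. -/
def truncated {ι : Type*} (k : Type*) [Field k] (m : ι → ℕ) (d : ℕ) :
    Submodule k (MvPolynomial ι k) :=
  restrictSupport k {s | s.degree = d ∧ ∀ j, s j ≤ m j}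

theorem truncated_mono {ι k : Type*} [Field k] {m m' : ι → ℕ} (h : m ≤ m') {d : ℕ}
    {p : MvPolynomial ι k} (hp : p ∈ truncated k m d) : p ∈ truncated k m' d :=
  restrictSupport_mono (R := k)
    (s := {s | s.degree = d ∧ ∀ j, s j ≤ m j}) (t := {s | s.degree = d ∧ ∀ j, s j ≤ m' j})
    (fun _ hs ↦ ⟨hs.1, fun j ↦ (hs.2 j).trans (h j)⟩) hp

theorem map_mem_of_mem_restrictSupport {ι k : Type*} [Field k] {S : Set (ι →₀ ℕ)}
    {N : Submodule k (MvPolynomial ι k)}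
    (f : Module.End k (MvPolynomial ι k)) (h : ∀ s ∈ S, f (monomial s 1) ∈ N)
    {p : MvPolynomial ι k} (hp : p ∈ restrictSupport k S) : f p ∈ N := by
  rw [restrictSupport_eq_span] at hp
  have : Submodule.span k (Set.image (monomial · (1 : k)) S) ≤ N.comap f := by
    rw [Submodule.span_le]
    rintro _ ⟨s, hs, rfl⟩
    exact h s hs
  exact this hp

variable {ι : Type*} [Fintype ι] (k : Type*) [Field k]

/-- The derivation `∑ⱼ ∂/∂yⱼ`. -/
def sumPDeriv : Derivation k (MvPolynomial ι k) (MvPolynomial ι k) := ∑ j, pderiv j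

/-- The Euler derivation `∑ⱼ yⱼ ∂/∂yⱼ`. -/
def eulerDeriv : Derivation k (MvPolynomial ι k) (MvPolynomial ι k) :=
  ∑ j, (X j : MvPolynomial ι k) • pderiv j

/-- The derivation `∑ⱼ yⱼ² ∂/∂yⱼ`. -/
def sqDeriv : Derivation k (MvPolynomial ι k) (MvPolynomial ι k) :=
  ∑ j, (X j : MvPolynomial ι k) • (X j : MvPolynomial ι k) • pderiv j

theorem sumPDeriv_apply (p : MvPolynomial ι k) : sumPDeriv k p = ∑ j, pderiv j p := by
  have h := congrFun (map_sum (Derivation.coeFnAddMonoidHom (R := k) (A := MvPolynomial ι k)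
    (M := MvPolynomial ι k)) (fun j ↦ pderiv j) Finset.univ) p
  rwa [Finset.sum_apply] at h

theorem eulerDeriv_apply (p : MvPolynomial ι k) : eulerDeriv k p = ∑ j, X j * pderiv j p := by
  have h := congrFun (map_sum (Derivation.coeFnAddMonoidHom (R := k) (A := MvPolynomial ι k)
    (M := MvPolynomial ι k)) (fun j ↦ (X j : MvPolynomial ι k) • pderiv j) Finset.univ) p
  rwa [Finset.sum_apply] at h

theorem sqDeriv_apply (p : MvPolynomial ι k) :
    sqDeriv k p = ∑ j, X j * (X j * pderiv j p) := by
  have h := congrFun (map_sum (Derivation.coeFnAddMonoidHom (R := k) (A := MvPolynomial ι k)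
    (M := MvPolynomial ι k))
    (fun j ↦ (X j : MvPolynomial ι k) • (X j : MvPolynomial ι k) • pderiv j) Finset.univ) p
  rwa [Finset.sum_apply] at h

theorem sumPDeriv_X (i : ι) : sumPDeriv k (X i) = 1 := by
  classical
  simp [sumPDeriv_apply, pderiv_X, Pi.single_apply]

theorem eulerDeriv_X (i : ι) : eulerDeriv k (X i) = X i := by
  classical
  simp [eulerDeriv_apply, pderiv_X, Pi.single_apply]

theorem sqDeriv_X (i : ι) : sqDeriv k (X i) = X i * X i := by
  classical
  simp [sqDeriv_apply, pderiv_X, Pi.single_apply]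

theorem eulerDeriv_sumPDeriv (p : MvPolynomial ι k) :
    eulerDeriv k (sumPDeriv k p) = sumPDeriv k (eulerDeriv k p) - sumPDeriv k p := by
  have h : ⁅eulerDeriv k, sumPDeriv k⁆ = -sumPDeriv (ι := ι) k :=
    derivation_ext fun i ↦ by
      rw [Derivation.commutator_apply, sumPDeriv_X, eulerDeriv_X, Derivation.neg_apply, sumPDeriv_X,
        Derivation.map_one_eq_zero, zero_sub]
  have := DFunLike.congr_fun h p
  rw [Derivation.commutator_apply] at this
  simp only [Derivation.neg_apply] at this
  linear_combination this

theorem sumPDeriv_sqDeriv (p : MvPolynomial ι k) :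
    sumPDeriv k (sqDeriv k p) = sqDeriv k (sumPDeriv k p) + 2 * eulerDeriv k p := by
  have h : ⁅sumPDeriv k, sqDeriv k⁆ = (2 : MvPolynomial ι k) • eulerDeriv (ι := ι) k :=
    derivation_ext fun i ↦ by
      rw [Derivation.commutator_apply, sqDeriv_X, sumPDeriv_X, Derivation.smul_apply, eulerDeriv_X,
        Derivation.map_one_eq_zero, Derivation.leibniz, sumPDeriv_X, smul_eq_mul, smul_eq_mul]
      ring
  have := DFunLike.congr_fun h p
  rw [Derivation.commutator_apply] at this
  simp only [Derivation.smul_apply, smul_eq_mul] at this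
  linear_combination this

/-- The raising operator `p ↦ (∑ⱼ mⱼ yⱼ) p - ∑ⱼ yⱼ² ∂p/∂yⱼ`. -/
def raising (m : ι → ℕ) : Module.End k (MvPolynomial ι k) :=
  LinearMap.mulLeft k (∑ j, (m j : MvPolynomial ι k) * X j) - (sqDeriv k).toLinearMap

/-- The weight operator `p ↦ (∑ⱼ mⱼ) p - 2 ∑ⱼ yⱼ ∂p/∂yⱼ`. -/
def weight (m : ι → ℕ) : Module.End k (MvPolynomial ι k) :=
  LinearMap.mulLeft k (∑ j, (m j : MvPolynomial ι k)) - (2 : k) • (eulerDeriv k).toLinearMap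

theorem raising_apply (m : ι → ℕ) (p : MvPolynomial ι k) :
    raising k m p = (∑ j, (m j : MvPolynomial ι k) * X j) * p - sqDeriv k p := rfl

theorem weight_apply (m : ι → ℕ) (p : MvPolynomial ι k) :
    weight k m p = (∑ j, (m j : MvPolynomial ι k)) * p - (2 : k) • eulerDeriv k p := rfl

theorem sumPDeriv_raising (m : ι → ℕ) (p : MvPolynomial ι k) :
    sumPDeriv k (raising k m p) = raising k m (sumPDeriv k p) + weight k m p := by
  have h : sumPDeriv k (∑ j, (m j : MvPolynomial ι k) * X j) =
      ∑ j, (m j : MvPolynomial ι k) := by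
    simp [map_sum, sumPDeriv_X]
  simp only [raising_apply, weight_apply, map_sub, Derivation.leibniz, h, sumPDeriv_sqDeriv,
    smul_eq_mul, two_smul]
  ring

theorem weight_sumPDeriv (m : ι → ℕ) (p : MvPolynomial ι k) :
    weight k m (sumPDeriv k p) = sumPDeriv k (weight k m p) + (2 : k) • sumPDeriv k p := by
  have h : sumPDeriv k (∑ j, (m j : MvPolynomial ι k)) = 0 := by
    simp [map_sum]
  simp only [weight_apply, map_sub, Derivation.leibniz, h, eulerDeriv_sumPDeriv,
    smul_eq_mul, two_smul, map_add]
  ring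

variable {k}

theorem sumPDeriv_mem_truncated {m : ι → ℕ} {d : ℕ} {p : MvPolynomial ι k}
    (hp : p ∈ truncated k m (d + 1)) : sumPDeriv k p ∈ truncated k m d := by
  refine map_mem_of_mem_restrictSupport (sumPDeriv k).toLinearMap (fun s hs ↦ ?_) hp
  change sumPDeriv k _ ∈ _
  rw [sumPDeriv_apply]
  refine Submodule.sum_mem _ fun j _ ↦ ?_
  rw [pderiv_monomial]
  refine (monomial_mem_restrictSupport k).2 ?_
  rcases Nat.eq_zero_or_pos (s j) with h | h
  · simp [h]
  · refine Or.inl ⟨?_, fun i ↦ (Nat.sub_le _ _).trans (hs.2 i)⟩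
    have h1 : s - Finsupp.single j 1 + Finsupp.single j 1 = s :=
      Finsupp.sub_add_single_one_cancel h.ne'
    have h2 := congrArg Finsupp.degree h1
    rw [map_add, Finsupp.degree_single, hs.1] at h2
    omega

theorem raising_mem_truncated {m : ι → ℕ} {d : ℕ} {p : MvPolynomial ι k}
    (hp : p ∈ truncated k m d) : raising k m p ∈ truncated k m (d + 1) := by
  classical
  refine map_mem_of_mem_restrictSupport (raising k m) (fun s hs ↦ ?_) hp
  rw [raising_apply, sqDeriv_apply, Finset.sum_mul, ← Finset.sum_sub_distrib]
  refine Submodule.sum_mem _ fun j _ ↦ ?_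
  have h : (m j : MvPolynomial ι k) * X j * monomial s 1 - X j * (X j * pderiv j (monomial s 1)) =
      monomial (s + Finsupp.single j 1) ((m j : k) - s j) := by
    have h1 : monomial (s + Finsupp.single j 1) ((m j : k) - s j) =
        C ((m j : k) - s j) * (X j * monomial s 1) := by
      rw [X, monomial_mul, C_mul_monomial, mul_one, mul_one, add_comm]
    rw [X_mul_pderiv_monomial, h1, nsmul_eq_mul]
    simp only [C_sub, map_natCast]
    ring
  rw [h]
  refine (monomial_mem_restrictSupport k).2 ?_
  rcases (hs.2 j).eq_or_lt with h | h
  · simp [h]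
  · refine Or.inl ⟨by simp [hs.1], fun i ↦ ?_⟩
    by_cases hij : i = j
    · subst hij
      simpa using h
    · simpa [Finsupp.single_apply, Ne.symm hij] using hs.2 i

theorem eulerDeriv_of_mem_truncated {m : ι → ℕ} {d : ℕ} {p : MvPolynomial ι k}
    (hp : p ∈ truncated k m d) : eulerDeriv k p = (d : k) • p := by
  suffices h : (eulerDeriv k).toLinearMap p - (d : k) • p ∈ (⊥ : Submodule k (MvPolynomial ι k)) by
    exact sub_eq_zero.1 h
  refine map_mem_of_mem_restrictSupport ((eulerDeriv k).toLinearMap - (d : k) • LinearMap.id)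
    (fun s hs ↦ ?_) hp
  change eulerDeriv k _ - (d : k) • _ = 0
  rw [eulerDeriv_apply, sub_eq_zero]
  simp only [X_mul_pderiv_monomial]
  rw [← Finset.sum_smul, ← Finsupp.degree_eq_sum, hs.1, Nat.cast_smul_eq_nsmul]
  rfl

theorem weight_of_mem_truncated {m : ι → ℕ} {d : ℕ} {p : MvPolynomial ι k}
    (hp : p ∈ truncated k m d) (hd : 2 * d ≤ ∑ j, m j) :
    weight k m p = ((∑ j, m j - 2 * d : ℕ) : k) • p := by
  rw [weight_apply, eulerDeriv_of_mem_truncated hp, Nat.cast_sub hd, sub_smul, smul_smul,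
    smul_eq_C_mul p (((∑ j, m j : ℕ) : k))]
  simp

theorem sumPDeriv_pow_eq_zero {m : ι → ℕ} {d : ℕ} {p : MvPolynomial ι k}
    (hp : p ∈ truncated k m d) :
    (((sumPDeriv k).toLinearMap : Module.End k (MvPolynomial ι k)) ^ (d + 1)) p = 0 := by
  induction d generalizing p with
  | zero =>
    suffices h : (sumPDeriv k).toLinearMap p ∈ (⊥ : Submodule k (MvPolynomial ι k)) by
      simpa using h
    refine map_mem_of_mem_restrictSupport _ (fun s hs ↦ ?_) hp
    have : s = 0 := (Finsupp.degree_eq_zero_iff s).1 hs.1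
    change sumPDeriv k _ = 0
    simp [this]
  | succ d ih =>
    rw [pow_succ, Module.End.mul_apply]
    exact ih (sumPDeriv_mem_truncated hp)

theorem exists_sumPDeriv_eq [CharZero k] {m : ι → ℕ} {d : ℕ} (hd : 2 * d < ∑ j, m j)
    {p : MvPolynomial ι k} (hp : p ∈ truncated k m d) :
    ∃ q ∈ truncated k m (d + 1), sumPDeriv k q = p :=
  exists_eq_of_pos_weight (E := (sumPDeriv k).toLinearMap) (sumPDeriv_raising k m)
    (weight_sumPDeriv k m) (fun _ ↦ sumPDeriv_mem_truncated) (fun _ ↦ raising_mem_truncated)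
    (Nat.sub_pos_of_lt hd) (fun _ hv ↦ weight_of_mem_truncated hv hd.le) (d + 1) p hp
    (sumPDeriv_pow_eq_zero hp)

end Truncated

noncomputable section Cable

variable (k : Type*) [Field k]

/-- Bounds for the degrees in the variables `y` of the `i`-th term of the sequence. -/
def cableBound (i : ℕ) : Fin 3 → ℕ := ![(2 * i + 1) / 3, 2 * i / 3, 2 * i / 3]

theorem X_mul_X_mem_truncated {a b : Fin 3} (hab : a ≠ b) :
    (X a * X b : MvPolynomial (Fin 3) k) ∈ truncated k (cableBound 2) 2 := by
  rw [X, X, monomial_mul]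
  refine (monomial_mem_restrictSupport k).2 (Or.inl ⟨by simp, fun j ↦ ?_⟩)
  fin_cases j <;> revert a b <;> simp [cableBound, Finsupp.single_apply] <;> decide

/-- There is a sequence of truncated polynomials with `(∑ⱼ ∂/∂yⱼ) cᵢ₊₁ = cᵢ`. -/
theorem exists_sumPDeriv_cable [CharZero k] :
    ∃ c : ℕ → MvPolynomial (Fin 3) k, c 0 = 1 ∧ c 1 = X 0 ∧
      c 2 = C (1 / 2) * (X 0 * X 2 + X 0 * X 1 - X 1 * X 2) ∧
      (∀ i, sumPDeriv k (c (i + 1)) = c i) ∧ ∀ i, c i ∈ truncated k (cableBound i) i := by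
  have step : ∀ (i : ℕ) (p : MvPolynomial (Fin 3) k), ∃ q, p ∈ truncated k (cableBound i) i →
      q ∈ truncated k (cableBound (i + 1)) (i + 1) ∧ sumPDeriv k q = p := by
    intro i p
    by_cases hp : p ∈ truncated k (cableBound i) i
    · have hle : ∀ j, cableBound i j ≤ cableBound (i + 1) j := by
        intro j
        fin_cases j <;> simp [cableBound] <;> omega
      obtain ⟨q, hq, h⟩ := exists_sumPDeriv_eq (m := cableBound (i + 1)) (d := i)
        (by simp [Fin.sum_univ_three, cableBound]; omega)
        (truncated_mono hle hp)
      exact ⟨q, fun _ ↦ ⟨hq, h⟩⟩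
    · exact ⟨0, fun h ↦ absurd h hp⟩
  choose g hg using step
  set c₂ : MvPolynomial (Fin 3) k := C (1 / 2) * (X 0 * X 2 + X 0 * X 1 - X 1 * X 2) with hc₂
  have hc₂mem : c₂ ∈ truncated k (cableBound 2) 2 := by
    rw [hc₂, C_mul']
    exact Submodule.smul_mem _ _ (Submodule.sub_mem _ (Submodule.add_mem _
      (X_mul_X_mem_truncated k (by decide)) (X_mul_X_mem_truncated k (by decide)))
      (X_mul_X_mem_truncated k (by decide)))
  let t : ℕ → MvPolynomial (Fin 3) k := fun i ↦ Nat.rec c₂ (fun i p ↦ g (i + 2) p) i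
  have ht : ∀ i, t i ∈ truncated k (cableBound (i + 2)) (i + 2) := by
    intro i
    induction i with
    | zero => exact hc₂mem
    | succ i ih => exact (hg (i + 2) (t i) ih).1
  refine ⟨fun i ↦ match i with | 0 => 1 | 1 => X 0 | i + 2 => t i, rfl, rfl, rfl, ?_, ?_⟩
  · rintro (_ | _ | i)
    · exact sumPDeriv_X k 0
    · have h2 : (C (1 / 2) : MvPolynomial (Fin 3) k) * 2 = 1 := by
        rw [← map_ofNat C 2, ← C_mul]
        simp
      change sumPDeriv k c₂ = X 0
      rw [hc₂]
      simp only [map_add, map_sub, Derivation.leibniz, sumPDeriv_X, smul_eq_mul, derivation_C]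
      linear_combination X 0 * h2
    · exact (hg (i + 2) (t i) (ht i)).2
  · rintro (_ | _ | i)
    · refine (monomial_mem_restrictSupport k).2 (Or.inl ⟨by simp, by simp⟩)
    · refine (monomial_mem_restrictSupport k).2 (Or.inl ⟨by simp, fun j ↦ ?_⟩)
      fin_cases j <;> simp [cableBound]
    · exact ht i

end Cable

noncomputable section Rescale

variable (k : Type*) [Field k]

/-- The endomorphism `yⱼ ↦ xⱼ³ yⱼ`. -/
def rescale : MvPolynomial (Fin 7) k →ₐ[k] MvPolynomial (Fin 7) k :=
  aeval ![X 0, X 1, X 2, X 0 ^ 3 * X 3, X 1 ^ 3 * X 4, X 2 ^ 3 * X 5, X 6]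

/-- The map on exponent vectors underlying `rescale`. -/
def rescaleExp (s : Fin 7 →₀ ℕ) : Fin 7 →₀ ℕ :=
  Finsupp.equivFunOnFinite.symm
    ![s 0 + 3 * s 3, s 1 + 3 * s 4, s 2 + 3 * s 5, s 3, s 4, s 5, s 6]

theorem rescaleExp_injective : Function.Injective rescaleExp := by
  intro s t h
  have h' : ∀ j, rescaleExp s j = rescaleExp t j := fun j ↦ by rw [h]
  simp only [Fin.forall_fin_succ, rescaleExp, Finsupp.equivFunOnFinite_symm_apply_apply] at h'
  simp at h'
  ext j
  fin_cases j <;> simp <;> omega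

theorem rescale_monomial (s : Fin 7 →₀ ℕ) (a : k) :
    rescale k (monomial s a) = monomial (rescaleExp s) a := by
  rw [rescale, aeval_monomial, monomial_eq (s := rescaleExp s), Finsupp.prod_fintype _ _ (by simp),
    Finsupp.prod_fintype _ _ (by simp)]
  simp [Fin.prod_univ_succ, rescaleExp, algebraMap_eq]
  left
  ring

theorem rescale_injective : Function.Injective (rescale k) := by
  classical
  have h : ∀ (p : MvPolynomial (Fin 7) k) s, coeff (rescaleExp s) (rescale k p) = coeff s p := by
    intro p s
    induction p using MvPolynomial.induction_on' with
    | monomial u a =>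
      simp only [rescale_monomial, coeff_monomial, rescaleExp_injective.eq_iff]
    | add p q hp hq => rw [map_add, coeff_add, coeff_add, hp, hq]
  intro p q hpq
  ext s
  rw [← h p, ← h q, hpq]

theorem rescale_X_xv (j : Fin 3) : rescale k (X (xv j)) = X (xv j) := by
  fin_cases j <;> simp [rescale, xv]

theorem rescale_X_yv (j : Fin 3) : rescale k (X (yv j)) = X (xv j) ^ 3 * X (yv j) := by
  fin_cases j <;> simp [rescale, xv, yv]

theorem robertsD_X_xv (j : Fin 3) : robertsD k (X (xv j)) = 0 := by
  fin_cases j <;> simp [robertsD, xv, mkDerivation_X]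

theorem robertsD_X_yv (j : Fin 3) : robertsD k (X (yv j)) = X (xv j) ^ 3 := by
  fin_cases j <;> simp [robertsD, xv, yv, mkDerivation_X]

theorem robertsD_X_six : robertsD k (X 6) = (X 0 * X 1 * X 2) ^ 2 := by
  simp [robertsD, mkDerivation_X]

/-- The derivation to which `rescale` intertwines Roberts' derivation. -/
def rescaledD : Derivation k (MvPolynomial (Fin 7) k) (MvPolynomial (Fin 7) k) :=
  mkDerivation k ![0, 0, 0, 1, 1, 1, (X 0 * X 1 * X 2) ^ 2]

theorem rescaledD_X_xv (j : Fin 3) : rescaledD k (X (xv j)) = 0 := by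
  fin_cases j <;> simp [rescaledD, xv, mkDerivation_X]

theorem rescaledD_X_yv (j : Fin 3) : rescaledD k (X (yv j)) = 1 := by
  fin_cases j <;> simp [rescaledD, yv, mkDerivation_X]

theorem rescale_robertsD (p : MvPolynomial (Fin 7) k) :
    rescale k (robertsD k p) = rescaledD k (rescale k p) := by
  induction p using MvPolynomial.induction_on with
  | C a => simp [rescale]
  | add p q hp hq => simp only [map_add, hp, hq]
  | mul_X p i hp =>
    have h : rescale k (robertsD k (X i)) = rescaledD k (rescale k (X i)) := by
      fin_cases i <;>
        simp [robertsD, rescaledD, rescale, mkDerivation_X, Derivation.leibniz_pow]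
    simp only [map_mul, Derivation.leibniz, smul_eq_mul, map_add, hp, h]

theorem rescaledD_rename {v : Fin 3 → Fin 7} (hv : ∀ j, rescaledD k (X (v j)) = 1)
    (p : MvPolynomial (Fin 3) k) :
    rescaledD k (rename v p) = rename v (sumPDeriv k p) := by
  induction p using MvPolynomial.induction_on with
  | C a => simp
  | add p q hp hq => simp only [map_add, hp, hq]
  | mul_X p i hp =>
    simp only [map_mul, Derivation.leibniz, smul_eq_mul, map_add, hp, rename_X, hv, sumPDeriv_X,
      map_one]

/-- The polynomials `x₁ (x₁x₂x₃)²ⁱ c` with `c` in the `i`-th truncated space are rescalings of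
polynomials not involving `z`. -/
theorem exists_rescale_eq (σ : Equiv.Perm (Fin 3)) (i : ℕ) (c : MvPolynomial (Fin 3) k)
    (hc : c ∈ truncated k (cableBound i) i) :
    ∃ q : MvPolynomial (Fin 7) k, degreeOf 6 q = 0 ∧
      rescale k q = X (xv (σ 0)) * (X (xv (σ 0)) * X (xv (σ 1)) * X (xv (σ 2))) ^ (2 * i) *
        rename (fun j ↦ yv (σ j)) c := by
  have hmul : ∀ a b : MvPolynomial (Fin 7) k, degreeOf 6 a = 0 → degreeOf 6 b = 0 →
      degreeOf 6 (a * b) = 0 := fun a b ha hb ↦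
    Nat.le_zero.1 ((degreeOf_mul_le 6 a b).trans (by rw [ha, hb]))
  have hx : ∀ (j : Fin 3) (e : ℕ), degreeOf 6 (X (xv j) ^ e : MvPolynomial (Fin 7) k) = 0 :=
    fun j e ↦ degreeOf_X_pow_of_ne e (by revert j; decide)
  have hy : ∀ (j : Fin 3) (e : ℕ), degreeOf 6 (X (yv j) ^ e : MvPolynomial (Fin 7) k) = 0 :=
    fun j e ↦ degreeOf_X_pow_of_ne e (by revert j; decide)
  rw [truncated, restrictSupport_eq_span] at hc
  induction hc using Submodule.span_induction with
  | mem c hc =>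
    obtain ⟨s, ⟨-, hs⟩, rfl⟩ := hc
    have hs0 : s 0 ≤ (2 * i + 1) / 3 := hs 0
    have hs1 : s 1 ≤ 2 * i / 3 := hs 1
    have hs2 : s 2 ≤ 2 * i / 3 := hs 2
    obtain ⟨a0, h0⟩ := Nat.exists_eq_add_of_le (show 3 * s 0 ≤ 2 * i + 1 by omega)
    obtain ⟨a1, h1⟩ := Nat.exists_eq_add_of_le (show 3 * s 1 ≤ 2 * i by omega)
    obtain ⟨a2, h2⟩ := Nat.exists_eq_add_of_le (show 3 * s 2 ≤ 2 * i by omega)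
    refine ⟨X (xv (σ 0)) ^ a0 * X (xv (σ 1)) ^ a1 * X (xv (σ 2)) ^ a2 *
      (X (yv (σ 0)) ^ s 0 * X (yv (σ 1)) ^ s 1 * X (yv (σ 2)) ^ s 2), ?_, ?_⟩
    · exact hmul _ _ (hmul _ _ (hmul _ _ (hx _ _) (hx _ _)) (hx _ _))
        (hmul _ _ (hmul _ _ (hy _ _) (hy _ _)) (hy _ _))
    · have e0 : X (xv (σ 0)) * (X (xv (σ 0)) * X (xv (σ 1)) * X (xv (σ 2))) ^ (2 * i) =
          (X (xv (σ 0)) ^ (2 * i + 1) * X (xv (σ 1)) ^ (2 * i) * X (xv (σ 2)) ^ (2 * i) :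
            MvPolynomial (Fin 7) k) := by ring
      rw [e0]
      nth_rewrite 1 [h0]
      nth_rewrite 1 [h1]
      rw [h2]
      simp only [map_mul, map_pow, rescale_X_xv, rescale_X_yv]
      rw [monomial_eq, Finsupp.prod_fintype _ _ (by simp), Fin.prod_univ_three]
      simp only [map_mul, map_pow, rename_X, map_one]
      ring
  | zero => exact ⟨0, degreeOf_zero 6, by simp⟩
  | add c d _ _ hc hd =>
    obtain ⟨q, hq, hqc⟩ := hc
    obtain ⟨r, hr, hrd⟩ := hd
    exact ⟨q + r, Nat.le_zero.1 ((degreeOf_add_le 6 q r).trans (by rw [hq, hr]; rfl)), by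
      rw [map_add, map_add, hqc, hrd, mul_add]⟩
  | smul a c _ hc =>
    obtain ⟨q, hq, hqc⟩ := hc
    exact ⟨C a * q, Nat.le_zero.1 ((degreeOf_C_mul_le q 6 a).trans hq.le), by
      rw [← C_mul', map_mul, map_mul, hqc, rename_C, rescale, aeval_C, algebraMap_eq]
      ring⟩

theorem rescaledD_mul_of_eq_zero {a b : MvPolynomial (Fin 7) k} (ha : rescaledD k a = 0) :
    rescaledD k (a * b) = a * rescaledD k b := by
  simp [ha]

theorem prod_X_xv_perm (σ : Equiv.Perm (Fin 3)) :
    (X (xv (σ 0)) * X (xv (σ 1)) * X (xv (σ 2)) : MvPolynomial (Fin 7) k) = X 0 * X 1 * X 2 := by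
  have h := Equiv.prod_comp σ fun j ↦ (X (xv j) : MvPolynomial (Fin 7) k)
  rw [Fin.prod_univ_three, Fin.prod_univ_three] at h
  exact h

/-- There is a sequence of polynomials not involving `z`, starting with three prescribed ones, on
which Roberts' derivation acts by `qᵢ₊₁ ↦ (x₁x₂x₃)² qᵢ`. -/
theorem exists_robertsD_cable [CharZero k] (σ : Equiv.Perm (Fin 3)) :
    ∃ q : ℕ → MvPolynomial (Fin 7) k,
      q 0 = X (xv (σ 0)) ∧
      q 1 = X (xv (σ 1)) ^ 2 * X (xv (σ 2)) ^ 2 * X (yv (σ 0)) ∧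
      q 2 = C (1 / 2) *
        (X (xv (σ 0)) ^ 2 * X (xv (σ 1)) ^ 4 * X (xv (σ 2)) * X (yv (σ 0)) * X (yv (σ 2)) +
          X (xv (σ 0)) ^ 2 * X (xv (σ 1)) * X (xv (σ 2)) ^ 4 * X (yv (σ 0)) * X (yv (σ 1)) -
          X (xv (σ 0)) ^ 5 * X (xv (σ 1)) * X (xv (σ 2)) * X (yv (σ 1)) * X (yv (σ 2))) ∧
      (∀ i, robertsD k (q (i + 1)) = (X 0 * X 1 * X 2) ^ 2 * q i) ∧
      ∀ i, degreeOf 6 (q i) = 0 := by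
  obtain ⟨c, hc0, hc1, hc2, hcD, hc⟩ := exists_sumPDeriv_cable k
  choose q hq6 hq using fun i ↦ exists_rescale_eq k σ i (c i) (hc i)
  refine ⟨q, ?_, ?_, ?_, fun i ↦ ?_, hq6⟩
  · apply rescale_injective k
    rw [hq, hc0, rescale_X_xv]
    simp
  · apply rescale_injective k
    rw [hq, hc1]
    simp only [map_mul, map_pow, rescale_X_xv, rescale_X_yv, rename_X]
    ring
  · apply rescale_injective k
    have hC : rescale k (C (1 / 2)) = C (1 / 2) := by rw [rescale, aeval_C, algebraMap_eq]
    rw [hq, hc2]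
    simp only [map_mul, map_pow, map_add, map_sub, rescale_X_xv, rescale_X_yv, rename_X, rename_C,
      hC]
    ring
  · apply rescale_injective k
    have hw : rescaledD k (X (xv (σ 0)) *
        (X (xv (σ 0)) * X (xv (σ 1)) * X (xv (σ 2))) ^ (2 * (i + 1))) = 0 := by
      simp [Derivation.leibniz_pow, rescaledD_X_xv]
    rw [rescale_robertsD, hq, rescaledD_mul_of_eq_zero k hw,
      rescaledD_rename k (fun j ↦ rescaledD_X_yv k (σ j)), hcD, ← prod_X_xv_perm k σ, map_mul,
      hq, map_pow, map_mul, map_mul, rescale_X_xv, rescale_X_xv, rescale_X_xv]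
    ring

/-- A truncation of the alternating sum `∑ᵢ (-1)ⁱ n(n-1)⋯(n-i+1) qᵢ zⁿ⁻ⁱ` is mapped by Roberts'
derivation to a single term. -/
theorem robertsD_sum_range {q : ℕ → MvPolynomial (Fin 7) k} (h0 : robertsD k (q 0) = 0)
    (hq : ∀ i, robertsD k (q (i + 1)) = (X 0 * X 1 * X 2) ^ 2 * q i) (n N : ℕ) :
    robertsD k (∑ i ∈ Finset.range (N + 1),
        C ((-1) ^ i * (n.descFactorial i : k)) * (q i * X 6 ^ (n - i))) =
      C ((-1) ^ N * (n.descFactorial N : k)) * (((n - N : ℕ) : MvPolynomial (Fin 7) k) *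
        ((X 0 * X 1 * X 2) ^ 2 * q N * X 6 ^ (n - N - 1))) := by
  induction N with
  | zero =>
    simp [h0, Derivation.leibniz_pow, robertsD_X_six]
    ring
  | succ N ih =>
    rw [Finset.sum_range_succ, map_add, ih]
    simp only [Derivation.leibniz, derivation_C, hq, Derivation.leibniz_pow, robertsD_X_six,
      smul_eq_mul, nsmul_eq_mul, mul_zero, add_zero]
    simp only [Nat.descFactorial_succ, Nat.cast_mul, map_mul, map_pow, map_neg, map_one,
      map_natCast, Nat.sub_sub]
    ring

end Rescale

/-- For every permutation `(i,j,k)` of `(1,2,3)` and every `n ≥ 2` there is an invariant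
`P ∈ ker D` of the form
`P = xᵢ zⁿ - n xⱼ²xₖ² yᵢ z^{n-1}
   + C(n,2)(xᵢ²xⱼ⁴xₖ yᵢyₖ + xᵢ²xⱼxₖ⁴ yᵢyⱼ - xᵢ⁵xⱼxₖ yⱼyₖ) z^{n-2} + Q`
where `Q` has degree at most `n - 3` in `z`. -/
theorem stmt_15 (k : Type*) [Field k] [CharZero k]
    (σ : Equiv.Perm (Fin 3)) (n : ℕ) (hn : 2 ≤ n) :
    ∃ P Q : MvPolynomial (Fin 7) k,
      robertsD k P = 0 ∧
      P = X (xv (σ 0)) * X 6 ^ n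
          - (n : MvPolynomial (Fin 7) k) *
            (X (xv (σ 1)) ^ 2 * X (xv (σ 2)) ^ 2 * X (yv (σ 0)) * X 6 ^ (n - 1))
          + ((n.choose 2 : ℕ) : MvPolynomial (Fin 7) k) *
            ((X (xv (σ 0)) ^ 2 * X (xv (σ 1)) ^ 4 * X (xv (σ 2)) *
                X (yv (σ 0)) * X (yv (σ 2)) +
              X (xv (σ 0)) ^ 2 * X (xv (σ 1)) * X (xv (σ 2)) ^ 4 *
                X (yv (σ 0)) * X (yv (σ 1)) -
              X (xv (σ 0)) ^ 5 * X (xv (σ 1)) * X (xv (σ 2)) *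
                X (yv (σ 1)) * X (yv (σ 2))) * X 6 ^ (n - 2))
          + Q ∧
      (Q = 0 ∨ MvPolynomial.degreeOf 6 Q + 3 ≤ n) := by
  obtain ⟨q, hq0, hq1, hq2, hqD, hq6⟩ := exists_robertsD_cable k σ
  set f : ℕ → MvPolynomial (Fin 7) k :=
    fun i ↦ C ((-1) ^ i * (n.descFactorial i : k)) * (q i * X 6 ^ (n - i)) with hf
  refine ⟨∑ i ∈ Finset.range (n + 1), f i, ∑ i ∈ Finset.range (n - 2), f (3 + i), ?_, ?_, ?_⟩
  · rw [robertsD_sum_range k (by rw [hq0, robertsD_X_xv]) hqD]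
    simp
  · have h2 : C (n.descFactorial 2 : k) * C (1 / 2) =
        ((n.choose 2 : ℕ) : MvPolynomial (Fin 7) k) := by
      rw [← C_mul, Nat.descFactorial_eq_factorial_mul_choose, ← map_natCast C]
      congr 1
      push_cast [Nat.factorial]
      ring
    rw [show n + 1 = 3 + (n - 2) by omega, Finset.sum_range_add, ← h2]
    congr 1
    simp only [Finset.sum_range_succ, Finset.sum_range_zero, hf, hq0, hq1, hq2, map_mul, map_pow,
      map_neg, map_one, Nat.descFactorial_zero, Nat.descFactorial_one, Nat.cast_one, map_natCast,
      Nat.sub_zero]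
    ring
  · rcases hn.eq_or_lt with rfl | hn
    · exact Or.inl (by simp)
    · refine Or.inr ?_
      suffices h : degreeOf 6 (∑ i ∈ Finset.range (n - 2), f (3 + i)) ≤ n - 3 by omega
      refine (degreeOf_sum_le 6 _ _).trans (Finset.sup_le fun i _ ↦ ?_)
      refine (degreeOf_C_mul_le _ _ _).trans ((degreeOf_mul_le _ _ _).trans ?_)
      rw [hq6, zero_add]
      refine (degreeOf_pow_le _ _ _).trans ?_
      rw [degreeOf_X, if_pos rfl]
      omega
end

section
/- Let k be a field of characteristic 0, R = k[x₁, x₂, x₃, y₁, y₂, y₃, z], D the k-derivation of R with D(x_i) = 0,D(y_i) = x_i³ for i = 1,2,3, and D(z) = (x₁x₂x₃)², and A = ker D. Grade R by ℤ³ with deg(x₁) = (1,0,0), deg(x₂) = (0,1,0), deg(x₃) = (0,0,1), deg(y_i) = 3·deg(x_i), and deg(z) = (2,2,2). If f ∈ A is homogeneous of multidegree (d₁, d₂, d₃) with respect to this grading and it is NOT the case that d₁ ≡ d₂ ≡ d₃ (mod 3), then f² lies in the ideal of A generated by x₁, x₂, x₃; i.e., f² = x₁g₁ + x₂g₂ +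 x₃g₃ for some g₁, g₂, g₃ ∈ A. -/
open MvPolynomial

/-- The ℤ³-grading of `k[x₁,x₂,x₃,y₁,y₂,y₃,z]` with `deg xᵢ = eᵢ`, `deg yᵢ = 3eᵢ`,
`deg z = (2,2,2)`. -/
def robertsWeight : Fin 7 → Fin 3 → ℕ :=
  ![![1, 0, 0], ![0, 1, 0], ![0, 0, 1], ![3, 0, 0], ![0, 3, 0], ![0, 0, 3], ![2, 2, 2]]

namespace Roberts

section LocallyNilpotent

variable {σ K : Type*} [CommRing K]

theorem pow_derivation_mul_of_apply_eq_zero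
    (E : Derivation K (MvPolynomial σ K) (MvPolynomial σ K)) {u : MvPolynomial σ K}
    (hu : E u = 0) (m : ℕ) (q : MvPolynomial σ K) : E^[m] (q * u) = E^[m] q * u := by
  induction m generalizing q with
  | zero => rfl
  | succ m ih =>
    rw [Function.iterate_succ_apply, Function.iterate_succ_apply, ← ih]
    congr 1
    simp [Derivation.leibniz, hu, mul_comm]

theorem pow_derivation_mul_of_apply_apply_eq_zero
    (E : Derivation K (MvPolynomial σ K) (MvPolynomial σ K)) {u : MvPolynomial σ K}
    (hu : E (E u) = 0) (m : ℕ) (q : MvPolynomial σ K) (hq : E^[m] q = 0) :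
    E^[m + 1] (q * u) = 0 := by
  induction m generalizing q with
  | zero =>
    have hq' : q = 0 := hq
    simp [hq']
  | succ m ih =>
    have h : E (q * u) = E q * u + q * E u := by
      simp only [Derivation.leibniz, smul_eq_mul]; ring
    rw [Function.iterate_succ_apply, h, iterate_map_add, ih _ hq,
      pow_derivation_mul_of_apply_eq_zero E hu, hq, zero_mul, add_zero]

/-- A derivation whose square kills the variables is locally nilpotent. -/
theorem exists_iterate_derivation_eq_zero
    (E : Derivation K (MvPolynomial σ K) (MvPolynomial σ K))
    (hE : ∀ i, E (E (X i)) = 0) (q : MvPolynomial σ K) : ∃ m, E^[m] q = 0 := by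
  induction q using MvPolynomial.induction_on with
  | C a => exact ⟨1, by simp⟩
  | add p q hp hq =>
    obtain ⟨m, hm⟩ := hp
    obtain ⟨n, hn⟩ := hq
    refine ⟨m + n, ?_⟩
    rw [iterate_map_add, Function.iterate_add_apply _ _ _ q, hn, add_comm m n,
      Function.iterate_add_apply _ _ _ p, hm, iterate_map_zero, iterate_map_zero, add_zero]
  | mul_X p i hp =>
    obtain ⟨m, hm⟩ := hp
    exact ⟨m + 1, pow_derivation_mul_of_apply_apply_eq_zero E (hE i) m p hm⟩

end LocallyNilpotent

section SlTwo

variable (k : Type*) [Field k]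

/-- The polynomial ring `k[X₁,X₂,X₃,Y₁,Y₂,Y₃]`, with `Xᵢ` indexed by `inl` and `Yᵢ` by `inr`. -/
abbrev PairRing := MvPolynomial (Fin 3 ⊕ Fin 3) k

/-- The raising operator `∑ Xᵢ ∂/∂Yᵢ`. -/
noncomputable def raising : Derivation k (PairRing k) (PairRing k) :=
  mkDerivation k (Sum.elim (fun _ => 0) (fun i => X (Sum.inl i)))

/-- The lowering operator `∑ Yᵢ ∂/∂Xᵢ`. -/
noncomputable def lowering : Derivation k (PairRing k) (PairRing k) :=
  mkDerivation k (Sum.elim (fun i => X (Sum.inr i)) (fun _ => 0))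

/-- The weight operator `∑ Xᵢ ∂/∂Xᵢ - ∑ Yᵢ ∂/∂Yᵢ`. -/
noncomputable def weightOp : Derivation k (PairRing k) (PairRing k) :=
  mkDerivation k (Sum.elim (fun i => X (Sum.inl i)) (fun i => - X (Sum.inr i)))

variable {k}

theorem raising_lowering (q : PairRing k) :
    raising k (lowering k q) = lowering k (raising k q) + weightOp k q := by
  have h : ⁅raising k, lowering k⁆ = weightOp k := by
    refine MvPolynomial.derivation_ext fun i => ?_
    rcases i with i | i <;>
      simp [Derivation.commutator_apply, raising, lowering, weightOp, mkDerivation_X]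
  have := congrArg (fun E => E q) h
  simp only [Derivation.commutator_apply] at this
  rw [← this]; ring

theorem weightOp_raising (q : PairRing k) :
    weightOp k (raising k q) = raising k (weightOp k q) + 2 * raising k q := by
  have h : ⁅weightOp k, raising k⁆ = raising k + raising k := by
    refine MvPolynomial.derivation_ext fun i => ?_
    rcases i with i | i <;>
      simp [Derivation.commutator_apply, raising, weightOp, mkDerivation_X]
  have := congrArg (fun E => E q) h
  simp only [Derivation.commutator_apply, Derivation.add_apply] at this
  linear_combination this

theorem weightOp_lowering (q : PairRing k) :
    weightOp k (lowering k q) = lowering k (weightOp k q) - 2 * lowering k q := by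
  have h : ⁅weightOp k, lowering k⁆ = -(lowering k + lowering k) := by
    refine MvPolynomial.derivation_ext fun i => ?_
    rcases i with i | i <;>
      simp [Derivation.commutator_apply, lowering, weightOp, mkDerivation_X]
    ring
  have := congrArg (fun E => E q) h
  simp only [Derivation.commutator_apply, Derivation.add_apply, Derivation.neg_apply] at this
  linear_combination this

theorem iterate_raising_lowering (m w : ℕ) (q : PairRing k) (hq : weightOp k q = w * q) :
    (raising k)^[m + 1] (lowering k q) = lowering k ((raising k)^[m + 1] q)
      + (m + 1) * (w + m) * (raising k)^[m] q := by
  induction m generalizing w q with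
  | zero => simp [raising_lowering, hq]
  | succ m ih =>
    have hD : weightOp k (raising k q) = ((w + 2 : ℕ) : PairRing k) * raising k q := by
      rw [weightOp_raising, hq]
      simp [Derivation.leibniz]
      ring
    have hw : (raising k)^[m + 1] ((w : PairRing k) * q) = w * (raising k)^[m + 1] q := by
      rw [mul_comm, pow_derivation_mul_of_apply_eq_zero _ (by simp), mul_comm]
    rw [Function.iterate_succ_apply, raising_lowering, iterate_map_add, ih _ _ hD, hq, hw,
      ← Function.iterate_succ_apply, ← Function.iterate_succ_apply]
    push_cast
    ring

/-- The raising operator is surjective onto the spaces of positive weight. -/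
theorem exists_raising_eq [CharZero k] (w : ℕ) (hw : 0 < w) (q : PairRing k)
    (hq : weightOp k q = w * q) :
    ∃ h, raising k h = q ∧ weightOp k h = (w - 2) * h := by
  obtain ⟨m, hm⟩ := exists_iterate_derivation_eq_zero (raising k)
    (by rintro (i | i) <;> simp [raising, mkDerivation_X]) q
  induction m generalizing q with
  | zero =>
    have hq' : q = 0 := hm
    exact ⟨0, by simp [hq']⟩
  | succ m ih =>
    have hFq : weightOp k (lowering k q) = (w - 2) * lowering k q := by
      rw [weightOp_lowering, hq]
      simp [Derivation.leibniz]
      ring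
    have h2 : raising k 2 = 0 := by exact_mod_cast (raising k).map_natCast 2
    set c : ℕ := (m + 1) * (w + m) with hc
    have hc0 : (c : k) ≠ 0 := by
      rw [Nat.cast_ne_zero]; positivity
    have hCc : (C (c : k)⁻¹ : PairRing k) * c = 1 := by
      rw [← map_natCast (C : k →+* PairRing k) c, ← C_mul, inv_mul_cancel₀ hc0, C_1]
    obtain ⟨h, h1, h2⟩ := ih (raising k (lowering k q) - c * q) (by
      rw [map_sub, weightOp_raising, hFq]
      simp [Derivation.leibniz, hq, h2]
      ring) (by
      have := iterate_raising_lowering m w q hq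
      rw [hm, map_zero, zero_add, Function.iterate_succ_apply] at this
      rw [iterate_map_sub, this, mul_comm (c : PairRing k),
        pow_derivation_mul_of_apply_eq_zero _ (by simp), hc]
      push_cast
      ring)
    refine ⟨C (c : k)⁻¹ * (lowering k q - h), ?_, ?_⟩
    · simp only [Derivation.leibniz, derivation_C, map_sub, h1, smul_eq_mul]
      linear_combination q * hCc
    · simp only [Derivation.leibniz, derivation_C, map_sub, h2, hFq,
        smul_eq_mul]
      ring

end SlTwo

section Lift

variable (k : Type*) [Field k]

/-- The index of the variable `xᵢ`. -/
def xIdx : Fin 3 → Fin 7 := ![0, 1, 2]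

/-- The index of the variable `yᵢ`. -/
def yIdx : Fin 3 → Fin 7 := ![3, 4, 5]

/-- The grading `robertsWeight` reduced modulo `3`. -/
def weightMod : Fin 7 → Fin 3 → ZMod 3 := fun s i => robertsWeight s i

/-- The substitution `Xᵢ ↦ xᵢ³`, `Yᵢ ↦ yᵢ`. -/
noncomputable def cubeLift : PairRing k →ₐ[k] MvPolynomial (Fin 7) k :=
  aeval (Sum.elim (fun i => X (xIdx i) ^ 3) (fun i => X (yIdx i)))

variable {k}

@[simp]
theorem cubeLift_inl (i : Fin 3) : cubeLift k (X (Sum.inl i)) = X (xIdx i) ^ 3 := by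
  simp [cubeLift]

@[simp]
theorem cubeLift_inr (i : Fin 3) : cubeLift k (X (Sum.inr i)) = X (yIdx i) := by
  simp [cubeLift]

@[simp]
theorem raising_inl (i : Fin 3) : raising k (X (Sum.inl i)) = 0 := by
  simp [raising, mkDerivation_X]

@[simp]
theorem raising_inr (i : Fin 3) : raising k (X (Sum.inr i)) = X (Sum.inl i) := by
  simp [raising, mkDerivation_X]

@[simp]
theorem weightOp_inl (i : Fin 3) : weightOp k (X (Sum.inl i)) = X (Sum.inl i) := by
  simp [weightOp, mkDerivation_X]

theorem weightMod_xIdx (i : Fin 3) : weightMod (xIdx i) = Pi.single i 1 := by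
  revert i; decide

theorem weightMod_yIdx (i : Fin 3) : weightMod (yIdx i) = 0 := by
  revert i; decide

theorem weightMod_z : weightMod 6 = 2 := by decide

theorem robertsD_xIdx (i : Fin 3) : robertsD k (X (xIdx i)) = 0 := by
  fin_cases i <;> simp [robertsD, xIdx, mkDerivation_X]

theorem robertsD_yIdx (i : Fin 3) : robertsD k (X (yIdx i)) = X (xIdx i) ^ 3 := by
  fin_cases i <;> simp [robertsD, xIdx, yIdx, mkDerivation_X]

theorem robertsD_z : robertsD k (X 6) = (X 0 * X 1 * X 2) ^ 2 := by
  simp [robertsD, mkDerivation_X]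

theorem pderiv_z_xIdx (i : Fin 3) :
    pderiv 6 (X (xIdx i) : MvPolynomial (Fin 7) k) = 0 :=
  pderiv_X_of_ne (by revert i; decide)

theorem pderiv_z_yIdx (i : Fin 3) :
    pderiv 6 (X (yIdx i) : MvPolynomial (Fin 7) k) = 0 :=
  pderiv_X_of_ne (by revert i; decide)

theorem isWeightedHomogeneous_xIdx (i : Fin 3) :
    IsWeightedHomogeneous weightMod (X (xIdx i) : MvPolynomial (Fin 7) k) (Pi.single i 1) :=
  weightMod_xIdx i ▸ isWeightedHomogeneous_X k weightMod (xIdx i)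

theorem exists_xIdx_or_yIdx_or_eq (s : Fin 7) :
    (∃ i, s = xIdx i) ∨ (∃ i, s = yIdx i) ∨ s = 6 := by
  revert s; decide

theorem pderiv_z_robertsD (f : MvPolynomial (Fin 7) k) :
    pderiv 6 (robertsD k f) = robertsD k (pderiv 6 f) := by
  have h : ⁅(pderiv 6 : Derivation k (MvPolynomial (Fin 7) k) _), robertsD k⁆ = 0 := by
    refine MvPolynomial.derivation_ext fun s => ?_
    rw [Derivation.commutator_apply]
    rcases exists_xIdx_or_yIdx_or_eq s with ⟨i, rfl⟩ | ⟨i, rfl⟩ | rfl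
    · simp [-pderiv_X, robertsD_xIdx, pderiv_z_xIdx]
    · simp [-pderiv_X, robertsD_yIdx, pderiv_z_yIdx, pderiv_z_xIdx, Derivation.leibniz_pow]
    · have h0 := pderiv_z_xIdx (k := k) 0
      have h1 := pderiv_z_xIdx (k := k) 1
      have h2 := pderiv_z_xIdx (k := k) 2
      simp only [xIdx, Matrix.cons_val] at h0 h1 h2
      simp [-pderiv_X, robertsD_z, h0, h1, h2, Derivation.leibniz_pow, Derivation.leibniz]
  have := congrArg (fun E => E f) h
  simpa [Derivation.commutator_apply, sub_eq_zero] using this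

theorem robertsD_cubeLift (q : PairRing k) :
    robertsD k (cubeLift k q) = cubeLift k (raising k q) := by
  induction q using MvPolynomial.induction_on with
  | C a => simp [cubeLift]
  | add p q hp hq => simp [hp, hq]
  | mul_X p s hp =>
    rcases s with i | i
    · simp [hp, Derivation.leibniz, Derivation.leibniz_pow, robertsD_xIdx]
    · simp [hp, Derivation.leibniz, robertsD_yIdx]

theorem pderiv_z_cubeLift (q : PairRing k) : pderiv 6 (cubeLift k q) = 0 := by
  induction q using MvPolynomial.induction_on with
  | C a => simp [cubeLift]
  | add p q hp hq => simp [hp, hq]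
  | mul_X p s hp =>
    rcases s with i | i
    · simp [-pderiv_X, hp, Derivation.leibniz, Derivation.leibniz_pow, pderiv_z_xIdx]
    · simp [-pderiv_X, hp, Derivation.leibniz, pderiv_z_yIdx]

theorem isWeightedHomogeneous_cubeLift (q : PairRing k) :
    IsWeightedHomogeneous weightMod (cubeLift k q) 0 := by
  induction q using MvPolynomial.induction_on with
  | C a => simpa [cubeLift] using isWeightedHomogeneous_C weightMod a
  | add p q hp hq => simpa using hp.add hq
  | mul_X p s hp =>
    rw [map_mul, ← add_zero (0 : Fin 3 → ZMod 3)]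
    refine hp.mul ?_
    rcases s with i | i
    · have h3 : (3 : ℕ) • (Pi.single i 1 : Fin 3 → ZMod 3) = 0 := by revert i; decide
      simpa [h3] using (isWeightedHomogeneous_xIdx (k := k) i).pow 3
    · have := isWeightedHomogeneous_X k weightMod (yIdx i)
      rw [weightMod_yIdx] at this
      simpa using this

end Lift

section Invariants

variable {k : Type*} [Field k]

/-- Elements `g` of `k[x,y]` having, up to multiples of `3`, the multidegree of `xⱼ zⁿ`, and of
the weight needed for `(x₁x₂x₃)² g` to lie in the image of the derivation. -/
def IsLiftable (j l m : Fin 3) (n : ℕ) (g : MvPolynomial (Fin 7) k) : Prop :=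
  ∃ h : PairRing k,
    (n % 3 = 0 ∧ weightOp k h = 0 ∧ g = X (xIdx j) * cubeLift k h) ∨
    (n % 3 = 1 ∧ weightOp k h = -h ∧ g = X (xIdx l) ^ 2 * X (xIdx m) ^ 2 * cubeLift k h) ∨
    (n % 3 = 2 ∧ weightOp k h = -h ∧
      g = X (xIdx j) ^ 2 * X (xIdx l) * X (xIdx m) * cubeLift k h)

theorem IsLiftable.pderiv_z_eq_zero {j l m : Fin 3} {n : ℕ} {g : MvPolynomial (Fin 7) k}
    (hg : IsLiftable j l m n g) : pderiv 6 g = 0 := by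
  obtain ⟨h, ⟨-, -, rfl⟩ | ⟨-, -, rfl⟩ | ⟨-, -, rfl⟩⟩ := hg <;>
    simp [-pderiv_X, Derivation.leibniz, Derivation.leibniz_pow, pderiv_z_xIdx, pderiv_z_cubeLift]

theorem IsLiftable.isWeightedHomogeneous {j l m : Fin 3}
    (hs : Pi.single j 1 + Pi.single l 1 + Pi.single m 1 = (1 : Fin 3 → ZMod 3))
    {n : ℕ} {g : MvPolynomial (Fin 7) k} (hg : IsLiftable j l m n g) :
    IsWeightedHomogeneous weightMod g (Pi.single j 1 + n • 2) := by
  have h3 : (3 : Fin 3 → ZMod 3) = 0 := by decide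
  have hn : (n : Fin 3 → ZMod 3) = (n % 3 : ℕ) := by
    conv_lhs => rw [← Nat.div_add_mod n 3]
    push_cast
    rw [h3]; ring
  have hj := isWeightedHomogeneous_xIdx (k := k) j
  have hl := isWeightedHomogeneous_xIdx (k := k) l
  have hm := isWeightedHomogeneous_xIdx (k := k) m
  obtain ⟨h, ⟨hr, -, rfl⟩ | ⟨hr, -, rfl⟩ | ⟨hr, -, rfl⟩⟩ := hg <;>
    have hh := isWeightedHomogeneous_cubeLift h
  · convert hj.mul hh using 1
    simp [hn, hr]
  · convert ((hl.pow 2).mul (hm.pow 2)).mul hh using 1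
    simp only [nsmul_eq_mul, hn, hr]
    push_cast
    linear_combination -2 * hs + (Pi.single j 1) * h3
  · convert (((hj.pow 2).mul hl).mul hm).mul hh using 1
    simp only [nsmul_eq_mul, hn, hr]
    push_cast
    linear_combination - hs + h3

theorem IsLiftable.exists_robertsD_eq [CharZero k] {j l m : Fin 3}
    (hp : X (xIdx j) * X (xIdx l) * X (xIdx m) = (X 0 * X 1 * X 2 : MvPolynomial (Fin 7) k))
    {n : ℕ} {g : MvPolynomial (Fin 7) k} (hg : IsLiftable j l m n g) :
    ∃ g', IsLiftable j l m (n + 1) g' ∧ robertsD k g' = -((X 0 * X 1 * X 2) ^ 2 * g) := by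
  rw [← hp]
  obtain ⟨h, ⟨hr, hw, rfl⟩ | ⟨hr, hw, rfl⟩ | ⟨hr, hw, rfl⟩⟩ := hg
  · obtain ⟨h', h1, h2⟩ := exists_raising_eq 1 one_pos (-(X (Sum.inl j) * h)) (by
      simp [Derivation.leibniz, hw, mul_comm])
    refine ⟨_, ⟨h', Or.inr (Or.inl ⟨by lia, ?_, rfl⟩)⟩, ?_⟩
    · rw [h2]; push_cast; ring
    · simp [Derivation.leibniz, Derivation.leibniz_pow, robertsD_xIdx, robertsD_cubeLift, h1]
      ring
  · obtain ⟨h', h1, h2⟩ := exists_raising_eq 1 one_pos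
      (-(X (Sum.inl l) * X (Sum.inl m) * h)) (by
        simp [Derivation.leibniz, hw]
        ring)
    refine ⟨_, ⟨h', Or.inr (Or.inr ⟨by lia, ?_, rfl⟩)⟩, ?_⟩
    · rw [h2]; push_cast; ring
    · simp [Derivation.leibniz, Derivation.leibniz_pow, robertsD_xIdx, robertsD_cubeLift, h1]
      ring
  · obtain ⟨h', h1, h2⟩ := exists_raising_eq 2 two_pos
      (-(X (Sum.inl j) * X (Sum.inl l) * X (Sum.inl m) * h)) (by
        simp [Derivation.leibniz, hw]
        ring)
    refine ⟨_, ⟨h', Or.inl ⟨by lia, ?_, rfl⟩⟩, ?_⟩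
    · rw [h2]; push_cast; ring
    · simp [Derivation.leibniz, robertsD_xIdx, robertsD_cubeLift, h1]
      ring

/-- The divided power `zⁿ / n!`. -/
noncomputable def dividedZ (n : ℕ) : MvPolynomial (Fin 7) k := C (n.factorial : k)⁻¹ * X 6 ^ n

theorem dividedZ_zero : dividedZ 0 = (1 : MvPolynomial (Fin 7) k) := by simp [dividedZ]

theorem derivation_dividedZ_succ [CharZero k]
    (E : Derivation k (MvPolynomial (Fin 7) k) (MvPolynomial (Fin 7) k)) (n : ℕ) :
    E (dividedZ (n + 1)) = dividedZ n * E (X 6) := by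
  have h1 : ((n + 1 : ℕ) : k) ≠ 0 := Nat.cast_ne_zero.2 n.succ_ne_zero
  have h : (C ((n + 1).factorial : k)⁻¹ : MvPolynomial (Fin 7) k) * ((n + 1 : ℕ) : MvPolynomial (Fin 7) k) =
      C (n.factorial : k)⁻¹ := by
    rw [← map_natCast (C : k →+* MvPolynomial (Fin 7) k), ← C_mul, Nat.factorial_succ,
      Nat.cast_mul, mul_inv_rev, inv_mul_cancel_right₀ h1]
  simp only [dividedZ, Derivation.leibniz, derivation_C, Derivation.leibniz_pow, smul_eq_mul,
    nsmul_eq_mul, Nat.add_sub_cancel, ← h]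
  ring

theorem isWeightedHomogeneous_dividedZ (n : ℕ) :
    IsWeightedHomogeneous weightMod (dividedZ n : MvPolynomial (Fin 7) k) (n • 2) :=
  (weightMod_z ▸ (isWeightedHomogeneous_X k weightMod 6).pow n).C_mul _

/-- Roberts' invariants with leading term `xⱼ zⁿ / n!`. -/
theorem exists_invariant_leading [CharZero k] (j : Fin 3) (n : ℕ) :
    ∃ β : MvPolynomial (Fin 7) k, robertsD k β = 0 ∧ (pderiv 6)^[n] β = X (xIdx j) ∧
      IsWeightedHomogeneous weightMod β (Pi.single j 1 + n • 2) := by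
  obtain ⟨l, m, hp, hs⟩ : ∃ l m : Fin 3,
      X (xIdx j) * X (xIdx l) * X (xIdx m) = (X 0 * X 1 * X 2 : MvPolynomial (Fin 7) k) ∧
      Pi.single j 1 + Pi.single l 1 + Pi.single m 1 = (1 : Fin 3 → ZMod 3) := by
    fin_cases j
    · exact ⟨1, 2, by simp [xIdx], by decide⟩
    · exact ⟨0, 2, by simp [xIdx, mul_comm], by decide⟩
    · exact ⟨0, 1, by simp [xIdx]; ring, by decide⟩
  choose! next hnext using fun n (g : MvPolynomial (Fin 7) k) (hg : IsLiftable j l m n g) =>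
    hg.exists_robertsD_eq hp
  let g : ℕ → MvPolynomial (Fin 7) k := fun n => Nat.rec (X (xIdx j)) next n
  have hg : ∀ n, IsLiftable j l m n (g n) := by
    intro n
    induction n with
    | zero => exact ⟨1, Or.inl ⟨rfl, by simp, by simp [g]⟩⟩
    | succ n ih => exact (hnext n _ ih).1
  have hgD : ∀ n, robertsD k (g (n + 1)) = -((X 0 * X 1 * X 2) ^ 2 * g n) :=
    fun n => (hnext n _ (hg n)).2
  let β : ℕ → MvPolynomial (Fin 7) k :=
    fun n => ∑ ij ∈ Finset.HasAntidiagonal.antidiagonal n, g ij.1 * dividedZ ij.2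
  have hβ : ∀ n, (pderiv 6)^[n] (β n) = X (xIdx j) := by
    intro n
    induction n with
    | zero => simp [β, g, dividedZ_zero]
    | succ n ih =>
      rw [Function.iterate_succ_apply, ← ih]
      congr 1
      simp only [β, Finset.Nat.sum_antidiagonal_succ', map_add, map_sum, Derivation.leibniz,
        derivation_dividedZ_succ, (hg _).pderiv_z_eq_zero, pderiv_X_self, dividedZ_zero]
      simp
  refine ⟨β n, ?_, hβ n, ?_⟩
  · have h0 : robertsD k (g 0) = 0 := robertsD_xIdx j
    cases n with
    | zero => simp [β, h0, dividedZ_zero]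
    | succ n =>
      have h1 : robertsD k (β (n + 1)) =
          (∑ ij ∈ Finset.HasAntidiagonal.antidiagonal (n + 1), g ij.1 * robertsD k (dividedZ ij.2)) +
          ∑ ij ∈ Finset.HasAntidiagonal.antidiagonal (n + 1), dividedZ ij.2 * robertsD k (g ij.1) := by
        simp [β, Derivation.leibniz, Finset.sum_add_distrib]
      rw [h1, Finset.Nat.sum_antidiagonal_succ', Finset.Nat.sum_antidiagonal_succ]
      simp only [derivation_dividedZ_succ, robertsD_z, hgD, h0, dividedZ_zero, Derivation.map_one_eq_zero,
        mul_zero, zero_add, ← Finset.sum_add_distrib]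
      exact Finset.sum_eq_zero fun ij _ => by ring
  · refine IsWeightedHomogeneous.sum _ _ _ fun ij hij => ?_
    convert ((hg ij.1).isWeightedHomogeneous hs).mul (isWeightedHomogeneous_dividedZ ij.2) using 1
    rw [← Finset.HasAntidiagonal.mem_antidiagonal.1 hij, add_smul, add_assoc]

theorem weight_weightMod_apply (s : Fin 7 →₀ ℕ) (i : Fin 3) :
    Finsupp.weight weightMod s i = s (xIdx i) + 2 * s 6 := by
  have h3 : (3 : ZMod 3) = 0 := by decide
  rw [Finsupp.weight_eq_sum, Fin.sum_univ_seven]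
  fin_cases i <;> simp [weightMod, robertsWeight, xIdx, h3, mul_comm]

theorem apply_z_eq_zero_of_pderiv_eq_zero [CharZero k] {b : MvPolynomial (Fin 7) k}
    (hb : pderiv 6 b = 0) {s : Fin 7 →₀ ℕ} (hs : coeff s b ≠ 0) : s 6 = 0 := by
  by_contra h
  have := coeff_pderiv (i := 6) b (s - Finsupp.single 6 1)
  rw [hb, coeff_zero, Finsupp.sub_add_single_one_cancel h] at this
  rcases mul_eq_zero.1 this.symm with h' | h'
  · exact hs h'
  · exact Nat.cast_add_one_ne_zero _ h'

theorem X_mul_X_dvd [CharZero k] {b : MvPolynomial (Fin 7) k} (hb : pderiv 6 b = 0)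
    {e : Fin 3 → ZMod 3} (he : IsWeightedHomogeneous weightMod b e) {i j : Fin 3}
    (hij : if i = j then e i = 2 else e i ≠ 0 ∧ e j ≠ 0) :
    X (xIdx i) * X (xIdx j) ∣ b := by
  have hX : (X (xIdx i) * X (xIdx j) : MvPolynomial (Fin 7) k) =
      monomial (Finsupp.single (xIdx i) 1 + Finsupp.single (xIdx j) 1) 1 := by
    simp [X, monomial_mul]
  rw [hX, monomial_one_dvd_iff_modMonomial_eq_zero]
  ext s
  by_cases hs : Finsupp.single (xIdx i) 1 + Finsupp.single (xIdx j) 1 ≤ s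
  · rw [coeff_modMonomial_of_le _ hs, coeff_zero]
  rw [coeff_modMonomial_of_not_le _ hs, coeff_zero]
  by_contra hc
  refine hs ?_
  have hw (i : Fin 3) : (s (xIdx i) : ZMod 3) = e i := by
    rw [← he hc, weight_weightMod_apply, apply_z_eq_zero_of_pderiv_eq_zero hb hc]; simp
  have h0 (i : Fin 3) (h : e i ≠ 0) : 1 ≤ s (xIdx i) := by
    by_contra! h'
    rw [← hw, Nat.lt_one_iff.1 h'] at h
    exact h Nat.cast_zero
  have hinj : ∀ i j, xIdx i = xIdx j → i = j := by decide
  intro v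
  rw [Finsupp.add_apply, Finsupp.single_apply, Finsupp.single_apply]
  split_ifs with h1 h2 h2
  · have hij' := hinj _ _ (h1.trans h2.symm)
    rw [if_pos hij', ← hw] at hij
    rw [← h1]
    by_contra! h'
    interval_cases s (xIdx i) <;> revert hij <;> decide
  · subst h1
    split_ifs at hij with hij'
    · exact h0 i (by rw [hij]; decide)
    · exact h0 i hij.1
  · subst h2
    split_ifs at hij with hij'
    · exact absurd (congrArg xIdx hij') h1
    · exact h0 j hij.2
  · exact Nat.zero_le _

theorem isWeightedHomogeneous_of_X_mul {M : Type*} [AddCancelCommMonoid M] {σ : Type*}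
    {w : σ → M} {i : σ} {c : MvPolynomial σ k} {n n' : M}
    (h : IsWeightedHomogeneous w (X i * c) n) (hn : w i + n' = n) :
    IsWeightedHomogeneous w c n' := by
  intro s hs
  rw [← coeff_X_mul s i] at hs
  have := h hs
  rw [map_add, Finsupp.weight_single, one_smul, ← hn] at this
  exact add_left_cancel this

theorem isWeightedHomogeneous_iterate_pderiv_z {f : MvPolynomial (Fin 7) k} {d : Fin 3 → ZMod 3}
    (hf : IsWeightedHomogeneous weightMod f d) (n : ℕ) :
    IsWeightedHomogeneous weightMod ((pderiv 6)^[n] f) (d + n • 1) := by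
  have h3 : (3 : Fin 3 → ZMod 3) = 0 := by decide
  induction n with
  | zero => simpa using hf
  | succ n ih =>
    rw [Function.iterate_succ_apply']
    refine ih.pderiv ?_
    rw [weightMod_z, add_smul]
    linear_combination h3

/-- Membership in the ideal of the invariant ring generated by `x₁, x₂, x₃`. -/
def IsInvariantCombination (f : MvPolynomial (Fin 7) k) : Prop :=
  ∃ g : Fin 3 → MvPolynomial (Fin 7) k,
    (∀ i, robertsD k (g i) = 0) ∧ f = ∑ i, X (xIdx i) * g i

theorem IsInvariantCombination.add {f g : MvPolynomial (Fin 7) k}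
    (hf : IsInvariantCombination f) (hg : IsInvariantCombination g) :
    IsInvariantCombination (f + g) := by
  obtain ⟨a, ha, rfl⟩ := hf
  obtain ⟨b, hb, rfl⟩ := hg
  exact ⟨a + b, fun i => by simp [ha, hb], by simp [mul_add, Finset.sum_add_distrib]⟩

theorem IsInvariantCombination.mul {f a : MvPolynomial (Fin 7) k}
    (hf : IsInvariantCombination f) (ha : robertsD k a = 0) :
    IsInvariantCombination (f * a) := by
  obtain ⟨g, hg, rfl⟩ := hf
  exact ⟨fun i => g i * a, fun i => by simp [Derivation.leibniz, hg, ha],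
    by simp [Finset.sum_mul, mul_assoc]⟩

theorem isInvariantCombination_X (i : Fin 3) :
    IsInvariantCombination (X (xIdx i) : MvPolynomial (Fin 7) k) := by
  refine ⟨fun l => if l = i then 1 else 0, fun l => ?_, by simp⟩
  dsimp only
  split_ifs <;> simp

theorem robertsD_eq_zero_of_X_mul {i : Fin 3} {c : MvPolynomial (Fin 7) k}
    (h : robertsD k (X (xIdx i) * c) = 0) : robertsD k c = 0 := by
  simpa [Derivation.leibniz, robertsD_xIdx] using h

theorem pderiv_z_eq_zero_of_X_mul {i : Fin 3} {c : MvPolynomial (Fin 7) k}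
    (h : pderiv 6 (X (xIdx i) * c) = 0) : pderiv 6 c = 0 := by
  simpa [-pderiv_X, Derivation.leibniz, pderiv_z_xIdx] using h

/-- An invariant whose coefficients with respect to `z` are all divisible by some `xᵢ xⱼ` for
reasons of degree lies in the ideal of invariants generated by `x₁, x₂, x₃`. -/
theorem isInvariantCombination_of_isWeightedHomogeneous [CharZero k] {d : Fin 3 → ZMod 3}
    (hd : ∀ t : ZMod 3, ∃ i j : Fin 3,
      if i = j then d i + t = 2 else d i + t ≠ 0 ∧ d j + t ≠ 0)
    {f : MvPolynomial (Fin 7) k} (hf : robertsD k f = 0)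
    (hhom : IsWeightedHomogeneous weightMod f d) : IsInvariantCombination f := by
  have h3 : (3 : Fin 3 → ZMod 3) = 0 := by decide
  obtain ⟨n, hn⟩ := exists_iterate_derivation_eq_zero
    (pderiv 6 : Derivation k (MvPolynomial (Fin 7) k) _)
    (fun s => by rw [pderiv_X, Pi.single_apply]; split_ifs <;> simp) f
  induction n generalizing f with
  | zero =>
    have hf0 : f = 0 := hn
    exact ⟨0, by simp, by simp [hf0]⟩
  | succ n ih =>
    have hb : pderiv 6 ((pderiv 6)^[n] f) = 0 := by
      rw [← Function.iterate_succ_apply' (pderiv 6) n f, hn]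
    have hDb : robertsD k ((pderiv 6)^[n] f) = 0 := by
      have hcomm : Function.Commute (robertsD k) (pderiv 6) :=
        fun q => (pderiv_z_robertsD q).symm
      rw [(hcomm.iterate_right n).eq, hf, iterate_map_zero]
    have he := isWeightedHomogeneous_iterate_pderiv_z hhom n
    obtain ⟨i, j, hij⟩ := hd n
    obtain ⟨c, hc⟩ := X_mul_X_dvd hb he (i := i) (j := j) (by simpa using hij)
    have hc' := hc
    rw [mul_assoc] at hc'
    rw [hc'] at hb hDb he
    have hDc : robertsD k c = 0 := robertsD_eq_zero_of_X_mul (robertsD_eq_zero_of_X_mul hDb)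
    have hzc : pderiv 6 c = 0 := pderiv_z_eq_zero_of_X_mul (pderiv_z_eq_zero_of_X_mul hb)
    have hec : IsWeightedHomogeneous weightMod c
        (d + n • 1 - Pi.single i 1 - Pi.single j 1) :=
      isWeightedHomogeneous_of_X_mul (n := d + n • 1 - Pi.single i 1)
        (isWeightedHomogeneous_of_X_mul he (by rw [weightMod_xIdx]; abel))
        (by rw [weightMod_xIdx]; abel)
    obtain ⟨β, hβD, hβz, hβe⟩ := exists_invariant_leading (k := k) j n
    have hD : robertsD k (X (xIdx i) * (β * c)) = 0 := by
      simp [Derivation.leibniz, robertsD_xIdx, hβD, hDc]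
    have hrest : IsInvariantCombination (f - X (xIdx i) * (β * c)) := by
      refine ih (by rw [map_sub, hf, hD, sub_zero]) (hhom.sub ?_) ?_
      · have hd' : Pi.single i 1 + (Pi.single j 1 + n • 2 +
            (d + n • 1 - Pi.single i 1 - Pi.single j 1)) = d := by
          simp only [nsmul_eq_mul]
          linear_combination (n : Fin 3 → ZMod 3) * h3
        exact hd' ▸ (isWeightedHomogeneous_xIdx i).mul (hβe.mul hec)
      · have hu : pderiv 6 (X (xIdx i) * c) = 0 := by
          simp [-pderiv_X, Derivation.leibniz, pderiv_z_xIdx, hzc]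
        rw [iterate_map_sub, hc, mul_left_comm, pow_derivation_mul_of_apply_eq_zero _ hu, hβz]
        ring
    have := hrest.add ((isInvariantCombination_X i).mul (a := β * c)
      (by simp [Derivation.leibniz, hβD, hDc]))
    rwa [sub_add_cancel] at this

theorem isWeightedHomogeneous_weightMod {f : MvPolynomial (Fin 7) k} {d : Fin 3 → ℕ}
    (h : IsWeightedHomogeneous robertsWeight f d) :
    IsWeightedHomogeneous weightMod f (fun i => (d i : ZMod 3)) := by
  intro s hs
  rw [← h hs]
  ext i
  simp [Finsupp.weight_eq_sum, weightMod]

/-- The residues of a multidegree that is not constant modulo `3`, or those of its double,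
satisfy the divisibility condition of `isInvariantCombination_of_isWeightedHomogeneous`. -/
theorem forall_exists_or_forall_exists_two_mul (d : Fin 3 → ZMod 3)
    (hd : ¬ (d 0 = d 1 ∧ d 1 = d 2)) :
    (∀ t : ZMod 3, ∃ i j : Fin 3,
      if i = j then d i + t = 2 else d i + t ≠ 0 ∧ d j + t ≠ 0) ∨
    (∀ t : ZMod 3, ∃ i j : Fin 3,
      if i = j then (2 • d) i + t = 2 else (2 • d) i + t ≠ 0 ∧ (2 • d) j + t ≠ 0) := by
  revert d
  decide

end Invariants

end Roberts

open Roberts in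
/-- If `f` is an invariant of Roberts' action which is multihomogeneous of multidegree
`(d₁, d₂, d₃)` and it is not the case that `d₁ ≡ d₂ ≡ d₃ (mod 3)`, then `f²` lies in the
ideal of the invariant ring generated by `x₁, x₂, x₃`. -/
theorem stmt_16 (k : Type*) [Field k] [CharZero k]
    (f : MvPolynomial (Fin 7) k) (hf : robertsD k f = 0) (d₁ d₂ d₃ : ℕ)
    (hhom : IsWeightedHomogeneous robertsWeight f ![d₁, d₂, d₃])
    (hd : ¬ (d₁ % 3 = d₂ % 3 ∧ d₂ % 3 = d₃ % 3)) :
    ∃ g₁ g₂ g₃ : MvPolynomial (Fin 7) k,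
      robertsD k g₁ = 0 ∧ robertsD k g₂ = 0 ∧ robertsD k g₃ = 0 ∧
      f ^ 2 = X 0 * g₁ + X 1 * g₂ + X 2 * g₃ := by
  have hd' : ¬ (((d₁ : ZMod 3) = d₂) ∧ ((d₂ : ZMod 3) = d₃)) := by
    rwa [ZMod.natCast_eq_natCast_iff', ZMod.natCast_eq_natCast_iff']
  have hmod := isWeightedHomogeneous_weightMod hhom
  have key : IsInvariantCombination (f ^ 2) := by
    rcases forall_exists_or_forall_exists_two_mul
      (fun i => ((![d₁, d₂, d₃] : Fin 3 → ℕ) i : ZMod 3)) hd' with h | h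
    · rw [sq]
      exact (isInvariantCombination_of_isWeightedHomogeneous h hf hmod).mul hf
    · exact isInvariantCombination_of_isWeightedHomogeneous h
        (by simp [Derivation.leibniz_pow, hf]) (hmod.pow 2)
  obtain ⟨g, hg, h⟩ := key
  exact ⟨g 0, g 1, g 2, hg 0, hg 1, hg 2, by rw [h, Fin.sum_univ_three]; rfl⟩
end
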